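/- Let u : [0,1]² → ℝ be continuous on [0,1]², twice continuously differentiable on the open square (0,1)², and satisfy Δu(x) ≥ 1 for all x ∈ (0,1)². Then for every t ∈ ℝ, every connected component of the set {x ∈ [0,1]² : u(x) ≤ t} is simply connected (as a topological space with the subspace topology). -/

import Mathlib

/-- The Laplacian `Δu(x) = ∂²u/∂x₁²(x) + ∂²u/∂x₂²(x)` in the plane. -/
noncomputable def laplacian (u : EuclideanSpace ℝ (Fin 2) → ℝ)
    (x : EuclideanSpace ℝ (Fin 2)) : ℝ :=
  ∑ i : Fin 2,
    fderiv ℝ (fun y => fderiv ℝ u y (EuclideanSpace.single i 1)) x (EuclideanSpace.single i 1)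

/-- The closed unit square `[0,1]²`. -/
def unitSquare : Set (EuclideanSpace ℝ (Fin 2)) := {x | ∀ i, x i ∈ Set.Icc (0 : ℝ) 1}

/-- The open unit square `(0,1)²`. -/
def openUnitSquare : Set (EuclideanSpace ℝ (Fin 2)) := {x | ∀ i, x i ∈ Set.Ioo (0 : ℝ) 1}

namespace SublevelTopology

open Set Filter Topology Metric

section

/-- In a compact set, a connected component lying in an open set lies in a relatively clopen part
of the compact set that is contained in the open set. -/
theorem exists_clopen_split {X : Type*} [TopologicalSpace X] [T2Space X] {S U : Set X}
    (hS : IsCompact S) {x : X} (hx : x ∈ S) (hU : IsOpen U)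
    (hC : connectedComponentIn S x ⊆ U) :
    ∃ A B : Set X, IsClosed A ∧ IsClosed B ∧ A ∪ B = S ∧ Disjoint A B ∧
      connectedComponentIn S x ⊆ A ∧ A ⊆ U := by
  have : CompactSpace S := isCompact_iff_compactSpace.mp hS
  have hSc : IsClosed S := hS.isClosed
  rw [connectedComponentIn_eq_image hx] at hC ⊢
  have hsub : connectedComponent (⟨x, hx⟩ : S) ⊆ ((↑) : S → X) ⁻¹' U := image_subset_iff.mp hC
  rw [connectedComponent_eq_iInter_isClopen] at hsub
  have hdir : Directed (· ⊇ ·)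
      (fun s : { s : Set S // IsClopen s ∧ (⟨x, hx⟩ : S) ∈ s } => (s : Set S)) := by
    intro s s'
    exact ⟨⟨s.1 ∩ s'.1, s.2.1.inter s'.2.1, s.2.2, s'.2.2⟩, inter_subset_left, inter_subset_right⟩
  have : Nonempty { s : Set S // IsClopen s ∧ (⟨x, hx⟩ : S) ∈ s } :=
    ⟨⟨univ, isClopen_univ, mem_univ _⟩⟩
  obtain ⟨⟨Z, hZ, hxZ⟩, hZU⟩ := exists_subset_nhds_of_isCompact' hdir
    (fun s => s.2.1.isClosed.isCompact) (fun s => s.2.1.isClosed)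
    (fun y hy => (hU.preimage continuous_subtype_val).mem_nhds (hsub hy))
  refine ⟨(↑) '' Z, (↑) '' Zᶜ, hSc.isClosedEmbedding_subtypeVal.isClosedMap _ hZ.isClosed,
    hSc.isClosedEmbedding_subtypeVal.isClosedMap _ hZ.compl.isClosed, ?_, ?_, ?_, ?_⟩
  · rw [← image_union, union_compl_self, image_univ, Subtype.range_coe]
  · exact disjoint_image_of_injective Subtype.val_injective disjoint_compl_right
  · exact image_mono (hZ.connectedComponent_subset hxZ)
  · exact image_subset_iff.mpr hZU

/-- Boundary bumping: if a compact connected set is not contained in an open set `O`, then neither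
are its pieces in a closed set `F ⊇ O`. -/
theorem connectedComponentIn_inter_not_subset {X : Type*} [TopologicalSpace X] [T2Space X]
    {K F O : Set X} (hK : IsCompact K) (hKc : IsPreconnected K) (hF : IsClosed F) (hO : IsOpen O)
    (hOF : O ⊆ F) {x : X} (hx : x ∈ K) (hxF : x ∈ F) (hKO : ¬ K ⊆ O) :
    ¬ connectedComponentIn (K ∩ F) x ⊆ O := by
  intro hC
  obtain ⟨A, B, hA, hB, hAB, hdis, hCA, hAO⟩ :=
    exists_clopen_split (hK.inter_right hF) ⟨hx, hxF⟩ hO hC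
  apply hKO
  have hxA : x ∈ A := hCA (mem_connectedComponentIn ⟨hx, hxF⟩)
  have hcov : K ⊆ A ∪ (B ∪ Oᶜ) := by
    intro y hy
    by_cases hyO : y ∈ O
    · have : y ∈ A ∪ B := hAB ▸ ⟨hy, hOF hyO⟩
      rcases this with h | h
      · exact Or.inl h
      · exact Or.inr (Or.inl h)
    · exact Or.inr (Or.inr hyO)
  by_contra hnot
  obtain ⟨y, hyK, hyO⟩ := not_subset.mp hnot
  obtain ⟨z, -, hzA, hzB⟩ := isPreconnected_closed_iff.mp hKc A (B ∪ Oᶜ) hA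
    (hB.union hO.isClosed_compl) hcov ⟨x, hx, hxA⟩ ⟨y, hyK, Or.inr hyO⟩
  rcases hzB with h | h
  · exact disjoint_left.mp hdis hzA h
  · exact h (hAO hzA)

theorem exists_continuous_log {A : Type*} [TopologicalSpace A] (H : C(unitInterval × A, ℂ))
    (hH : ∀ p, H p ≠ 0) (f : C(A, ℂ)) (hf : ∀ a, Complex.exp (f a) = H (0, a)) :
    ∃ L : C(unitInterval × A, ℂ), (∀ p, Complex.exp (L p) = H p) ∧ ∀ a, L (0, a) = f a := by
  let H' : C(unitInterval × A, {z : ℂ // z ≠ 0}) := ⟨fun p => ⟨H p, hH p⟩, by fun_prop⟩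
  have h0 : ∀ a, H' (0, a) = (⟨_, (f a).exp_ne_zero⟩ : {z : ℂ // z ≠ 0}) := by
    intro a
    apply Subtype.ext
    exact (hf a).symm
  refine ⟨Complex.isCoveringMap_exp.liftHomotopy H' f h0, fun p => ?_, fun a => ?_⟩
  · have := congrFun (Complex.isCoveringMap_exp.liftHomotopy_lifts H' f h0) p
    exact congrArg Subtype.val this
  · exact Complex.isCoveringMap_exp.liftHomotopy_zero H' f h0 a

/-- A continuous logarithm is determined up to a constant on a preconnected space. -/
theorem sub_eq_sub_of_exp_eq {X : Type*} [TopologicalSpace X] [PreconnectedSpace X] {f g : X → ℂ}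
    (hf : Continuous f) (hg : Continuous g) (h : ∀ x, Complex.exp (f x) = Complex.exp (g x))
    (x y : X) : f x - g x = f y - g y := by
  have key : ∀ z, ∃ n : ℤ, f z - g z = n * (2 * Real.pi * Complex.I) := by
    intro z
    obtain ⟨n, hn⟩ := Complex.exp_eq_exp_iff_exists_int.mp (h z)
    exact ⟨n, by rw [hn]; ring⟩
  choose n hn using key
  have hcont : Continuous (fun z => (n z : ℝ)) := by
    have : (fun z => (n z : ℝ)) = fun z => (f z - g z).im / (2 * Real.pi) := by
      funext z
      rw [hn z]
      have : Real.pi ≠ 0 := Real.pi_ne_zero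
      simp
    rw [this]
    fun_prop
  have hcz : Continuous n := Int.isClosedEmbedding_coe_real.isEmbedding.continuous_iff.mpr hcont
  have : n x = n y := PreconnectedSpace.constant inferInstance hcz
  rw [hn x, hn y, this]

end

section

theorem log_I_mul {z : ℂ} (hz : z ≠ 0) (hre : 0 ≤ z.re) :
    Complex.log (Complex.I * z) = Complex.log z + (Real.pi / 2 : ℝ) * Complex.I := by
  have h1 := Complex.abs_arg_le_pi_div_two_iff.mpr hre
  have h2 := abs_le.mp h1
  have hpi := Real.pi_pos
  rw [Complex.log_mul Complex.I_ne_zero hz, Complex.log_I]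
  · push_cast; ring
  · rw [Complex.arg_I]; constructor <;> linarith [h2.1, h2.2]

theorem log_neg_I_mul {z : ℂ} (hz : z ≠ 0) (hre : 0 ≤ z.re) (him : 0 ≤ z.im) :
    Complex.log (-Complex.I * z) = Complex.log z - (Real.pi / 2 : ℝ) * Complex.I := by
  have h1 := Complex.abs_arg_le_pi_div_two_iff.mpr hre
  have h2 := abs_le.mp h1
  have h3 := Complex.arg_nonneg_iff.mpr him
  have hpi := Real.pi_pos
  rw [Complex.log_mul (neg_ne_zero.mpr Complex.I_ne_zero) hz, Complex.log_neg_I]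
  · push_cast; ring
  · rw [Complex.arg_neg_I]; constructor <;> linarith [h2.1, h2.2]

theorem mem_slitPlane_of_re_nonneg {z : ℂ} (hz : z ≠ 0) (hre : 0 ≤ z.re) :
    z ∈ Complex.slitPlane := by
  rw [Complex.mem_slitPlane_iff]
  by_contra! h
  exact hz (Complex.ext (le_antisymm h.1 hre) h.2)

/-- A path going from the bottom to the top of a vertical strip meets every connected set that
goes from the left of the strip to its right. -/
theorem exists_mem_of_crossing {D : Set (ℝ × ℝ)} (hD : IsPreconnected D) {a b : ℝ}
    (α : C(unitInterval, ℝ × ℝ)) (hα : ∀ s, (α s).1 ∈ Icc a b)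
    (h0 : ∀ p ∈ D, (α 0).2 ≤ p.2) (h1 : ∀ p ∈ D, p.2 ≤ (α 1).2)
    {p q : ℝ × ℝ} (hp : p ∈ D) (hq : q ∈ D) (hpa : p.1 ≤ a) (hqb : b ≤ q.1) :
    ∃ s, α s ∈ D := by
  by_contra! hnot
  have : PreconnectedSpace D := isPreconnected_iff_preconnectedSpace.mp hD
  let H : C(unitInterval × D, ℂ) :=
    ⟨fun x => (((α x.1).1 - x.2.1.1 : ℝ) : ℂ) + (((α x.1).2 - x.2.1.2 : ℝ) : ℂ) * Complex.I,
      by fun_prop⟩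
  have Hre : ∀ x, (H x).re = (α x.1).1 - x.2.1.1 := fun x => by simp [H]
  have Him : ∀ x, (H x).im = (α x.1).2 - x.2.1.2 := fun x => by simp [H]
  have H0 : ∀ x, H x ≠ 0 := by
    intro x hx
    have e1 := Hre x
    have e2 := Him x
    rw [hx] at e1 e2
    apply hnot x.1
    have : α x.1 = x.2.1 := by
      ext
      · simp at e1; linarith
      · simp at e2; linarith
    rw [this]
    exact x.2.2
  have hIm0 : ∀ y : D, (H (0, y)).im ≤ 0 := fun y => by rw [Him]; linarith [h0 y y.2]
  have hIm1 : ∀ y : D, 0 ≤ (H (1, y)).im := fun y => by rw [Him]; linarith [h1 y y.2]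
  have hlow : Continuous fun y : D =>
      Complex.log (Complex.I * H (0, y)) - (Real.pi / 2 : ℝ) * Complex.I := by
    refine Continuous.sub (Continuous.clog (by fun_prop) fun y => ?_) continuous_const
    refine mem_slitPlane_of_re_nonneg (mul_ne_zero Complex.I_ne_zero (H0 _)) ?_
    simpa using hIm0 y
  have hup : Continuous fun y : D =>
      Complex.log (-Complex.I * H (1, y)) + (Real.pi / 2 : ℝ) * Complex.I := by
    refine Continuous.add (Continuous.clog (by fun_prop) fun y => ?_) continuous_const
    refine mem_slitPlane_of_re_nonneg
      (mul_ne_zero (neg_ne_zero.mpr Complex.I_ne_zero) (H0 _)) ?_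
    simpa using hIm1 y
  have expI : Complex.exp ((Real.pi / 2 : ℝ) * Complex.I) = Complex.I := by
    push_cast
    exact Complex.exp_pi_div_two_mul_I
  obtain ⟨L, hL, hL0⟩ := exists_continuous_log H H0 ⟨_, hlow⟩ (fun y => by
    simp only [ContinuousMap.coe_mk]
    rw [Complex.exp_sub, Complex.exp_log (mul_ne_zero Complex.I_ne_zero (H0 _)), expI]
    field_simp)
  simp only [ContinuousMap.coe_mk] at hL0
  have hconst := sub_eq_sub_of_exp_eq (f := fun y : D => L (1, y)) (by fun_prop) hup (fun y => by
    rw [hL, Complex.exp_add,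
      Complex.exp_log (mul_ne_zero (neg_ne_zero.mpr Complex.I_ne_zero) (H0 _)), expI]
    linear_combination (H (1, y)) * Complex.I_sq) ⟨p, hp⟩ ⟨q, hq⟩
  have hPre : ∀ s, 0 ≤ (H (s, ⟨p, hp⟩)).re := fun s => by
    rw [Hre]; simp only; linarith [(hα s).1]
  have hQre : ∀ s, 0 ≤ (-H (s, ⟨q, hq⟩)).re := fun s => by
    rw [Complex.neg_re, Hre]; simp only; linarith [(hα s).2]
  have hQ0 : ∀ s, -H (s, ⟨q, hq⟩) ≠ 0 := fun s => neg_ne_zero.mpr (H0 _)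
  have eP := sub_eq_sub_of_exp_eq (f := fun s : unitInterval => L (s, ⟨p, hp⟩))
    (g := fun s => Complex.log (H (s, ⟨p, hp⟩))) (by fun_prop)
    (Continuous.clog (by fun_prop) fun s => mem_slitPlane_of_re_nonneg (H0 _) (hPre s))
    (fun s => by rw [hL, Complex.exp_log (H0 _)]) 0 1
  have eQ := sub_eq_sub_of_exp_eq (f := fun s : unitInterval => L (s, ⟨q, hq⟩))
    (g := fun s => Complex.log (-H (s, ⟨q, hq⟩)) + Real.pi * Complex.I) (by fun_prop)
    (Continuous.add (Continuous.clog (by fun_prop)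
      fun s => mem_slitPlane_of_re_nonneg (hQ0 s) (hQre s)) continuous_const)
    (fun s => by rw [hL, Complex.exp_add, Complex.exp_log (hQ0 s), Complex.exp_pi_mul_I]; ring) 0 1
  rw [hL0, log_I_mul (H0 _) (hPre 0)] at eP
  rw [log_neg_I_mul (H0 _) (hPre 1) (hIm1 _)] at hconst
  have c1 : Complex.I * H (0, ⟨q, hq⟩) = -Complex.I * -H (0, ⟨q, hq⟩) := by ring
  have c2 : -Complex.I * H (1, ⟨q, hq⟩) = Complex.I * -H (1, ⟨q, hq⟩) := by ring
  rw [hL0, c1, log_neg_I_mul (hQ0 0) (hQre 0) (by simpa using hIm0 ⟨q, hq⟩)] at eQ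
  rw [c2, log_I_mul (hQ0 1) (hQre 1)] at hconst
  have : (Real.pi : ℂ) * Complex.I = 0 := by
    push_cast at eP eQ hconst
    linear_combination (eP - eQ + hconst) / 2
  simp [Real.pi_ne_zero] at this

end

section

/-- The properties of a function with Laplacian at least `1` on a rectangle that are used below:
subtracting certain quadratic polynomials of Laplacian `1 / 2` leaves no interior local maximum, and
near an interior point the function is strictly convex in one of the coordinate directions. -/
structure IsAdmissible (u : ℝ × ℝ → ℝ) (a b c d : ℝ) : Prop where
  cont : ContinuousOn u (Icc a b ×ˢ Icc c d)
  not_max_fst : ∀ z ∈ Ioo a b ×ˢ Ioo c d, ∀ m : ℝ,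
    ¬ IsLocalMax (fun p : ℝ × ℝ => u p - (p.1 - m) ^ 2 / 4) z
  not_max_snd : ∀ z ∈ Ioo a b ×ˢ Ioo c d, ∀ m : ℝ,
    ¬ IsLocalMax (fun p : ℝ × ℝ => u p - (p.2 - m) ^ 2 / 4) z
  convex : ∀ z ∈ Ioo a b ×ˢ Ioo c d, ∃ r > 0,
    (∀ y, |y - z.2| ≤ r → StrictConvexOn ℝ (Icc (z.1 - r) (z.1 + r)) fun x => u (x, y)) ∨
    (∀ x, |x - z.1| ≤ r → StrictConvexOn ℝ (Icc (z.2 - r) (z.2 + r)) fun y => u (x, y))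

/-- The sublevel set of a function on a rectangle. -/
def sublevel (u : ℝ × ℝ → ℝ) (t a b c d : ℝ) : Set (ℝ × ℝ) :=
  {p | p ∈ Icc a b ×ˢ Icc c d ∧ u p ≤ t}

variable {u : ℝ × ℝ → ℝ} {t a b c d : ℝ}

theorem IsAdmissible.mono (hu : IsAdmissible u a b c d) {a' b' c' d' : ℝ} (ha : a ≤ a')
    (hb : b' ≤ b) (hc : c ≤ c') (hd : d' ≤ d) : IsAdmissible u a' b' c' d' := by
  have h : Ioo a' b' ×ˢ Ioo c' d' ⊆ Ioo a b ×ˢ Ioo c d :=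
    prod_mono (Ioo_subset_Ioo ha hb) (Ioo_subset_Ioo hc hd)
  exact ⟨hu.cont.mono (prod_mono (Icc_subset_Icc ha hb) (Icc_subset_Icc hc hd)),
    fun z hz => hu.not_max_fst z (h hz), fun z hz => hu.not_max_snd z (h hz),
    fun z hz => hu.convex z (h hz)⟩

theorem IsAdmissible.not_isLocalMax (hu : IsAdmissible u a b c d) {z : ℝ × ℝ}
    (hz : z ∈ Ioo a b ×ˢ Ioo c d) : ¬ IsLocalMax u z := by
  intro h
  refine hu.not_max_fst z hz z.1 ?_
  filter_upwards [h] with p hp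
  simp only [sub_self]
  nlinarith [sq_nonneg (p.1 - z.1)]

theorem IsAdmissible.swap (hu : IsAdmissible u a b c d) :
    IsAdmissible (u ∘ Prod.swap) c d a b := by
  refine ⟨hu.cont.comp continuous_swap.continuousOn fun p hp => ⟨hp.2, hp.1⟩, ?_, ?_, ?_⟩
  · intro z hz m h
    refine hu.not_max_snd z.swap ⟨hz.2, hz.1⟩ m ?_
    have := (continuous_swap.tendsto z.swap).eventually (by simpa [IsLocalMax, IsMaxFilter] using h)
    filter_upwards [this] with p hp
    simpa using hp
  · intro z hz m h
    refine hu.not_max_fst z.swap ⟨hz.2, hz.1⟩ m ?_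
    have := (continuous_swap.tendsto z.swap).eventually (by simpa [IsLocalMax, IsMaxFilter] using h)
    filter_upwards [this] with p hp
    simpa using hp
  · intro z hz
    obtain ⟨r, hr, h⟩ := hu.convex z.swap ⟨hz.2, hz.1⟩
    exact ⟨r, hr, h.symm⟩

theorem IsAdmissible.reflect (hu : IsAdmissible u a b c d) :
    IsAdmissible (fun p => u (p.1, -p.2)) a b (-d) (-c) := by
  have hc : Continuous fun p : ℝ × ℝ => (p.1, -p.2) := by fun_prop
  have hmem : ∀ z : ℝ × ℝ, z ∈ Ioo a b ×ˢ Ioo (-d) (-c) →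
      (z.1, -z.2) ∈ Ioo a b ×ˢ Ioo c d := fun z hz =>
    ⟨hz.1, by constructor <;> linarith [hz.2.1, hz.2.2]⟩
  refine ⟨hu.cont.comp hc.continuousOn fun p hp =>
    ⟨hp.1, by constructor <;> linarith [hp.2.1, hp.2.2]⟩, ?_, ?_, ?_⟩
  · intro z hz m h
    refine hu.not_max_fst _ (hmem z hz) m ?_
    have := (hc.tendsto (z.1, -z.2)).eventually (by simpa [IsLocalMax, IsMaxFilter] using h)
    filter_upwards [this] with p hp
    simpa using hp
  · intro z hz m h
    refine hu.not_max_snd _ (hmem z hz) (-m) ?_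
    have := (hc.tendsto (z.1, -z.2)).eventually (by simpa [IsLocalMax, IsMaxFilter] using h)
    filter_upwards [this] with p hp
    have e1 : (-p.2 - m) ^ 2 = (p.2 + m) ^ 2 := by ring
    have e2 : (-z.2 + m) ^ 2 = (z.2 - m) ^ 2 := by ring
    simpa [e1, e2] using hp
  · intro z hz
    obtain ⟨r, hr, h⟩ := hu.convex _ (hmem z hz)
    refine ⟨r, hr, ?_⟩
    rcases h with h | h
    · refine Or.inl fun y hy => h (-y) ?_
      rwa [show -y - (z.1, -z.2).2 = -(y - z.2) by simp; ring, abs_neg]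
    · refine Or.inr fun x hx => ?_
      have h' := h x hx
      refine ⟨convex_Icc _ _, fun y hy y' hy' hne s s' hs hs' hss => ?_⟩
      have := h'.2 (x := -y) (y := -y') (by constructor <;> simp only <;> linarith [hy.1, hy.2])
        (by constructor <;> simp only <;> linarith [hy'.1, hy'.2]) (by simpa using hne) hs hs' hss
      have e : s • -y + s' • -y' = -(s • y + s' • y') := by simp; ring
      rwa [e] at this

theorem isCompact_rect (a b c d : ℝ) : IsCompact (Icc a b ×ˢ Icc c d : Set (ℝ × ℝ)) :=
  isCompact_Icc.prod isCompact_Icc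

theorem convex_rect (a b c d : ℝ) : Convex ℝ (Icc a b ×ˢ Icc c d : Set (ℝ × ℝ)) :=
  (convex_Icc a b).prod (convex_Icc c d)

theorem IsAdmissible.isClosed_sublevel (hu : IsAdmissible u a b c d) (t : ℝ) :
    IsClosed (sublevel u t a b c d) :=
  hu.cont.preimage_isClosed_of_isClosed (isCompact_rect a b c d).isClosed isClosed_Iic

theorem sublevel_subset : sublevel u t a b c d ⊆ Icc a b ×ˢ Icc c d := fun _ h => h.1

theorem IsAdmissible.isCompact_sublevel (hu : IsAdmissible u a b c d) (t : ℝ) :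
    IsCompact (sublevel u t a b c d) :=
  (isCompact_rect a b c d).of_isClosed_subset (hu.isClosed_sublevel t) sublevel_subset

/-- A part of the sublevel set that crosses a thin box over a piece of the lower edge cannot be
separated, in the sublevel set, from that piece. -/
theorem IsAdmissible.false_of_crossing (hu : IsAdmissible u a b c d) {x₁ x₂ h : ℝ}
    (ha : a ≤ x₁) (hx : x₁ < x₂) (hb : x₂ ≤ b) (hh : 0 < h) (hd : c + h ≤ d)
    {A B : Set (ℝ × ℝ)} (hA : IsClosed A) (hB : IsClosed B) (hAB : A ∪ B = sublevel u t a b c d)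
    (hdis : Disjoint A B) (hE : Icc x₁ x₂ ×ˢ {c} ⊆ B)
    (hbd : ∀ p ∈ Icc x₁ x₂ ×ˢ Icc c (c + h), u p ≤ t + (x₂ - x₁) ^ 2 / 16)
    {D : Set (ℝ × ℝ)} (hD : IsPreconnected D) (hDA : D ⊆ A) (hDh : ∀ p ∈ D, p.2 ∈ Icc c (c + h))
    {p q : ℝ × ℝ} (hp : p ∈ D) (hq : q ∈ D) (hp1 : p.1 ≤ x₁) (hq1 : x₂ ≤ q.1) : False := by
  set m : ℝ := (x₁ + x₂) / 2 with hm
  set R : Set (ℝ × ℝ) := Icc x₁ x₂ ×ˢ Icc c (c + h) with hR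
  have hRc : IsCompact R := isCompact_rect _ _ _ _
  have hRsub : R ⊆ Icc a b ×ˢ Icc c d := prod_mono (Icc_subset_Icc ha hb) (Icc_subset_Icc le_rfl hd)
  set e₀ : ℝ × ℝ := (m, c) with he₀
  have he₀B : e₀ ∈ B := hE ⟨⟨by simp only [e₀]; linarith, by simp only [e₀]; linarith⟩, rfl⟩
  have he₀R : e₀ ∈ R \ A := ⟨⟨⟨by simp only [e₀]; linarith, by simp only [e₀]; linarith⟩,
    ⟨le_rfl, by simp only [e₀]; linarith⟩⟩, fun h => disjoint_left.mp hdis h he₀B⟩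
  set V : Set (ℝ × ℝ) := {z | JoinedIn (R \ A) e₀ z} with hV
  have hVR : V ⊆ R \ A := fun z hz => hz.target_mem
  have he₀V : e₀ ∈ V := JoinedIn.refl he₀R
  have hball : ∀ z ∈ R \ A, ∃ r > 0, ∀ x ∈ ball z r ∩ R, ∀ y ∈ ball z r ∩ R, x ∈ V → y ∈ V := by
    intro z hz
    obtain ⟨r, hr, hrA⟩ := Metric.isOpen_iff.mp hA.isOpen_compl z hz.2
    refine ⟨r, hr, fun x hx y hy hxV => ?_⟩
    have hconv : Convex ℝ (ball z r ∩ R) := (convex_ball z r).inter (convex_rect _ _ _ _)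
    have hj := (hconv.isPathConnected ⟨x, hx⟩).joinedIn x hx y hy
    exact JoinedIn.trans hxV (hj.mono fun w hw => ⟨hw.2, hrA hw.1⟩)
  have hVcl : ∀ z ∈ closure V, z ∈ R \ A → z ∈ V := by
    intro z hz hzR
    obtain ⟨r, hr, h⟩ := hball z hzR
    obtain ⟨w, hw, hwz⟩ := Metric.mem_closure_iff.mp hz r hr
    exact h w ⟨by rwa [mem_ball, dist_comm], (hVR hw).1⟩ z ⟨mem_ball_self hr, hzR.1⟩ hw
  have htop : ∀ z ∈ V, z.2 ≠ c + h := by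
    intro z hz hz2
    obtain ⟨s, hs⟩ := exists_mem_of_crossing hD (a := x₁) (b := x₂)
      ⟨hz.somePath, hz.somePath.continuous⟩ (fun s => (hz.somePath_mem s).1.1)
      (fun p hp => by simpa using (hDh p hp).1) (fun p hp => by simpa [hz2] using (hDh p hp).2)
      hp hq hp1 hq1
    exact (hz.somePath_mem s).2 (hDA hs)
  have hmid : ∀ z ∈ V, z.1 = m → u z ≤ t := by
    intro z₁ hz₁ hz₁m
    by_contra! hut
    have hclR : closure V ⊆ R := closure_minimal (hVR.trans sdiff_subset) hRc.isClosed
    obtain ⟨z₀, hz₀, hmax⟩ := (hRc.of_isClosed_subset isClosed_closure hclR).exists_isMaxOn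
      ⟨e₀, subset_closure he₀V⟩ (f := fun p : ℝ × ℝ => u p - (p.1 - m) ^ 2 / 4)
      ((hu.cont.mono (hclR.trans hRsub)).sub (by fun_prop))
    have h1 : t < u z₀ - (z₀.1 - m) ^ 2 / 4 := by
      have := hmax (subset_closure hz₁)
      simp only [mem_ofPred_eq, hz₁m] at this
      simp at this
      linarith
    have hz₀R := hclR hz₀
    have hsub : ∀ w ∈ A ∪ B, u w ≤ t := fun w hw => by rw [hAB] at hw; exact hw.2
    have hut₀ : t < u z₀ := by nlinarith [sq_nonneg (z₀.1 - m)]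
    have hz₀V : z₀ ∈ V := hVcl z₀ hz₀ ⟨hz₀R, fun hA => absurd (hsub z₀ (Or.inl hA)) (by linarith)⟩
    have hside : (z₀.1 - m) ^ 2 < (x₂ - x₁) ^ 2 / 4 := by linarith [hbd z₀ hz₀R]
    have hb1 : x₁ < z₀.1 := by
      refine lt_of_le_of_ne hz₀R.1.1 fun he => ?_
      rw [← he, hm] at hside
      nlinarith
    have hb2 : z₀.1 < x₂ := by
      refine lt_of_le_of_ne hz₀R.1.2 fun he => ?_
      rw [he, hm] at hside
      nlinarith
    have hb3 : c < z₀.2 := by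
      refine lt_of_le_of_ne hz₀R.2.1 fun he => ?_
      exact absurd (hsub z₀ (Or.inr (hE ⟨hz₀R.1, he.symm⟩))) (by linarith)
    have hb4 : z₀.2 < c + h := lt_of_le_of_ne hz₀R.2.2 (htop z₀ hz₀V)
    refine hu.not_max_fst z₀ ⟨⟨by linarith, by linarith⟩, ⟨hb3, by linarith⟩⟩ m ?_
    obtain ⟨r, hr, hrV⟩ := hball z₀ (hVR hz₀V)
    have hnear : Ioo x₁ x₂ ×ˢ Ioo c (c + h) ∈ 𝓝 z₀ :=
      (isOpen_Ioo.prod isOpen_Ioo).mem_nhds ⟨⟨hb1, hb2⟩, ⟨hb3, hb4⟩⟩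
    filter_upwards [ball_mem_nhds z₀ hr, hnear] with w hw hw'
    exact hmax (subset_closure (hrV z₀ ⟨mem_ball_self hr, hz₀R⟩ w
      ⟨hw, ⟨Ioo_subset_Icc_self hw'.1, Ioo_subset_Icc_self hw'.2⟩⟩ hz₀V))
  have hline : Icc c (c + h) ⊆ {y | (m, y) ∈ V} := by
    have hmR : ∀ y ∈ Icc c (c + h), (m, y) ∈ R := fun y hy =>
      ⟨⟨by simp only; linarith, by simp only; linarith⟩, hy⟩
    refine IsClosed.Icc_subset_of_forall_exists_gt ?_ he₀V ?_
    · refine isClosed_of_closure_subset fun y hy => ?_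
      have hyI : y ∈ Icc c (c + h) :=
        closure_minimal inter_subset_right isClosed_Icc hy
      refine ⟨?_, hyI⟩
      have hcont : Continuous fun y : ℝ => (m, y) := by fun_prop
      have hyV : (m, y) ∈ closure V :=
        map_mem_closure hcont hy fun z hz => hz.1
      have hyB : (m, y) ∈ closure B := by
        refine map_mem_closure hcont hy fun z hz => ?_
        have hzR := hVR hz.1
        have : (m, z) ∈ A ∪ B := by
          rw [hAB]
          exact ⟨hRsub hzR.1, hmid _ hz.1 rfl⟩
        exact this.resolve_left hzR.2
      rw [hB.closure_eq] at hyB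
      exact hVcl _ hyV ⟨hmR y hyI, fun hA => disjoint_left.mp hdis hA hyB⟩
    · rintro x ⟨hxV, hx1, hx2⟩ y hy
      obtain ⟨r, hr, hrV⟩ := hball _ (hVR hxV)
      rw [mem_Ioi] at hy
      set y' := min y (min (x + r / 2) (c + h)) with hy'
      have h1 : x < y' := lt_min hy (lt_min (by linarith) hx2)
      have h2 : y' ≤ x + r / 2 := (min_le_right _ _).trans (min_le_left _ _)
      have h3 : y' ≤ c + h := (min_le_right _ _).trans (min_le_right _ _)
      refine ⟨y', ?_, h1, min_le_left _ _⟩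
      refine hrV (m, x) ⟨mem_ball_self hr, (hVR hxV).1⟩ (m, y') ⟨?_, hmR _ ⟨by linarith, h3⟩⟩ hxV
      rw [mem_ball, Prod.dist_eq, dist_self, Real.dist_eq, abs_of_pos (by linarith)]
      exact max_lt hr (by linarith)
  exact htop _ (hline ⟨by linarith, le_rfl⟩) rfl

end

section

theorem exists_subseq_of_frequently {X : Type*} [TopologicalSpace X] [FirstCountableTopology X]
    {D : ℕ → Set X} {Z : Set X} (hZ : IsCompact Z) (hD : ∀ n, D n ⊆ Z) {P : X → Prop}
    (h : ∃ᶠ n in atTop, ∃ z ∈ D n, P z) :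
    ∃ ψ : ℕ → ℕ, StrictMono ψ ∧ ∃ z : ℕ → X, (∀ n, z n ∈ D (ψ n) ∧ P (z n)) ∧
      ∃ w ∈ Z, Tendsto z atTop (𝓝 w) := by
  obtain ⟨φ, hφ, hz⟩ := extraction_of_frequently_atTop h
  choose z hz hP using hz
  obtain ⟨w, hw, θ, hθ, hlim⟩ := hZ.tendsto_subseq fun n => hD _ (hz n)
  exact ⟨φ ∘ θ, hφ.comp hθ, z ∘ θ, fun n => ⟨hz _, hP _⟩, w, hw, hlim⟩

theorem eventually_exists_eq {X : Type*} [TopologicalSpace X] {D : ℕ → Set X}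
    (hD : ∀ n, IsPreconnected (D n)) {f : X → ℝ} (hf : Continuous f) {x y : ℕ → X} {l e : X}
    (hx : ∀ n, x n ∈ D n) (hy : ∀ n, y n ∈ D n) (hl : Tendsto x atTop (𝓝 l))
    (he : Tendsto y atTop (𝓝 e)) {m : ℝ} (h1 : f l < m) (h2 : m < f e) :
    ∀ᶠ n in atTop, ∃ z ∈ D n, f z = m := by
  filter_upwards [((hf.tendsto l).comp hl).eventually_lt_const h1,
    ((hf.tendsto e).comp he).eventually_const_lt h2] with n h1 h2
  exact (hD n).intermediate_value (hx n) (hy n) hf.continuousOn ⟨h1.le, h2.le⟩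

/-- If points on the same level of `f` belong to the same set of the sequence, then limits of
points of the sets lie on the same level. -/
theorem apply_lim_eq {X : Type*} [TopologicalSpace X] {D : ℕ → Set X}
    (hD : ∀ n, IsPreconnected (D n)) {f : X → ℝ} (hf : Continuous f)
    (h : ∀ n m, ∀ p ∈ D n, ∀ q ∈ D m, f p = f q → n = m) {x y : ℕ → X} {l e : X}
    (hx : ∀ n, x n ∈ D n) (hy : ∀ n, y n ∈ D n) (hl : Tendsto x atTop (𝓝 l))
    (he : Tendsto y atTop (𝓝 e)) : f l = f e := by
  have key : ∀ m, ¬ ∀ᶠ n in atTop, ∃ z ∈ D n, f z = m := by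
    intro m hm
    obtain ⟨N, hN⟩ := eventually_atTop.mp hm
    obtain ⟨p, hp, hpm⟩ := hN N le_rfl
    obtain ⟨q, hq, hqm⟩ := hN (N + 1) (by omega)
    have := h _ _ p hp q hq (hpm.trans hqm.symm)
    omega
  by_contra hne
  rcases lt_or_gt_of_ne hne with hlt | hlt
  · exact key _ (eventually_exists_eq hD hf hx hy hl he (m := (f l + f e) / 2)
      (by linarith) (by linarith))
  · exact key _ (eventually_exists_eq hD hf hy hx he hl (m := (f l + f e) / 2)
      (by linarith) (by linarith))

/-- A sequence of continua of diameter at least `ε` no two of which can be joined in `S`. -/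
structure IsSeparatedSeq (S : Set (ℝ × ℝ)) (C : ℕ → Set (ℝ × ℝ)) (ε : ℝ) : Prop where
  isCompact : ∀ n, IsCompact (C n)
  isPreconnected : ∀ n, IsPreconnected (C n)
  subset : ∀ n, C n ⊆ S
  pos : 0 < ε
  eq_of_joined : ∀ n m T, IsPreconnected T → T ⊆ S → (C n ∩ T).Nonempty → (C m ∩ T).Nonempty →
    n = m
  exists_le_dist : ∀ n, ∃ x ∈ C n, ∃ y ∈ C n, ε ≤ dist x y

variable {u : ℝ × ℝ → ℝ} {t a b c d ε : ℝ} {S : Set (ℝ × ℝ)} {C : ℕ → Set (ℝ × ℝ)}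

theorem IsSeparatedSeq.comp (hC : IsSeparatedSeq S C ε) {φ : ℕ → ℕ} (hφ : StrictMono φ) :
    IsSeparatedSeq S (C ∘ φ) ε :=
  ⟨fun _ => hC.isCompact _, fun _ => hC.isPreconnected _, fun _ => hC.subset _, hC.pos,
    fun _ _ T hT hTS h1 h2 => hφ.injective (hC.eq_of_joined _ _ T hT hTS h1 h2),
    fun _ => hC.exists_le_dist _⟩

theorem IsSeparatedSeq.preimage (hC : IsSeparatedSeq S C ε) (e : ℝ × ℝ ≃ₜ ℝ × ℝ)
    (he : ∀ x y, dist (e x) (e y) = dist x y) :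
    IsSeparatedSeq (e ⁻¹' S) (fun n => e ⁻¹' C n) ε := by
  refine ⟨fun n => e.isCompact_preimage.mpr (hC.isCompact n),
    fun n => e.isPreconnected_preimage.mpr (hC.isPreconnected n),
    fun n => preimage_mono (hC.subset n), hC.pos, ?_, ?_⟩
  · rintro n m T hT hTS ⟨x, hx, hxT⟩ ⟨y, hy, hyT⟩
    exact hC.eq_of_joined n m (e '' T) (hT.image e e.continuous.continuousOn)
      (image_subset_iff.mpr hTS) ⟨e x, hx, mem_image_of_mem e hxT⟩ ⟨e y, hy, mem_image_of_mem e hyT⟩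
  · intro n
    obtain ⟨x, hx, y, hy, hxy⟩ := hC.exists_le_dist n
    exact ⟨e.symm x, by simpa, e.symm y, by simpa, by rw [← he]; simpa⟩

theorem IsSeparatedSeq.exists_arcs (hC : IsSeparatedSeq S C ε) {l : ℝ × ℝ} {x : ℕ → ℝ × ℝ}
    (hx : ∀ n, x n ∈ C n) (hl : Tendsto x atTop (𝓝 l)) {r : ℝ} (hr : 0 < r) (hrε : 2 * r < ε) :
    ∃ φ : ℕ → ℕ, StrictMono φ ∧ ∃ (D : ℕ → Set (ℝ × ℝ)) (x' y' : ℕ → ℝ × ℝ) (e : ℝ × ℝ),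
      (∀ n, IsPreconnected (D n)) ∧ (∀ n, D n ⊆ C (φ n)) ∧ (∀ n, D n ⊆ closedBall l r) ∧
      (∀ n, x' n ∈ D n) ∧ (∀ n, y' n ∈ D n) ∧ Tendsto x' atTop (𝓝 l) ∧
      Tendsto y' atTop (𝓝 e) ∧ dist e l = r := by
  obtain ⟨N, hN⟩ := eventually_atTop.mp (hl.eventually (closedBall_mem_nhds l hr))
  set D : ℕ → Set (ℝ × ℝ) := fun n => connectedComponentIn (C (n + N) ∩ closedBall l r) (x (n + N))
    with hD
  have hxD : ∀ n, x (n + N) ∈ D n := fun n =>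
    mem_connectedComponentIn ⟨hx _, hN _ (by omega)⟩
  have hDsub : ∀ n, D n ⊆ C (n + N) ∩ closedBall l r := fun n => connectedComponentIn_subset _ _
  have hex : ∀ n, ∃ y ∈ D n, dist y l = r := by
    intro n
    have h1 : ¬ C (n + N) ⊆ ball l r := by
      intro h
      obtain ⟨p, hp, q, hq, hpq⟩ := hC.exists_le_dist (n + N)
      have h1 := mem_ball.mp (h hp)
      have h2 := mem_ball.mp (h hq)
      have := dist_triangle_right p q l
      linarith
    have h2 := connectedComponentIn_inter_not_subset (hC.isCompact (n + N))
      (hC.isPreconnected _) isClosed_closedBall isOpen_ball ball_subset_closedBall (hx (n + N))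
      (hN _ (by omega)) h1
    obtain ⟨y, hy, hyb⟩ := not_subset.mp h2
    refine ⟨y, hy, le_antisymm (hDsub n hy).2 (not_lt.mp hyb)⟩
  choose y hy hyr using hex
  obtain ⟨e, -, θ, hθ, hlim⟩ := (isCompact_closedBall l r).tendsto_subseq
    fun n => (hDsub n (hy n)).2
  refine ⟨fun n => θ n + N, fun i j hij => by simpa using hθ hij, D ∘ θ, fun n => x (θ n + N),
    y ∘ θ, e, fun n => isPreconnected_connectedComponentIn, fun n => (hDsub _).trans inter_subset_left,
    fun n => (hDsub _).trans inter_subset_right, fun n => hxD _, fun n => hy _, ?_, hlim, ?_⟩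
  · exact hl.comp ((tendsto_add_atTop_iff_nat N).mpr tendsto_id |>.comp hθ.tendsto_atTop)
  · exact tendsto_nhds_unique ((hlim.dist tendsto_const_nhds)) (by simp [hyr])

/-- Separated continua do not accumulate at a point near which the function is strictly convex in
the first coordinate. -/
theorem IsSeparatedSeq.false_of_convex (hu : IsAdmissible u a b c d)
    (hC : IsSeparatedSeq (sublevel u t a b c d) C ε) {l : ℝ × ℝ} {x : ℕ → ℝ × ℝ}
    (hx : ∀ n, x n ∈ C n) (hl : Tendsto x atTop (𝓝 l)) (hlQ : l ∈ Ioo a b ×ˢ Ioo c d)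
    {r : ℝ} (hr : 0 < r)
    (hconv : ∀ y, |y - l.2| ≤ r → StrictConvexOn ℝ (Icc (l.1 - r) (l.1 + r)) fun x => u (x, y)) :
    False := by
  obtain ⟨r₁, hr₁, hQ⟩ := Metric.isOpen_iff.mp (isOpen_Ioo.prod isOpen_Ioo) l hlQ
  obtain ⟨s, hs0, hsr, hsr₁, hsε⟩ : ∃ s, 0 < s ∧ s ≤ r ∧ s < r₁ ∧ 2 * s < ε := by
    have := hC.pos
    refine ⟨min r (min (r₁ / 2) (ε / 4)), by positivity, min_le_left _ _, ?_, ?_⟩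
    · exact ((min_le_right _ _).trans (min_le_left _ _)).trans_lt (by linarith)
    · have := (min_le_right r (min (r₁ / 2) (ε / 4))).trans (min_le_right _ _)
      linarith
  have hsQ : closedBall l s ⊆ Icc a b ×ˢ Icc c d :=
    (closedBall_subset_ball hsr₁).trans (hQ.trans (prod_mono Ioo_subset_Icc_self Ioo_subset_Icc_self))
  have hmem : ∀ p ∈ closedBall l s, |p.2 - l.2| ≤ r ∧ p.1 ∈ Icc (l.1 - r) (l.1 + r) := by
    intro p hp
    rw [mem_closedBall, Prod.dist_eq, max_le_iff, Real.dist_eq, Real.dist_eq] at hp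
    have := abs_le.mp hp.1
    exact ⟨hp.2.trans hsr, by linarith, by linarith⟩
  obtain ⟨φ, hφ, D, x', y', e, hD, hDC, hDl, hx', hy', hl', he, her⟩ := hC.exists_arcs hx hl hs0 hsε
  have hDS : ∀ n, D n ⊆ sublevel u t a b c d := fun n => (hDC n).trans (hC.subset _)
  have hlevel : ∀ n m, ∀ p ∈ D n, ∀ q ∈ D m, p.2 = q.2 → n = m := by
    intro n m p hp q hq hpq
    have hpl := hDl n hp
    have hql := hDl m hq
    refine hφ.injective (hC.eq_of_joined _ _ (segment ℝ p q) (convex_segment p q).isPreconnected ?_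
      ⟨p, hDC n hp, left_mem_segment ℝ p q⟩ ⟨q, hDC m hq, right_mem_segment ℝ p q⟩)
    intro w hw
    refine ⟨hsQ ((convex_closedBall l s).segment_subset hpl hql hw), ?_⟩
    have hw12 := Prod.segment_subset p q hw
    have hw2 : w.2 = p.2 := by
      have := hw12.2
      rw [← hpq, segment_same] at this
      exact this
    have := (hconv p.2 (hmem p hpl).1).convexOn.le_on_segment (hmem p hpl).2 (hmem q hql).2 hw12.1
    rw [← hw2, Prod.mk.eta] at this
    refine this.trans (max_le ?_ ?_)
    · rw [hw2]; exact (hDS n hp).2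
    · rw [hw2, hpq]; exact (hDS m hq).2
  have hel : e.2 = l.2 := apply_lim_eq hD continuous_snd hlevel hy' hx' he hl'
  have hel1 : |e.1 - l.1| = s := by
    rw [Prod.dist_eq, hel, dist_self, Real.dist_eq] at her
    rw [← her, max_eq_left (abs_nonneg _)]
  have hne : e.1 ≠ l.1 := by
    intro h
    rw [h] at hel1
    simp at hel1
    linarith
  set m : ℝ := (l.1 + e.1) / 2 with hm
  have hev : ∀ᶠ n in atTop, ∃ z ∈ D n, z.1 = m := by
    rcases lt_or_gt_of_ne hne with h | h
    · exact eventually_exists_eq hD continuous_fst hy' hx' he hl' (by linarith) (by linarith)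
    · exact eventually_exists_eq hD continuous_fst hx' hy' hl' he (by linarith) (by linarith)
  obtain ⟨ψ, hψ, z, hz, w, -, hw⟩ := exists_subseq_of_frequently (isCompact_closedBall l s) hDl
    hev.frequently
  have hw2 : w.2 = l.2 := apply_lim_eq (fun n => hD (ψ n)) continuous_snd
    (fun n m p hp q hq h => hψ.injective (hlevel _ _ p hp q hq h)) (fun n => (hz n).1)
    (fun n => hx' (ψ n)) hw (hl'.comp hψ.tendsto_atTop)
  have hw1 : w.1 = m := tendsto_nhds_unique ((continuous_fst.tendsto w).comp hw)
    (by simp [Function.comp_def, (hz _).2])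
  have hlS : l ∈ sublevel u t a b c d := (hu.isClosed_sublevel t).mem_of_tendsto hl'
    (Eventually.of_forall fun n => hDS n (hx' n))
  have heS : e ∈ sublevel u t a b c d := (hu.isClosed_sublevel t).mem_of_tendsto he
    (Eventually.of_forall fun n => hDS n (hy' n))
  have hut : u w < t := by
    have h1 := (hconv l.2 (by simpa using hr.le)).2 (x := l.1) (y := e.1)
      (hmem l (mem_closedBall_self hs0.le)).2 (hmem e her.le).2 hne.symm
      (show (0 : ℝ) < 1 / 2 by norm_num) (show (0 : ℝ) < 1 / 2 by norm_num) (by norm_num)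
    have h2 : ((1 / 2 : ℝ) • l.1 + (1 / 2 : ℝ) • e.1, l.2) = w := by
      ext
      · simp only [smul_eq_mul, hw1, hm]; ring
      · exact hw2.symm
    simp only [h2] at h1
    have h3 : (e.1, l.2) = e := by rw [← hel]
    rw [h3, Prod.mk.eta] at h1
    have := hlS.2
    have := heS.2
    simp only [smul_eq_mul] at h1
    linarith
  have hwl : w ∈ ball l r₁ := by
    rw [mem_ball, Prod.dist_eq, hw2, dist_self, Real.dist_eq, hw1, hm,
      show (l.1 + e.1) / 2 - l.1 = (e.1 - l.1) / 2 by ring, abs_div, hel1]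
    exact max_lt (by rw [abs_two]; linarith) hr₁
  have hQn : Icc a b ×ˢ Icc c d ∈ 𝓝 w :=
    mem_of_superset (isOpen_ball.mem_nhds hwl)
      (hQ.trans (prod_mono Ioo_subset_Icc_self Ioo_subset_Icc_self))
  have hnear : ∀ᶠ p in 𝓝 w, p ∈ sublevel u t a b c d := by
    filter_upwards [hQn, (hu.cont.continuousAt hQn).eventually_lt_const hut] with p hp hp'
    exact ⟨hp, hp'.le⟩
  obtain ⟨ρ, hρ, hρS⟩ := Metric.eventually_nhds_iff_ball.mp hnear
  obtain ⟨N, hN⟩ := eventually_atTop.mp (hw.eventually (ball_mem_nhds w hρ))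
  have := hψ.injective (hφ.injective (hC.eq_of_joined (φ (ψ N)) (φ (ψ (N + 1))) (ball w ρ)
    (convex_ball w ρ).isPreconnected (fun p hp => hρS p hp)
    ⟨z N, hDC _ (hz N).1, hN N le_rfl⟩ ⟨z (N + 1), hDC _ (hz _).1, hN _ (by omega)⟩))
  omega

end

section

variable {u : ℝ × ℝ → ℝ} {t a b c d ε : ℝ} {S : Set (ℝ × ℝ)} {C : ℕ → Set (ℝ × ℝ)}

theorem dist_swap_swap (x y : ℝ × ℝ) : dist x.swap y.swap = dist x y := by
  simp [Prod.dist_eq, max_comm]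

theorem preimage_swap_sublevel :
    Prod.swap ⁻¹' sublevel u t a b c d = sublevel (u ∘ Prod.swap) t c d a b := by
  ext p
  simp [sublevel, and_comm]

theorem IsSeparatedSeq.swap (hC : IsSeparatedSeq (sublevel u t a b c d) C ε) :
    IsSeparatedSeq (sublevel (u ∘ Prod.swap) t c d a b) (fun n => Prod.swap ⁻¹' C n) ε := by
  have := hC.preimage (Homeomorph.prodComm ℝ ℝ) dist_swap_swap
  rw [← preimage_swap_sublevel]
  exact this

theorem IsSeparatedSeq.reflect (hC : IsSeparatedSeq (sublevel u t a b c d) C ε) :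
    IsSeparatedSeq (sublevel (fun p => u (p.1, -p.2)) t a b (-d) (-c))
      (fun n => (fun p : ℝ × ℝ => (p.1, -p.2)) ⁻¹' C n) ε := by
  have := hC.preimage ((Homeomorph.refl ℝ).prodCongr (Homeomorph.neg ℝ))
    (fun x y => by simp [Prod.dist_eq])
  have e : sublevel (fun p => u (p.1, -p.2)) t a b (-d) (-c) =
      ((Homeomorph.refl ℝ).prodCongr (Homeomorph.neg ℝ)) ⁻¹' sublevel u t a b c d := by
    ext ⟨x, y⟩
    have h1 : -d ≤ y ↔ -y ≤ d := neg_le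
    have h2 : y ≤ -c ↔ c ≤ -y := le_neg
    change ((a ≤ x ∧ x ≤ b) ∧ -d ≤ y ∧ y ≤ -c) ∧ u (x, -y) ≤ t ↔
      ((a ≤ x ∧ x ≤ b) ∧ c ≤ -y ∧ -y ≤ d) ∧ u (x, -y) ≤ t
    tauto
  rw [e]
  exact this

/-- Separated continua do not accumulate at an interior point. -/
theorem IsSeparatedSeq.false_of_interior (hu : IsAdmissible u a b c d)
    (hC : IsSeparatedSeq (sublevel u t a b c d) C ε) {l : ℝ × ℝ} {x : ℕ → ℝ × ℝ}
    (hx : ∀ n, x n ∈ C n) (hl : Tendsto x atTop (𝓝 l)) (hlQ : l ∈ Ioo a b ×ˢ Ioo c d) :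
    False := by
  obtain ⟨r, hr, h | h⟩ := hu.convex l hlQ
  · exact hC.false_of_convex hu hx hl hlQ hr h
  · exact hC.swap.false_of_convex hu.swap (x := fun n => (x n).swap) (l := l.swap)
      (fun n => by simpa using hx n) ((continuous_swap.tendsto l).comp hl) ⟨hlQ.2, hlQ.1⟩ hr h

/-- Separated continua do not accumulate at an interior point of the lower edge. -/
theorem IsSeparatedSeq.false_of_lower_edge (hu : IsAdmissible u a b c d) (hcd : c < d)
    (hC : IsSeparatedSeq (sublevel u t a b c d) C ε) {l : ℝ × ℝ} {x : ℕ → ℝ × ℝ}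
    (hx : ∀ n, x n ∈ C n) (hl : Tendsto x atTop (𝓝 l)) (hl1 : l.1 ∈ Ioo a b) (hl2 : l.2 = c) :
    False := by
  obtain ⟨r, hr, hra, hrb, hrd, hrε⟩ : ∃ r, 0 < r ∧ r < l.1 - a ∧ r < b - l.1 ∧ r < d - c ∧
      2 * r < ε := by
    have h1 := hC.pos
    have h2 := hl1.1
    have h3 := hl1.2
    obtain ⟨r, hr, hr'⟩ := exists_between (show 0 < min (min (l.1 - a) (b - l.1))
      (min (d - c) (ε / 2)) from lt_min (lt_min (by linarith) (by linarith))
        (lt_min (by linarith) (by linarith)))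
    simp only [lt_min_iff] at hr'
    exact ⟨r, hr, hr'.1.1, hr'.1.2, hr'.2.1, by linarith [hr'.2.2]⟩
  obtain ⟨φ, hφ, D, x', y', e, hD, hDC, hDl, hx', hy', hl', he, her⟩ := hC.exists_arcs hx hl hr hrε
  have hScl := hu.isClosed_sublevel t
  have hDS : ∀ n, D n ⊆ sublevel u t a b c d := fun n => (hDC n).trans (hC.subset _)
  have hlim : ∀ (ψ : ℕ → ℕ) (z : ℕ → ℝ × ℝ) (w : ℝ × ℝ), StrictMono ψ → (∀ n, z n ∈ D (ψ n)) →
      Tendsto z atTop (𝓝 w) → w.2 = c := by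
    intro ψ z w hψ hz hw
    have hwS : w ∈ sublevel u t a b c d :=
      hScl.mem_of_tendsto hw (Eventually.of_forall fun n => hDS _ (hz n))
    have hwl : w ∈ closedBall l r :=
      isClosed_closedBall.mem_of_tendsto hw (Eventually.of_forall fun n => hDl _ (hz n))
    rw [mem_closedBall, Prod.dist_eq, max_le_iff, Real.dist_eq, Real.dist_eq, abs_le, abs_le] at hwl
    refine le_antisymm (not_lt.mp fun hlt => ?_) hwS.1.2.1
    refine (hC.comp (hφ.comp hψ)).false_of_interior hu (x := z) (fun n => hDC _ (hz n)) hw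
      ⟨⟨by linarith [hwl.1.1], by linarith [hwl.1.2]⟩, hlt, by linarith [hwl.2.2]⟩
  have he2 : e.2 = c := hlim id y' e strictMono_id hy' he
  have he1 : |e.1 - l.1| = r := by
    rw [Prod.dist_eq, he2, hl2, dist_self, Real.dist_eq] at her
    rw [← her, max_eq_left (abs_nonneg _)]
  obtain ⟨p, q, pl, ql, hp, hq, hpl, hql, hpq, hpa, hqb⟩ : ∃ (p q : ℕ → ℝ × ℝ) (pl ql : ℝ × ℝ),
      (∀ n, p n ∈ D n) ∧ (∀ n, q n ∈ D n) ∧ Tendsto p atTop (𝓝 pl) ∧ Tendsto q atTop (𝓝 ql) ∧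
      pl.1 < ql.1 ∧ a < pl.1 ∧ ql.1 < b := by
    rcases abs_eq hr.le |>.mp he1 with h | h
    · exact ⟨x', y', l, e, hx', hy', hl', he, by linarith, hl1.1, by linarith⟩
    · exact ⟨y', x', e, l, hy', hx', he, hl', by linarith, by linarith, hl1.2⟩
  have hE : ∀ x ∈ Ioo pl.1 ql.1, (x, c) ∈ sublevel u t a b c d := by
    intro x hx
    obtain ⟨ψ, hψ, z, hz, w, -, hw⟩ := exists_subseq_of_frequently (isCompact_closedBall l r) hDl
      (eventually_exists_eq hD continuous_fst hp hq hpl hql hx.1 hx.2).frequently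
    have hw2 := hlim ψ z w hψ (fun n => (hz n).1) hw
    have hw1 : w.1 = x := tendsto_nhds_unique ((continuous_fst.tendsto w).comp hw)
      (by simp [Function.comp_def, (hz _).2])
    have : w = (x, c) := Prod.ext hw1 hw2
    rw [← this]
    exact hScl.mem_of_tendsto hw (Eventually.of_forall fun n => hDS _ (hz n).1)
  obtain ⟨x₁, hx₁, hx₁q⟩ := exists_between hpq
  obtain ⟨x₂, hx₂, hx₂q⟩ := exists_between hx₁q
  set E : Set (ℝ × ℝ) := Icc x₁ x₂ ×ˢ {c} with hEdef
  have hES : E ⊆ sublevel u t a b c d := by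
    rintro ⟨x, y⟩ ⟨hx, hy⟩
    rw [mem_singleton_iff] at hy
    simp only at hy hx
    rw [hy]
    exact hE x ⟨by linarith [hx.1], by linarith [hx.2]⟩
  have hEc : IsPreconnected E := isPreconnected_Icc.prod isPreconnected_singleton
  obtain ⟨h, hh, hhd, hbd⟩ : ∃ h > 0, c + h ≤ d ∧
      ∀ p ∈ Icc x₁ x₂ ×ˢ Icc c (c + h), u p ≤ t + (x₂ - x₁) ^ 2 / 16 := by
    have huc := (isCompact_rect a b c d).uniformContinuousOn_of_continuous hu.cont
    obtain ⟨η, hη, H⟩ := Metric.uniformContinuousOn_iff.mp huc ((x₂ - x₁) ^ 2 / 16)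
      (by have := sub_pos.mpr hx₂; positivity)
    refine ⟨min (η / 2) (d - c), lt_min (by linarith) (by linarith),
      by linarith [min_le_right (η / 2) (d - c)], fun p hp => ?_⟩
    have hp2 := hp.2.2
    have hη2 := min_le_left (η / 2) (d - c)
    have hd2 := min_le_right (η / 2) (d - c)
    have hpE : (p.1, c) ∈ sublevel u t a b c d := hES ⟨hp.1, rfl⟩
    have := H p ⟨hpE.1.1, hp.2.1, by linarith⟩ (p.1, c) hpE.1 (by
      rw [Prod.dist_eq, dist_self, Real.dist_eq, abs_of_nonneg (by simpa using hp.2.1)]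
      exact max_lt hη (by simp only; linarith))
    rw [Real.dist_eq, abs_lt] at this
    linarith [hpE.2]
  have hlow : ∀ᶠ n in atTop, ∀ z ∈ D n, z.2 ≤ c + h := by
    by_contra hcon
    have hcon' : ∃ᶠ n in atTop, ∃ z ∈ D n, c + h < z.2 := by
      simpa [Filter.Frequently] using hcon
    obtain ⟨ψ, hψ, z, hz, w, -, hw⟩ := exists_subseq_of_frequently (isCompact_closedBall l r) hDl
      hcon'
    have h1 := hlim ψ z w hψ (fun n => (hz n).1) hw
    have h2 := ge_of_tendsto' ((continuous_snd.tendsto w).comp hw) fun n => (hz n).2.le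
    linarith
  have hall := hlow.and ((((continuous_fst.tendsto pl).comp hpl).eventually_lt_const hx₁).and
    (((continuous_fst.tendsto ql).comp hql).eventually_const_lt hx₂q))
  obtain ⟨N, hN⟩ := eventually_atTop.mp hall
  have hx₁E : (x₁, c) ∈ E := ⟨⟨le_rfl, hx₂.le⟩, rfl⟩
  set K := connectedComponentIn (sublevel u t a b c d) (x₁, c) with hK
  have hEK : E ⊆ K := hEc.subset_connectedComponentIn hx₁E hES
  obtain ⟨n, hnN, hnK⟩ : ∃ n, N ≤ n ∧ Disjoint (C (φ n)) K := by
    by_contra! hcon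
    have := hφ.injective (hC.eq_of_joined (φ N) (φ (N + 1)) K isPreconnected_connectedComponentIn
      (connectedComponentIn_subset _ _) (not_disjoint_iff_nonempty_inter.mp (hcon N le_rfl))
      (not_disjoint_iff_nonempty_inter.mp (hcon (N + 1) (by omega))))
    omega
  obtain ⟨B, A, hB, hA, hBA, hdis, hKB, hBU⟩ := exists_clopen_split (hu.isCompact_sublevel t)
    (hES hx₁E) (hC.isCompact (φ n)).isClosed.isOpen_compl
    (subset_compl_iff_disjoint_left.mpr hnK)
  have hDA : D n ⊆ A := by
    intro z hz
    have : z ∈ B ∪ A := by rw [hBA]; exact hDS n hz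
    exact this.resolve_left fun hzB => hBU hzB (hDC n hz)
  obtain ⟨h1, h2, h3⟩ := hN n hnN
  exact hu.false_of_crossing (by linarith) hx₂ (by linarith) hh hhd hA hB
    (by rw [union_comm]; exact hBA) hdis.symm (hEK.trans hKB) hbd (hD n) hDA
    (fun z hz => ⟨(hDS n hz).1.2.1, h1 z hz⟩) (hp n) (hq n) h2.le h3.le

theorem IsSeparatedSeq.fst_eq (hu : IsAdmissible u a b c d) (hcd : c < d)
    (hC : IsSeparatedSeq (sublevel u t a b c d) C ε) {l e : ℝ × ℝ} {x y : ℕ → ℝ × ℝ}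
    (hx : ∀ n, x n ∈ C n) (hy : ∀ n, y n ∈ C n) (hl : Tendsto x atTop (𝓝 l))
    (he : Tendsto y atTop (𝓝 e)) : ¬ l.1 < e.1 := by
  intro hlt
  have hS : ∀ {z : ℕ → ℝ × ℝ} {ψ : ℕ → ℕ} {w}, (∀ n, z n ∈ C (ψ n)) → Tendsto z atTop (𝓝 w) →
      w ∈ sublevel u t a b c d := fun hz hw => (hu.isClosed_sublevel t).mem_of_tendsto hw
    (Eventually.of_forall fun n => hC.subset _ (hz n))
  obtain ⟨m, hm1, hm2⟩ := exists_between hlt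
  obtain ⟨ψ, hψ, z, hz, w, -, hw⟩ := exists_subseq_of_frequently (hu.isCompact_sublevel t)
    hC.subset (eventually_exists_eq hC.isPreconnected continuous_fst hx hy hl he hm1 hm2).frequently
  have hw1 : w.1 = m := tendsto_nhds_unique ((continuous_fst.tendsto w).comp hw)
    (by simp [Function.comp_def, (hz _).2])
  have hwS := hS (fun n => (hz n).1) hw
  have hlS := hS (ψ := id) hx hl
  have heS := hS (ψ := id) hy he
  have hwI : w.1 ∈ Ioo a b := ⟨by linarith [hlS.1.1.1], by linarith [heS.1.1.2]⟩
  rcases hwS.1.2.1.eq_or_lt with h1 | h1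
  · exact (hC.comp hψ).false_of_lower_edge hu hcd (fun n => (hz n).1) hw hwI h1.symm
  rcases hwS.1.2.2.eq_or_lt with h2 | h2
  · refine (hC.comp hψ).reflect.false_of_lower_edge hu.reflect (by linarith)
      (x := fun n => ((z n).1, -(z n).2)) (l := (w.1, -w.2)) (fun n => ?_) ?_ hwI (by simp [h2])
    · simpa using (hz n).1
    · have : Continuous fun p : ℝ × ℝ => (p.1, -p.2) := by fun_prop
      exact (this.tendsto w).comp hw
  · exact (hC.comp hψ).false_of_interior hu (fun n => (hz n).1) hw ⟨hwI, h1, h2⟩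

/-- There is no infinite sequence of pairwise separated large continua in a sublevel set. -/
theorem IsSeparatedSeq.false (hu : IsAdmissible u a b c d) (hab : a < b) (hcd : c < d)
    (hC : IsSeparatedSeq (sublevel u t a b c d) C ε) : False := by
  choose x hx y hy hxy using hC.exists_le_dist
  obtain ⟨l, -, φ, hφ, hl⟩ := (hu.isCompact_sublevel t).tendsto_subseq fun n => hC.subset _ (hx n)
  obtain ⟨e, -, ψ, hψ, he⟩ := (hu.isCompact_sublevel t).tendsto_subseq
    fun n => hC.subset _ (hy (φ n))
  have hl' := hl.comp hψ.tendsto_atTop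
  have hC' := hC.comp (hφ.comp hψ)
  have hle : ε ≤ dist l e := ge_of_tendsto' (hl'.dist he) fun n => hxy _
  have h1 : l.1 = e.1 := le_antisymm
    (not_lt.mp (hC'.fst_eq hu hcd (fun n => hy _) (fun n => hx _) he hl'))
    (not_lt.mp (hC'.fst_eq hu hcd (fun n => hx _) (fun n => hy _) hl' he))
  have hs : ∀ {z : ℕ → ℝ × ℝ} {w}, Tendsto z atTop (𝓝 w) →
      Tendsto (fun n => (z n).swap) atTop (𝓝 w.swap) :=
    fun {z w} h => (continuous_swap.tendsto w).comp h
  have h2 : l.2 = e.2 := le_antisymm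
    (not_lt.mp (hC'.swap.fst_eq hu.swap hab (fun n => by simpa using hy _)
      (fun n => by simpa using hx _) (hs he) (hs hl')))
    (not_lt.mp (hC'.swap.fst_eq hu.swap hab (fun n => by simpa using hx _)
      (fun n => by simpa using hy _) (hs hl') (hs he)))
  rw [show l = e from Prod.ext h1 h2, dist_self] at hle
  exact absurd hC.pos (not_lt.mpr hle)

end

section

theorem isClosed_connectedComponentIn {X : Type*} [TopologicalSpace X] {S : Set X}
    (hS : IsClosed S) (x : X) : IsClosed (connectedComponentIn S x) := by
  by_cases hx : x ∈ S
  · rw [connectedComponentIn_eq_image hx]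
    exact hS.isClosedEmbedding_subtypeVal.isClosedMap _ isClosed_connectedComponent
  · rw [connectedComponentIn_eq_empty hx]
    exact isClosed_empty

theorem mem_connectedComponentIn_comm {X : Type*} [TopologicalSpace X] {S : Set X} {x y : X}
    (h : y ∈ connectedComponentIn S x) : x ∈ connectedComponentIn S y := by
  rw [← connectedComponentIn_eq h]
  exact mem_connectedComponentIn (connectedComponentIn_nonempty_iff.mp ⟨y, h⟩)

variable {u : ℝ × ℝ → ℝ} {t a b c d ε : ℝ}

theorem IsAdmissible.isCompact_component (hu : IsAdmissible u a b c d) (t : ℝ) (x : ℝ × ℝ) :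
    IsCompact (connectedComponentIn (sublevel u t a b c d) x) :=
  (hu.isCompact_sublevel t).of_isClosed_subset
    (isClosed_connectedComponentIn (hu.isClosed_sublevel t) x) (connectedComponentIn_subset _ _)

theorem exists_rect_inter (hu : IsAdmissible u a b c d) (hab : a < b) (hcd : c < d)
    {z : ℝ × ℝ} (hz : z ∈ Icc a b ×ˢ Icc c d) {r : ℝ} (hr : 0 < r) :
    ∃ a' b' c' d', a' < b' ∧ c' < d' ∧ IsAdmissible u a' b' c' d' ∧
      Icc a' b' ×ˢ Icc c' d' = Icc a b ×ˢ Icc c d ∩ closedBall z r ∧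
      ∀ t, sublevel u t a' b' c' d' = sublevel u t a b c d ∩ closedBall z r := by
  obtain ⟨⟨h1, h2⟩, h3, h4⟩ := hz
  have hQ : Icc (max a (z.1 - r)) (min b (z.1 + r)) ×ˢ Icc (max c (z.2 - r)) (min d (z.2 + r)) =
      Icc a b ×ˢ Icc c d ∩ closedBall z r := by
    rw [← Prod.mk.eta (p := z), ← closedBall_prod_same, Real.closedBall_eq_Icc,
      Real.closedBall_eq_Icc, prod_inter_prod, Icc_inter_Icc, Icc_inter_Icc]
  refine ⟨max a (z.1 - r), min b (z.1 + r), max c (z.2 - r), min d (z.2 + r), ?_, ?_,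
    hu.mono (le_max_left _ _) (min_le_left _ _) (le_max_left _ _) (min_le_left _ _), hQ, fun t => ?_⟩
  · exact max_lt (lt_min hab (by linarith)) (lt_min (by linarith) (by linarith))
  · exact max_lt (lt_min hcd (by linarith)) (lt_min (by linarith) (by linarith))
  · ext p
    simp only [sublevel, hQ, mem_inter_iff, mem_ofPred_eq]
    tauto

/-- Only finitely many components of a sublevel set have a given size. -/
theorem IsAdmissible.finite_components (hu : IsAdmissible u a b c d) (hab : a < b) (hcd : c < d)
    (t : ℝ) (hε : 0 < ε) :
    {C | ∃ x ∈ sublevel u t a b c d, C = connectedComponentIn (sublevel u t a b c d) x ∧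
      ∃ p ∈ C, ∃ q ∈ C, ε ≤ dist p q}.Finite := by
  by_contra hinf
  set 𝒞 := {C | ∃ x ∈ sublevel u t a b c d, C = connectedComponentIn (sublevel u t a b c d) x ∧
      ∃ p ∈ C, ∃ q ∈ C, ε ≤ dist p q} with h𝒞
  have hinf' : 𝒞.Infinite := hinf
  set C := hinf'.natEmbedding with hC
  have h := fun n => (C n).2
  choose x hx hCx hd using h
  refine IsSeparatedSeq.false (t := t) (C := fun n => (C n : Set (ℝ × ℝ))) (ε := ε) hu hab hcd
    ⟨fun n => ?_, fun n => ?_, fun n => ?_, hε, ?_, hd⟩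
  · rw [hCx n]; exact hu.isCompact_component t (x n)
  · rw [hCx n]; exact isPreconnected_connectedComponentIn
  · rw [hCx n]; exact connectedComponentIn_subset _ _
  · rintro n m T hT hTS ⟨p, hp, hpT⟩ ⟨q, hq, hqT⟩
    apply C.injective
    apply Subtype.ext
    rw [hCx n] at hp ⊢
    rw [hCx m] at hq ⊢
    rw [connectedComponentIn_eq hp, connectedComponentIn_eq hq]
    exact connectedComponentIn_eq (hT.subset_connectedComponentIn hpT hTS hqT)

theorem IsAdmissible.exists_ball_subset_component (hu : IsAdmissible u a b c d) (hab : a < b)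
    (hcd : c < d) {x z : ℝ × ℝ} (hz : z ∈ connectedComponentIn (sublevel u t a b c d) x)
    (hε : 0 < ε) : ∃ ρ > 0, ∀ p ∈ connectedComponentIn (sublevel u t a b c d) x ∩ ball z ρ,
      p ∈ connectedComponentIn (sublevel u t a b c d ∩ closedBall z ε) z := by
  set K := connectedComponentIn (sublevel u t a b c d) x with hK
  have hKS : K ⊆ sublevel u t a b c d := connectedComponentIn_subset _ _
  have hKc : IsPreconnected K := isPreconnected_connectedComponentIn
  by_cases hKε : K ⊆ ball z ε
  · refine ⟨1, one_pos, fun p hp => ?_⟩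
    have hsub : K ⊆ sublevel u t a b c d ∩ closedBall z ε :=
      fun q hq => ⟨hKS hq, ball_subset_closedBall (hKε hq)⟩
    exact hKc.subset_connectedComponentIn hz hsub hp.1
  obtain ⟨a', b', c', d', hab', hcd', hu', -, hS⟩ := exists_rect_inter hu hab hcd (hKS hz).1 hε
  rw [← hS]
  have hfin := hu'.finite_components hab' hcd' t (half_pos hε)
  set 𝒞 := {C | ∃ x ∈ sublevel u t a' b' c' d', C = connectedComponentIn (sublevel u t a' b' c' d') x ∧
      ∃ p ∈ C, ∃ q ∈ C, ε / 2 ≤ dist p q} with h𝒞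
  have hcl : IsClosed (⋃₀ (𝒞 ∩ {C | z ∉ C})) := by
    rw [sUnion_eq_biUnion]
    refine (hfin.subset inter_subset_left).isClosed_biUnion ?_
    rintro _ ⟨⟨y, -, rfl, -⟩, -⟩
    exact isClosed_connectedComponentIn (hu'.isClosed_sublevel t) y
  have hzn : z ∉ ⋃₀ (𝒞 ∩ {C | z ∉ C}) := by
    rintro ⟨C, hC, hzC⟩
    exact hC.2 hzC
  obtain ⟨ρ, hρ, hρ'⟩ := Metric.isOpen_iff.mp hcl.isOpen_compl z hzn
  refine ⟨min ρ (ε / 2), by positivity, fun p hp => ?_⟩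
  have hpρ : p ∈ ball z ρ := ball_subset_ball (min_le_left _ _) hp.2
  have hpε : dist p z < ε / 2 := ball_subset_ball (min_le_right _ _) hp.2
  have hpε' : p ∈ closedBall z ε := by rw [mem_closedBall]; linarith
  have hpS : p ∈ sublevel u t a' b' c' d' := by rw [hS]; exact ⟨hKS hp.1, hpε'⟩
  obtain ⟨q, hq, hqz⟩ := not_subset.mp (connectedComponentIn_inter_not_subset
    (hu.isCompact_component t x) hKc isClosed_closedBall isOpen_ball ball_subset_closedBall hp.1
    hpε' hKε)
  have hq' : q ∈ connectedComponentIn (sublevel u t a' b' c' d') p := by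
    rw [hS]
    exact connectedComponentIn_mono p (inter_subset_inter_left _ hKS) hq
  have hmem : connectedComponentIn (sublevel u t a' b' c' d') p ∈ 𝒞 := by
    refine ⟨p, hpS, rfl, p, mem_connectedComponentIn hpS, q, hq', ?_⟩
    have h1 := dist_triangle q p z
    rw [mem_ball, not_lt] at hqz
    rw [dist_comm p q]
    linarith
  by_contra hcon
  refine hρ' hpρ ⟨_, ⟨hmem, fun hz' => hcon (mem_connectedComponentIn_comm hz')⟩,
    mem_connectedComponentIn hpS⟩

/-- Components of a sublevel set are uniformly connected im kleinen. -/
theorem IsAdmissible.exists_mem_component (hu : IsAdmissible u a b c d) (hab : a < b)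
    (hcd : c < d) (t : ℝ) (x₀ : ℝ × ℝ) (hε : 0 < ε) :
    ∃ δ > 0, ∀ x ∈ connectedComponentIn (sublevel u t a b c d) x₀,
      ∀ y ∈ connectedComponentIn (sublevel u t a b c d) x₀, dist x y < δ →
        y ∈ connectedComponentIn (sublevel u t a b c d ∩ closedBall x ε) x := by
  set K := connectedComponentIn (sublevel u t a b c d) x₀ with hK
  have h : ∀ z : K, ∃ ρ > 0, ∀ p ∈ K ∩ ball (z : ℝ × ℝ) ρ,
      p ∈ connectedComponentIn (sublevel u t a b c d ∩ closedBall (z : ℝ × ℝ) (ε / 2)) z :=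
    fun z => hu.exists_ball_subset_component hab hcd z.2 (half_pos hε)
  choose ρ hρ H using h
  obtain ⟨δ, hδ, hδ'⟩ := lebesgue_number_lemma_of_metric (hu.isCompact_component t x₀)
    (c := fun z : K => ball (z : ℝ × ℝ) (ρ z)) (fun z => isOpen_ball)
    fun z hz => mem_iUnion.mpr ⟨⟨z, hz⟩, mem_ball_self (hρ _)⟩
  refine ⟨δ, hδ, fun x hx y hy hxy => ?_⟩
  obtain ⟨z, hz⟩ := hδ' x hx
  have hxz := H z x ⟨hx, hz (mem_ball_self hδ)⟩
  have hyz := H z y ⟨hy, hz (by rwa [mem_ball, dist_comm])⟩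
  refine isPreconnected_connectedComponentIn.subset_connectedComponentIn hxz
    (fun w hw => ?_) hyz
  have hw' := connectedComponentIn_subset _ _ hw
  refine ⟨hw'.1, ?_⟩
  have h1 := mem_closedBall.mp hw'.2
  have h2 := mem_closedBall.mp (connectedComponentIn_subset _ _ hxz).2
  have := dist_triangle_right w x z
  rw [mem_closedBall]
  linarith

end

section

theorem exists_glue {X Y : Type*} [TopologicalSpace X] [TopologicalSpace Y] {A B : Set X}
    (hA : IsClosed A) (hB : IsClosed B) {f g : X → Y} (hf : ContinuousOn f A)
    (hg : ContinuousOn g B) (hfg : ∀ x ∈ A, x ∈ B → f x = g x) :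
    ∃ h : X → Y, EqOn h f A ∧ EqOn h g B ∧ ContinuousOn h (A ∪ B) := by
  classical
  have h1 : EqOn (A.piecewise f g) f A := piecewise_eqOn A f g
  have h2 : EqOn (A.piecewise f g) g B := fun x hx => by
    by_cases hxA : x ∈ A
    · rw [h1 hxA, hfg x hxA hx]
    · exact piecewise_eqOn_compl A f g hxA
  exact ⟨A.piecewise f g, h1, h2, (hf.congr h1).union_of_isClosed (hg.congr h2) hA hB⟩

/-- A sequence of maps with geometrically decreasing increments converges to a continuous map. -/
theorem exists_lim_of_dist_le {X Y : Type*} [TopologicalSpace X] [MetricSpace Y] [CompleteSpace Y]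
    {D : Set X} {f : ℕ → X → Y} {C : ℝ} (hf : ∀ n, ContinuousOn (f n) D)
    (hd : ∀ n, ∀ x ∈ D, dist (f n x) (f (n + 1) x) ≤ C / 2 / 2 ^ n) :
    ∃ g : X → Y, ContinuousOn g D ∧ ∀ x ∈ D, Tendsto (fun n => f n x) atTop (𝓝 (g x)) := by
  have h : ∀ x, ∃ y, x ∈ D → Tendsto (fun n => f n x) atTop (𝓝 y) := by
    intro x
    by_cases hx : x ∈ D
    · obtain ⟨y, hy⟩ := cauchySeq_tendsto_of_complete (cauchySeq_of_le_geometric_two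
        (f := fun n => f n x) (C := C) fun n => hd n x hx)
      exact ⟨y, fun _ => hy⟩
    · exact ⟨f 0 x, fun h => absurd h hx⟩
  choose g hg using h
  refine ⟨g, ?_, hg⟩
  have hu : TendstoUniformlyOn f g atTop D := by
    rw [Metric.tendstoUniformlyOn_iff]
    intro ε hε
    have h0 : Tendsto (fun n : ℕ => C / 2 ^ n) atTop (𝓝 0) := by
      simpa [div_eq_mul_inv] using (tendsto_pow_atTop_nhds_zero_of_lt_one
        (r := (2 : ℝ)⁻¹) (by norm_num) (by norm_num)).const_mul C
    filter_upwards [h0.eventually_lt_const hε] with n hn x hx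
    rw [dist_comm]
    exact (dist_le_of_le_geometric_two_of_tendsto (f := fun n => f n x)
      (fun n => hd n x hx) (hg x hx) n).trans_lt hn
  exact hu.continuousOn (Frequently.of_forall hf)

variable {u : ℝ × ℝ → ℝ} {t a b c d ε : ℝ}

/-- A path made of finitely many pieces in balls of radius `ε`, the endpoints of each piece lying in
one component of the part of the sublevel set in the ball. -/
inductive IsFinePath (u : ℝ × ℝ → ℝ) (t a b c d ε : ℝ) : ℝ → ℝ → (ℝ → ℝ × ℝ) → Prop
  | piece (r s : ℝ) (w : ℝ × ℝ) (f : ℝ → ℝ × ℝ) (hrs : r < s) (hw : w ∈ Icc a b ×ˢ Icc c d)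
    (hf : ContinuousOn f (Icc r s))
    (hfQ : MapsTo f (Icc r s) (Icc a b ×ˢ Icc c d ∩ closedBall w ε))
    (h : f s ∈ connectedComponentIn (sublevel u t a b c d ∩ closedBall w ε) (f r)) :
    IsFinePath u t a b c d ε r s f
  | append (r m s : ℝ) (f : ℝ → ℝ × ℝ) (h₁ : IsFinePath u t a b c d ε r m f)
    (h₂ : IsFinePath u t a b c d ε m s f) : IsFinePath u t a b c d ε r s f

variable {r m s : ℝ} {f g : ℝ → ℝ × ℝ}

theorem IsFinePath.lt (h : IsFinePath u t a b c d ε r s f) : r < s := by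
  induction h with
  | piece r s w f hrs => exact hrs
  | append r m s f _ _ h₁ h₂ => exact h₁.trans h₂

theorem IsFinePath.congr (h : IsFinePath u t a b c d ε r s f) (hfg : EqOn g f (Icc r s)) :
    IsFinePath u t a b c d ε r s g := by
  induction h with
  | piece r s w f hrs hw hf hfQ h =>
    refine .piece r s w g hrs hw (hf.congr hfg) (hfQ.congr hfg.symm) ?_
    rwa [hfg (left_mem_Icc.mpr hrs.le), hfg (right_mem_Icc.mpr hrs.le)]
  | append r m s f h₁ h₂ ih₁ ih₂ =>
    exact .append r m s g (ih₁ (hfg.mono (Icc_subset_Icc le_rfl h₂.lt.le)))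
      (ih₂ (hfg.mono (Icc_subset_Icc h₁.lt.le le_rfl)))

theorem IsFinePath.mono {a' b' c' d' : ℝ} (h : IsFinePath u t a' b' c' d' ε r s f)
    (hQ : Icc a' b' ×ˢ Icc c' d' ⊆ Icc a b ×ˢ Icc c d) : IsFinePath u t a b c d ε r s f := by
  have hS : sublevel u t a' b' c' d' ⊆ sublevel u t a b c d := fun p hp => ⟨hQ hp.1, hp.2⟩
  induction h with
  | piece r s w f hrs hw hf hfQ h =>
    exact .piece r s w f hrs (hQ hw) hf (fun x hx => ⟨hQ (hfQ hx).1, (hfQ hx).2⟩)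
      (connectedComponentIn_mono _ (inter_subset_inter_left _ hS) h)
  | append r m s f h₁ h₂ ih₁ ih₂ => exact .append r m s f ih₁ ih₂

theorem IsFinePath.continuousOn (h : IsFinePath u t a b c d ε r s f) :
    ContinuousOn f (Icc r s) := by
  induction h with
  | piece r s w f hrs hw hf hfQ h => exact hf
  | append r m s f h₁ h₂ ih₁ ih₂ =>
    rw [← Icc_union_Icc_eq_Icc h₁.lt.le h₂.lt.le]
    exact ih₁.union_of_isClosed ih₂ isClosed_Icc isClosed_Icc

theorem IsFinePath.exists_dist_le (h : IsFinePath u t a b c d ε r s f) :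
    ∀ x ∈ Icc r s, ∃ p ∈ sublevel u t a b c d, dist (f x) p ≤ 2 * ε := by
  induction h with
  | piece r s w f hrs hw hf hfQ h =>
    intro x hx
    have hr := connectedComponentIn_subset _ _ (mem_connectedComponentIn_comm h)
    refine ⟨f r, hr.1, ?_⟩
    have h1 := mem_closedBall.mp hr.2
    have h2 := mem_closedBall.mp (hfQ hx).2
    linarith [dist_triangle_right (f x) (f r) w]
  | append r m s f h₁ h₂ ih₁ ih₂ =>
    intro x hx
    rw [← Icc_union_Icc_eq_Icc h₁.lt.le h₂.lt.le] at hx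
    exact hx.elim (ih₁ x) (ih₂ x)

theorem IsFinePath.glue (h₁ : IsFinePath u t a b c d ε r m f) (h₂ : IsFinePath u t a b c d ε m s g)
    (hm : f m = g m) : ∃ h, IsFinePath u t a b c d ε r s h ∧ EqOn h f (Icc r m) ∧
      EqOn h g (Icc m s) := by
  obtain ⟨h, hf, hg, -⟩ := exists_glue isClosed_Icc isClosed_Icc h₁.continuousOn h₂.continuousOn
    fun x hx hx' => by rw [le_antisymm hx.2 hx'.1]; exact hm
  exact ⟨h, .append r m s h (h₁.congr hf) (h₂.congr hg), hf, hg⟩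

theorem IsAdmissible.exists_isFinePath (hu : IsAdmissible u a b c d) (hab : a < b) (hcd : c < d)
    {x y : ℝ × ℝ} (hxy : y ∈ connectedComponentIn (sublevel u t a b c d) x) (hε : 0 < ε) :
    ∀ r s, r < s → ∃ f, IsFinePath u t a b c d ε r s f ∧ f r = x ∧ f s = y ∧
      MapsTo f (Icc r s) (Icc a b ×ˢ Icc c d) := by
  have hxS := connectedComponentIn_nonempty_iff.mp ⟨y, hxy⟩
  refine (isPreconnected_connectedComponentIn (x := x) (F := sublevel u t a b c d)).induction₂'
    (fun x y => ∀ r s, r < s → ∃ f, IsFinePath u t a b c d ε r s f ∧ f r = x ∧ f s = y ∧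
      MapsTo f (Icc r s) (Icc a b ×ˢ Icc c d)) ?_ ?_ (mem_connectedComponentIn hxS) hxy
  · intro z hz
    obtain ⟨δ, hδ, H⟩ := hu.exists_mem_component hab hcd t x hε
    have key : ∀ p q w : ℝ × ℝ, w ∈ Icc a b ×ˢ Icc c d →
        q ∈ connectedComponentIn (sublevel u t a b c d ∩ closedBall w ε) p →
        ∀ r s, r < s → ∃ f, IsFinePath u t a b c d ε r s f ∧ f r = p ∧ f s = q ∧
          MapsTo f (Icc r s) (Icc a b ×ˢ Icc c d) := by
      intro p q w hw hq r s hrs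
      have hq' := connectedComponentIn_subset _ _ hq
      have hp' := connectedComponentIn_subset _ _ (mem_connectedComponentIn_comm hq)
      set f : ℝ → ℝ × ℝ := fun x => AffineMap.lineMap p q ((x - r) / (s - r)) with hf
      have hf0 : f r = p := by simp [hf]
      have hf1 : f s = q := by simp [hf, div_self (sub_pos.mpr hrs).ne']
      have hmaps : MapsTo f (Icc r s) (Icc a b ×ˢ Icc c d ∩ closedBall w ε) := by
        intro x hx
        refine ((convex_rect a b c d).inter (convex_closedBall w ε)).lineMap_mem
          ⟨hp'.1.1, hp'.2⟩ ⟨hq'.1.1, hq'.2⟩ ⟨?_, ?_⟩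
        · exact div_nonneg (sub_nonneg.mpr hx.1) (sub_pos.mpr hrs).le
        · exact (div_le_one (sub_pos.mpr hrs)).mpr (by linarith [hx.2])
      refine ⟨f, .piece r s w f hrs hw ?_ hmaps (by rwa [hf0, hf1]), hf0, hf1,
        fun x hx => (hmaps hx).1⟩
      exact (AffineMap.lineMap_continuous.comp (by fun_prop)).continuousOn
    have hzQ := (connectedComponentIn_subset _ _ hz).1
    filter_upwards [self_mem_nhdsWithin, mem_nhdsWithin_of_mem_nhds (ball_mem_nhds z hδ)]
      with w hw hwz
    have hzw := H z hz w hw (by rwa [dist_comm])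
    exact ⟨key z w z hzQ hzw, key w z z hzQ (mem_connectedComponentIn_comm hzw)⟩
  · intro p q w _ _ _ hpq hqw r s hrs
    obtain ⟨f, hf, hfr, hfm, hfQ⟩ := hpq r ((r + s) / 2) (by linarith)
    obtain ⟨g, hg, hgm, hgs, hgQ⟩ := hqw ((r + s) / 2) s (by linarith)
    obtain ⟨h, hh, hhf, hhg⟩ := hf.glue hg (hfm.trans hgm.symm)
    refine ⟨h, hh, ?_, ?_, ?_⟩
    · rw [hhf (left_mem_Icc.mpr hf.lt.le), hfr]
    · rw [hhg (right_mem_Icc.mpr hg.lt.le), hgs]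
    · rw [← Icc_union_Icc_eq_Icc hf.lt.le hg.lt.le]
      exact (hfQ.congr hhf.symm).union (hgQ.congr hhg.symm)

theorem IsFinePath.exists_refinement (hu : IsAdmissible u a b c d) (hab : a < b) (hcd : c < d)
    (hε : 0 < ε) (h : IsFinePath u t a b c d ε r s f) {ε' : ℝ} (hε' : 0 < ε') :
    ∃ g, IsFinePath u t a b c d ε' r s g ∧ g r = f r ∧ g s = f s ∧
      ∀ x ∈ Icc r s, dist (f x) (g x) ≤ 2 * ε := by
  induction h with
  | piece r s w f hrs hw hf hfQ h =>
    obtain ⟨a', b', c', d', hab', hcd', hu', hQ, hS⟩ := exists_rect_inter hu hab hcd hw hε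
    rw [← hS] at h
    obtain ⟨g, hg, hgr, hgs, hgQ⟩ := hu'.exists_isFinePath hab' hcd' h hε' r s hrs
    rw [hQ] at hgQ
    refine ⟨g, hg.mono (by rw [hQ]; exact inter_subset_left), hgr, hgs, fun x hx => ?_⟩
    have h1 := mem_closedBall.mp (hgQ hx).2
    have h2 := mem_closedBall.mp (hfQ hx).2
    linarith [dist_triangle_right (f x) (g x) w]
  | append r m s f h₁ h₂ ih₁ ih₂ =>
    obtain ⟨g₁, hg₁, hr₁, hs₁, hd₁⟩ := ih₁
    obtain ⟨g₂, hg₂, hr₂, hs₂, hd₂⟩ := ih₂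
    obtain ⟨g, hg, hgf, hgg⟩ := hg₁.glue hg₂ (hs₁.trans hr₂.symm)
    refine ⟨g, hg, ?_, ?_, fun x hx => ?_⟩
    · rw [hgf (left_mem_Icc.mpr h₁.lt.le), hr₁]
    · rw [hgg (right_mem_Icc.mpr h₂.lt.le), hs₂]
    · rw [← Icc_union_Icc_eq_Icc h₁.lt.le h₂.lt.le] at hx
      rcases hx with hx | hx
      · rw [hgf hx]; exact hd₁ x hx
      · rw [hgg hx]; exact hd₂ x hx

/-- Components of sublevel sets are path connected. -/
theorem IsAdmissible.joinedIn_component (hu : IsAdmissible u a b c d) (hab : a < b) (hcd : c < d)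
    {x y : ℝ × ℝ} (hxy : y ∈ connectedComponentIn (sublevel u t a b c d) x) :
    JoinedIn (connectedComponentIn (sublevel u t a b c d) x) x y := by
  set e : ℕ → ℝ := fun n => 1 / 2 ^ n with he
  have hpos : ∀ n, 0 < e n := fun n => by positivity
  obtain ⟨f₀, hf₀, hf₀r, hf₀s, -⟩ := hu.exists_isFinePath hab hcd hxy (hpos 0) 0 1 one_pos
  have step : ∀ (n : ℕ) (f : {f // IsFinePath u t a b c d (e n) 0 1 f}),
      ∃ g : {f // IsFinePath u t a b c d (e (n + 1)) 0 1 f}, g.1 0 = f.1 0 ∧ g.1 1 = f.1 1 ∧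
        ∀ x ∈ Icc (0 : ℝ) 1, dist (f.1 x) (g.1 x) ≤ 2 * e n := by
    rintro n ⟨f, hf⟩
    obtain ⟨g, hg, h⟩ := hf.exists_refinement hu hab hcd (hpos n) (hpos (n + 1))
    exact ⟨⟨g, hg⟩, h⟩
  choose F hF0 hF1 hFd using step
  let G : ∀ n, {f // IsFinePath u t a b c d (e n) 0 1 f} := fun n => Nat.rec ⟨f₀, hf₀⟩ F n
  have hG0 : ∀ n, (G n).1 0 = x := fun n => by
    induction n with
    | zero => exact hf₀r
    | succ n ih => exact (hF0 n (G n)).trans ih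
  have hG1 : ∀ n, (G n).1 1 = y := fun n => by
    induction n with
    | zero => exact hf₀s
    | succ n ih => exact (hF1 n (G n)).trans ih
  obtain ⟨g, hg, hlim⟩ := exists_lim_of_dist_le (f := fun n => (G n).1) (D := Icc (0 : ℝ) 1) (C := 4)
    (fun n => (G n).2.continuousOn) (fun n x hx => by
      have := hFd n (G n) x hx
      simp only [he] at this
      calc _ ≤ _ := this
        _ = _ := by ring)
  have h0 : (0 : ℝ) ∈ Icc (0 : ℝ) 1 := left_mem_Icc.mpr zero_le_one
  have h1 : (1 : ℝ) ∈ Icc (0 : ℝ) 1 := right_mem_Icc.mpr zero_le_one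
  have hg0 : g 0 = x := tendsto_nhds_unique (hlim 0 h0) (by simp [hG0])
  have hg1 : g 1 = y := tendsto_nhds_unique (hlim 1 h1) (by simp [hG1])
  have he0 : Tendsto (fun n => 2 * e n) atTop (𝓝 0) := by
    simpa [he] using (tendsto_pow_atTop_nhds_zero_of_lt_one
      (r := (2 : ℝ)⁻¹) (by norm_num) (by norm_num)).const_mul 2
  have hgS : MapsTo g (Icc 0 1) (sublevel u t a b c d) := by
    intro x hx
    choose p hp hpd using fun n => (G n).2.exists_dist_le x hx
    have : Tendsto p atTop (𝓝 (g x)) := (tendsto_iff_of_dist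
      (squeeze_zero (fun _ => dist_nonneg) hpd he0)).mp (hlim x hx)
    exact (hu.isClosed_sublevel t).mem_of_tendsto this (Eventually.of_forall hp)
  have hgK : g '' Icc 0 1 ⊆ connectedComponentIn (sublevel u t a b c d) x :=
    (isPreconnected_Icc.image g hg).subset_connectedComponentIn ⟨0, h0, hg0⟩
      (image_subset_iff.mpr hgS)
  exact JoinedIn.ofLine hg hg0 hg1 hgK

/-- Components of sublevel sets are uniformly locally path connected. -/
theorem IsAdmissible.exists_joinedIn (hu : IsAdmissible u a b c d) (hab : a < b)
    (hcd : c < d) (t : ℝ) (x₀ : ℝ × ℝ) (hε : 0 < ε) :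
    ∃ δ > 0, ∀ x ∈ connectedComponentIn (sublevel u t a b c d) x₀,
      ∀ y ∈ connectedComponentIn (sublevel u t a b c d) x₀, dist x y < δ →
        JoinedIn (connectedComponentIn (sublevel u t a b c d) x₀ ∩ closedBall x ε) x y := by
  obtain ⟨δ, hδ, H⟩ := hu.exists_mem_component hab hcd t x₀ hε
  refine ⟨δ, hδ, fun x hx y hy hxy => ?_⟩
  obtain ⟨a', b', c', d', hab', hcd', hu', hQ, hS⟩ :=
    exists_rect_inter hu hab hcd (connectedComponentIn_subset _ _ hx).1 hε
  have := H x hx y hy hxy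
  rw [← hS] at this
  refine (hu'.joinedIn_component hab' hcd' this).mono ?_
  rw [hS, connectedComponentIn_eq hx]
  exact subset_inter (connectedComponentIn_mono x inter_subset_left)
    ((connectedComponentIn_subset _ _).trans inter_subset_right)

end

section

open scoped NNReal

variable {u : ℝ × ℝ → ℝ} {t a b c d ε : ℝ}

/-- A point outside a component of the sublevel set can be connected to the exterior of the
rectangle in the complement of the component. -/
theorem IsAdmissible.exists_leaving_set (hu : IsAdmissible u a b c d) {x p : ℝ × ℝ}
    (hx : x ∈ sublevel u t a b c d) (hp : p ∈ Icc a b ×ˢ Icc c d)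
    (hpK : p ∉ connectedComponentIn (sublevel u t a b c d) x) {O : Set (ℝ × ℝ)} (hO : IsOpen O)
    (hQO : Icc a b ×ˢ Icc c d ⊆ O) :
    ∃ W, IsOpen W ∧ IsPreconnected W ∧ p ∈ W ∧ W ⊆ O ∧
      Disjoint W (connectedComponentIn (sublevel u t a b c d) x) ∧
      ∃ q ∈ W, q ∉ Icc a b ×ˢ Icc c d := by
  obtain ⟨A, B, hA, hB, hAB, hdis, hKA, hAp⟩ := exists_clopen_split (hu.isCompact_sublevel t) hx
    (isOpen_compl_singleton (x := p)) (by simpa using hpK)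
  have hAS : ∀ z ∈ A ∪ B, u z ≤ t := fun z hz => by rw [hAB] at hz; exact hz.2
  have hpOA : p ∈ O \ A := ⟨hQO hp, fun h => hAp h rfl⟩
  set V := connectedComponentIn (O \ A) p with hV
  have hVo : IsOpen V := (hO.sdiff hA).connectedComponentIn
  have hVc : IsPreconnected V := isPreconnected_connectedComponentIn
  have hpV : p ∈ V := mem_connectedComponentIn hpOA
  have hVOA : V ⊆ O \ A := connectedComponentIn_subset _ _
  refine ⟨V, hVo, hVc, hpV, hVOA.trans sdiff_subset,
    disjoint_left.mpr fun z hz hzK => (hVOA hz).2 (hKA hzK), ?_⟩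
  by_contra! hVQ
  have hVI : V ⊆ Ioo a b ×ˢ Ioo c d := by
    have := interior_maximal (fun z hz => hVQ z hz) hVo
    rwa [interior_prod_eq, interior_Icc, interior_Icc] at this
  have hclQ : closure V ⊆ Icc a b ×ˢ Icc c d :=
    closure_minimal (fun z hz => hVQ z hz) (isCompact_rect a b c d).isClosed
  have hcl : ∀ z ∈ closure V, z ∉ A → z ∈ V := by
    intro z hz hzA
    have h1 : IsPreconnected (insert z V) :=
      hVc.subset_closure (subset_insert z V) (insert_subset hz subset_closure)
    have h2 : insert z V ⊆ O \ A := by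
      rintro w (rfl | hw)
      exacts [⟨hQO (hclQ hz), hzA⟩, hVOA hw]
    exact h1.subset_connectedComponentIn (mem_insert_of_mem z hpV) h2 (mem_insert z V)
  obtain ⟨z, hz, hmax⟩ := ((isCompact_rect a b c d).of_isClosed_subset isClosed_closure
    hclQ).exists_isMaxOn ⟨p, subset_closure hpV⟩ (hu.cont.mono hclQ)
  by_cases hzA : z ∈ A
  · have hut : ∀ w ∈ V, u w ≤ t := fun w hw =>
      (hmax (subset_closure hw)).trans (hAS z (Or.inl hzA))
    have hVB : V ⊆ B := by
      intro w hw
      have : w ∈ A ∪ B := by rw [hAB]; exact ⟨hVQ w hw, hut w hw⟩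
      exact this.resolve_left (hVOA hw).2
    have hVcl : IsClosed V := isClosed_of_closure_subset fun w hw =>
      hcl w hw fun hwA => disjoint_left.mp hdis hwA (closure_minimal hVB hB hw)
    have huniv := IsClopen.eq_univ ⟨hVcl, hVo⟩ ⟨p, hpV⟩
    have : ((b + 1, c) : ℝ × ℝ) ∈ V := by rw [huniv]; trivial
    have := (hVQ _ this).1.2
    simp only at this
    linarith
  · have hzV := hcl z hz hzA
    refine hu.not_isLocalMax (hVI hzV) ?_
    filter_upwards [hVo.mem_nhds hzV] with w hw
    exact hmax (subset_closure hw)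

theorem exists_homeomorph_of_dist_lt {E : Type*} [NormedAddCommGroup E] [NormedSpace ℝ E]
    [CompleteSpace E] {x y : E} {r : ℝ} (hr : 0 < r) (hxy : dist y x < r) :
    ∃ h : E ≃ₜ E, (∀ z ∉ ball x r, h z = z) ∧ h x = y := by
  lift r to ℝ≥0 using hr.le
  set φ : E → E := fun z => z + max 0 (1 - dist z x / r) • (y - x) with hφ
  have hk : ‖y - x‖₊ / r < 1 := by
    rw [← NNReal.coe_lt_coe]
    simpa [div_lt_one hr, ← dist_eq_norm] using hxy
  have happ : ApproximatesLinearOn φ (ContinuousLinearEquiv.refl ℝ E : E →L[ℝ] E) univ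
      (‖y - x‖₊ / r) := by
    intro z _ w _
    have h1 : φ z - φ w - (ContinuousLinearEquiv.refl ℝ E : E →L[ℝ] E) (z - w) =
        (max 0 (1 - dist z x / r) - max 0 (1 - dist w x / r)) • (y - x) := by
      simp only [hφ, ContinuousLinearEquiv.coe_refl, ContinuousLinearMap.coe_id', id, sub_smul]
      abel
    have h2 : |max 0 (1 - dist z x / r) - max 0 (1 - dist w x / r)| ≤ ‖z - w‖ / r := by
      rw [max_comm 0, max_comm 0]
      refine (abs_max_sub_max_le_abs _ _ _).trans ?_
      rw [sub_sub_sub_cancel_left, ← sub_div, abs_div, abs_of_pos hr, abs_sub_comm,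
        ← dist_eq_norm]
      gcongr
      exact abs_dist_sub_le z w x
    rw [h1, norm_smul, Real.norm_eq_abs]
    calc _ ≤ ‖z - w‖ / r * ‖y - x‖ := by gcongr
      _ = _ := by push_cast; ring
  have hc : Subsingleton E ∨ ‖y - x‖₊ / r <
      ‖((ContinuousLinearEquiv.refl ℝ E).symm : E →L[ℝ] E)‖₊⁻¹ := by
    rcases subsingleton_or_nontrivial E with h | h
    · exact Or.inl h
    · right
      simpa using hk
  refine ⟨happ.toHomeomorph φ hc, fun z hz => ?_, ?_⟩
  · change φ z = z
    rw [mem_ball, not_lt] at hz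
    have : 1 - dist z x / r ≤ 0 := by
      rw [sub_nonpos, le_div_iff₀ hr, one_mul]; exact hz
    simp [hφ, max_eq_left this]
  · change φ x = y
    simp [hφ]

theorem exists_homeomorph_of_isPreconnected {E : Type*} [NormedAddCommGroup E] [NormedSpace ℝ E]
    [CompleteSpace E] {W : Set E} (hW : IsOpen W) (hWc : IsPreconnected W) {p q : E} (hp : p ∈ W)
    (hq : q ∈ W) : ∃ h : E ≃ₜ E, (∀ z ∉ W, h z = z) ∧ h p = q := by
  refine hWc.induction₂ (fun p q => ∃ h : E ≃ₜ E, (∀ z ∉ W, h z = z) ∧ h p = q) ?_ ?_ ?_ hp hq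
  · intro x hx
    obtain ⟨r, hr, hrW⟩ := Metric.isOpen_iff.mp hW x hx
    filter_upwards [mem_nhdsWithin_of_mem_nhds (ball_mem_nhds x hr)] with y hy
    obtain ⟨h, h1, h2⟩ := exists_homeomorph_of_dist_lt hr hy
    exact ⟨h, fun z hz => h1 z fun hz' => hz (hrW hz'), h2⟩
  · rintro x y z - - - ⟨h, h1, h2⟩ ⟨k, k1, k2⟩
    exact ⟨h.trans k, fun w hw => by simp [h1 w hw, k1 w hw], by simp [h2, k2]⟩
  · rintro x y - - ⟨h, h1, h2⟩
    exact ⟨h.symm, fun w hw => by rw [h.symm_apply_eq, h1 w hw], by rw [h.symm_apply_eq, h2]⟩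

/-- Finitely many points outside a component of the sublevel set can be moved out of the rectangle
by a homeomorphism fixing the component. -/
theorem IsAdmissible.exists_homeomorph (hu : IsAdmissible u a b c d) {x : ℝ × ℝ}
    (hx : x ∈ sublevel u t a b c d) {P : Set (ℝ × ℝ)} (hP : P.Finite)
    (hPK : Disjoint P (connectedComponentIn (sublevel u t a b c d) x)) :
    ∃ h : ℝ × ℝ ≃ₜ ℝ × ℝ, (∀ z ∈ connectedComponentIn (sublevel u t a b c d) x, h z = z) ∧
      ∀ p ∈ P, h p ∉ Icc a b ×ˢ Icc c d := by
  induction P, hP using Set.Finite.induction_on with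
  | empty => exact ⟨Homeomorph.refl _, fun z _ => rfl, by simp⟩
  | @insert p P _ hP ih =>
    rw [disjoint_insert_left] at hPK
    obtain ⟨h, hK, hPQ⟩ := ih hPK.2
    by_cases hpQ : h p ∈ Icc a b ×ˢ Icc c d
    · have hpK : h p ∉ connectedComponentIn (sublevel u t a b c d) x := fun hcon =>
        hPK.1 (by rwa [h.injective (hK _ hcon)] at hcon)
      obtain ⟨W, hWo, hWc, hpW, hWP, hWK, q, hq, hqQ⟩ := hu.exists_leaving_set hx hpQ hpK
        (hP.image h).isClosed.isOpen_compl (by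
          rintro z hz ⟨p', hp', rfl⟩
          exact hPQ p' hp' hz)
      obtain ⟨k, k1, k2⟩ := exists_homeomorph_of_isPreconnected hWo hWc hpW hq
      refine ⟨h.trans k, fun z hz => ?_, ?_⟩
      · rw [Homeomorph.trans_apply, hK z hz, k1 z (disjoint_right.mp hWK hz)]
      · rintro p' (rfl | hp')
        · rwa [Homeomorph.trans_apply, k2]
        · rw [Homeomorph.trans_apply, k1 _ fun hcon => hWP hcon (mem_image_of_mem h hp')]
          exact hPQ p' hp'
    · exact ⟨h, hK, by rintro p' (rfl | hp'); exacts [hpQ, hPQ p' hp']⟩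

end

section

variable {Y : Type*} [TopologicalSpace Y] {adm : ℝ × ℝ → Y → Prop} {z w : ℝ × ℝ} {p q r : Y}

/-- The values `p` and `q` at the endpoints of a segment extend to a continuous function on the
segment whose values are admissible. -/
def EdgeFill (adm : ℝ × ℝ → Y → Prop) (z w : ℝ × ℝ) (p q : Y) : Prop :=
  ∃ e : ℝ → Y, ContinuousOn e (Icc 0 1) ∧ e 0 = p ∧ e 1 = q ∧
    ∀ s ∈ Icc (0 : ℝ) 1, adm (AffineMap.lineMap z w s) (e s)

theorem EdgeFill.symm (h : EdgeFill adm z w p q) : EdgeFill adm w z q p := by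
  obtain ⟨e, he, h0, h1, ha⟩ := h
  refine ⟨fun s => e (1 - s), he.comp (by fun_prop) fun s hs => ?_, by simpa, by simpa,
    fun s hs => ?_⟩
  · exact ⟨by linarith [hs.2], by linarith [hs.1]⟩
  · have := ha (1 - s) ⟨by linarith [hs.2], by linarith [hs.1]⟩
    rwa [AffineMap.lineMap_apply_one_sub] at this

theorem EdgeFill.of_joinedIn {A : Set Y} (h : JoinedIn A p q)
    (hA : ∀ s ∈ Icc (0 : ℝ) 1, ∀ y ∈ A, adm (AffineMap.lineMap z w s) y) :
    EdgeFill adm z w p q := by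
  obtain ⟨γ, hγ⟩ := h
  refine ⟨γ.extend, γ.continuous_extend.continuousOn, by simp, by simp, fun s hs => hA s hs _ ?_⟩
  rw [γ.extend_apply hs]
  exact hγ _

theorem EdgeFill.trans {s₀ : ℝ} (hs₀ : s₀ ∈ Ioo (0 : ℝ) 1)
    (h₁ : EdgeFill adm z (AffineMap.lineMap z w s₀) p r)
    (h₂ : EdgeFill adm (AffineMap.lineMap z w s₀) w r q) : EdgeFill adm z w p q := by
  obtain ⟨e, he, e0, e1, ea⟩ := h₁
  obtain ⟨f, hf, f0, f1, fa⟩ := h₂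
  have hs0 : 0 < s₀ := hs₀.1
  have hs1 : 0 < 1 - s₀ := by linarith [hs₀.2]
  have hm₁ : ∀ s ∈ Icc 0 s₀, s / s₀ ∈ Icc (0 : ℝ) 1 := fun s hs =>
    ⟨div_nonneg hs.1 hs0.le, (div_le_one hs0).mpr hs.2⟩
  have hm₂ : ∀ s ∈ Icc s₀ 1, (s - s₀) / (1 - s₀) ∈ Icc (0 : ℝ) 1 := fun s hs =>
    ⟨div_nonneg (by linarith [hs.1]) hs1.le, (div_le_one hs1).mpr (by linarith [hs.2])⟩
  obtain ⟨k, hk₁, hk₂, hk⟩ := exists_glue (A := Icc 0 s₀) (B := Icc s₀ 1) isClosed_Icc isClosed_Icc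
    (f := fun s => e (s / s₀)) (g := fun s => f ((s - s₀) / (1 - s₀)))
    (he.comp (by fun_prop) hm₁) (hf.comp (by fun_prop) hm₂) fun x hx hx' => by
      rw [le_antisymm hx.2 hx'.1, div_self hs0.ne', sub_self, zero_div, e1, f0]
  rw [Icc_union_Icc_eq_Icc hs0.le hs₀.2.le] at hk
  refine ⟨k, hk, ?_, ?_, fun s hs => ?_⟩
  · simp [hk₁ (left_mem_Icc.mpr hs0.le), e0]
  · simp [hk₂ (right_mem_Icc.mpr hs₀.2.le), div_self hs1.ne', f1]
  · rcases le_total s s₀ with h | h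
    · have h' : s ∈ Icc 0 s₀ := ⟨hs.1, h⟩
      rw [hk₁ h']
      convert ea _ (hm₁ s h') using 1
      simp only [AffineMap.lineMap_apply_module]
      ext <;> simp <;> field_simp <;> ring
    · have h' : s ∈ Icc s₀ 1 := ⟨h, hs.2⟩
      rw [hk₂ h']
      convert fa _ (hm₂ s h') using 1
      simp only [AffineMap.lineMap_apply_module]
      have hs1' := hs1.ne'
      ext <;> simp <;> field_simp <;> ring

theorem EdgeFill.of_midpoint (h₁ : EdgeFill adm z (midpoint ℝ z w) p r)
    (h₂ : EdgeFill adm w (midpoint ℝ z w) q r) : EdgeFill adm z w p q :=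
  EdgeFill.trans (s₀ := 2⁻¹) (by norm_num)
    (by simpa [midpoint] using h₁) (by simpa [midpoint] using h₂.symm)

theorem EdgeFill.of_small {Q : Set (ℝ × ℝ)} (hQ : Convex ℝ Q) (hpt : ∀ z ∈ Q, ∃ p, adm z p)
    {η : ℝ} (hη : 0 < η) (h : ∀ z ∈ Q, ∀ w ∈ Q, dist z w < η → ∀ p q, adm z p → adm w q →
      EdgeFill adm z w p q) (hz : z ∈ Q) (hw : w ∈ Q) (hp : adm z p) (hq : adm w q) :
    EdgeFill adm z w p q := by
  have H : ∀ n : ℕ, ∀ z ∈ Q, ∀ w ∈ Q, dist z w < 2 ^ n * η → ∀ p q, adm z p → adm w q →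
      EdgeFill adm z w p q := by
    intro n
    induction n with
    | zero => simpa using h
    | succ n ih =>
      intro z hz w hw hzw p q hp hq
      have hm : midpoint ℝ z w ∈ Q := hQ.midpoint_mem hz hw
      obtain ⟨r, hr⟩ := hpt _ hm
      rw [pow_succ] at hzw
      refine EdgeFill.of_midpoint (ih z hz _ hm ?_ p r hp hr) (ih w hw _ hm ?_ q r hq hr)
      · rw [dist_left_midpoint]; norm_num; linarith
      · rw [dist_right_midpoint]; norm_num; linarith
  obtain ⟨n, hn⟩ := pow_unbounded_of_one_lt (dist z w / η) one_lt_two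
  exact H n z hz w hw ((div_lt_iff₀ hη).mp hn) p q hp hq

/-- The boundary of a rectangle. -/
def frame (a b c d : ℝ) : Set (ℝ × ℝ) :=
  (Icc a b ×ˢ Icc c d) \ (Ioo a b ×ˢ Ioo c d)

theorem frame_subset (a b c d : ℝ) : frame a b c d ⊆ Icc a b ×ˢ Icc c d := sdiff_subset

theorem isClosed_frame (a b c d : ℝ) : IsClosed (frame a b c d) :=
  (isClosed_Icc.prod isClosed_Icc).sdiff (isOpen_Ioo.prod isOpen_Ioo)

theorem frame_left_subset {a b c d m : ℝ} (hm : m ∈ Ioo a b) :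
    frame a m c d ⊆ frame a b c d ∪ {m} ×ˢ Icc c d := by
  rintro z ⟨⟨h1, h2⟩, h3⟩
  by_cases hz : z.1 = m
  · exact Or.inr ⟨hz, h2⟩
  · refine Or.inl ⟨⟨⟨h1.1, h1.2.trans hm.2.le⟩, h2⟩, fun h => h3 ⟨⟨h.1.1, ?_⟩, h.2⟩⟩
    exact lt_of_le_of_ne h1.2 hz

theorem frame_right_subset {a b c d m : ℝ} (hm : m ∈ Ioo a b) :
    frame m b c d ⊆ frame a b c d ∪ {m} ×ˢ Icc c d := by
  rintro z ⟨⟨h1, h2⟩, h3⟩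
  by_cases hz : z.1 = m
  · exact Or.inr ⟨hz, h2⟩
  · refine Or.inl ⟨⟨⟨hm.1.le.trans h1.1, h1.2⟩, h2⟩, fun h => h3 ⟨⟨?_, h.1.2⟩, h.2⟩⟩
    exact lt_of_le_of_ne h1.1 (Ne.symm hz)

theorem frame_bot_subset {a b c d m : ℝ} (hm : m ∈ Ioo c d) :
    frame a b c m ⊆ frame a b c d ∪ Icc a b ×ˢ {m} := by
  rintro z ⟨⟨h1, h2⟩, h3⟩
  by_cases hz : z.2 = m
  · exact Or.inr ⟨h1, hz⟩
  · refine Or.inl ⟨⟨h1, h2.1, h2.2.trans hm.2.le⟩, fun h => h3 ⟨h.1, h.2.1, ?_⟩⟩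
    exact lt_of_le_of_ne h2.2 hz

theorem frame_top_subset {a b c d m : ℝ} (hm : m ∈ Ioo c d) :
    frame a b m d ⊆ frame a b c d ∪ Icc a b ×ˢ {m} := by
  rintro z ⟨⟨h1, h2⟩, h3⟩
  by_cases hz : z.2 = m
  · exact Or.inr ⟨h1, hz⟩
  · refine Or.inl ⟨⟨h1, hm.1.le.trans h2.1, h2.2⟩, fun h => h3 ⟨h.1, ?_, h.2.2⟩⟩
    exact lt_of_le_of_ne h2.1 (Ne.symm hz)

/-- A rectangle is the union of two rectangles which do not meet each other's interior. -/
structure IsSplit (a b c d a₁ b₁ c₁ d₁ a₂ b₂ c₂ d₂ : ℝ) : Prop where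
  rect_eq : Icc a b ×ˢ Icc c d = Icc a₁ b₁ ×ˢ Icc c₁ d₁ ∪ Icc a₂ b₂ ×ˢ Icc c₂ d₂
  interior_left : Ioo a₁ b₁ ×ˢ Ioo c₁ d₁ ⊆ Ioo a b ×ˢ Ioo c d
  interior_right : Ioo a₂ b₂ ×ˢ Ioo c₂ d₂ ⊆ Ioo a b ×ˢ Ioo c d
  disjoint_left : Disjoint (Icc a₁ b₁ ×ˢ Icc c₁ d₁) (Ioo a₂ b₂ ×ˢ Ioo c₂ d₂)
  disjoint_right : Disjoint (Icc a₂ b₂ ×ˢ Icc c₂ d₂) (Ioo a₁ b₁ ×ˢ Ioo c₁ d₁)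

theorem isSplit_fst {a m b : ℝ} (ham : a < m) (hmb : m < b) (c d : ℝ) :
    IsSplit a b c d a m c d m b c d where
  rect_eq := by rw [← union_prod, Icc_union_Icc_eq_Icc ham.le hmb.le]
  interior_left := prod_mono (Ioo_subset_Ioo le_rfl hmb.le) le_rfl
  interior_right := prod_mono (Ioo_subset_Ioo ham.le le_rfl) le_rfl
  disjoint_left := disjoint_left.mpr fun _ hz hz' => absurd hz.1.2 (not_le.mpr hz'.1.1)
  disjoint_right := disjoint_left.mpr fun _ hz hz' => absurd hz.1.1 (not_le.mpr hz'.1.2)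

theorem isSplit_snd {c m d : ℝ} (hcm : c < m) (hmd : m < d) (a b : ℝ) :
    IsSplit a b c d a b c m a b m d where
  rect_eq := by rw [← prod_union, Icc_union_Icc_eq_Icc hcm.le hmd.le]
  interior_left := prod_mono le_rfl (Ioo_subset_Ioo le_rfl hmd.le)
  interior_right := prod_mono le_rfl (Ioo_subset_Ioo hcm.le le_rfl)
  disjoint_left := disjoint_left.mpr fun _ hz hz' => absurd hz.2.2 (not_le.mpr hz'.2.1)
  disjoint_right := disjoint_left.mpr fun _ hz hz' => absurd hz.2.1 (not_le.mpr hz'.2.2)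

namespace IsSplit

variable {a b c d a₁ b₁ c₁ d₁ a₂ b₂ c₂ d₂ : ℝ}

theorem mem_frame (h : IsSplit a b c d a₁ b₁ c₁ d₁ a₂ b₂ c₂ d₂)
    (hz : z ∈ frame a b c d) : z ∈ frame a₁ b₁ c₁ d₁ ∨ z ∈ frame a₂ b₂ c₂ d₂ := by
  have hzR := hz.1
  rw [h.rect_eq] at hzR
  exact hzR.imp (fun h' => ⟨h', fun hI => hz.2 (h.interior_left hI)⟩)
    (fun h' => ⟨h', fun hI => hz.2 (h.interior_right hI)⟩)

theorem mem_frame_left (h : IsSplit a b c d a₁ b₁ c₁ d₁ a₂ b₂ c₂ d₂)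
    (hz : z ∈ Icc a₁ b₁ ×ˢ Icc c₁ d₁) (hz' : z ∈ Icc a₂ b₂ ×ˢ Icc c₂ d₂) :
    z ∈ frame a₁ b₁ c₁ d₁ :=
  ⟨hz, Set.disjoint_left.mp h.disjoint_right hz'⟩

theorem mem_frame_right (h : IsSplit a b c d a₁ b₁ c₁ d₁ a₂ b₂ c₂ d₂)
    (hz : z ∈ Icc a₁ b₁ ×ˢ Icc c₁ d₁) (hz' : z ∈ Icc a₂ b₂ ×ˢ Icc c₂ d₂) :
    z ∈ frame a₂ b₂ c₂ d₂ :=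
  ⟨hz', Set.disjoint_left.mp h.disjoint_left hz⟩

end IsSplit

theorem frame_of_fst_mem {a b c d : ℝ} (hz : z ∈ frame a b c d) (h : z.1 ∈ Ioo a b) :
    z.2 = c ∨ z.2 = d := by
  by_contra! hcon
  exact hz.2 ⟨h, lt_of_le_of_ne hz.1.2.1 hcon.1.symm, lt_of_le_of_ne hz.1.2.2 hcon.2⟩

theorem frame_of_snd_mem {a b c d : ℝ} (hz : z ∈ frame a b c d) (h : z.2 ∈ Ioo c d) :
    z.1 = a ∨ z.1 = b := by
  by_contra! hcon
  exact hz.2 ⟨⟨lt_of_le_of_ne hz.1.1.1 hcon.1.symm, lt_of_le_of_ne hz.1.1.2 hcon.2⟩, h⟩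

theorem exists_extension_fst {a b c d m : ℝ} (hcd : c < d) (hm : m ∈ Ioo a b) {g : ℝ × ℝ → Y}
    (hg : ContinuousOn g (frame a b c d)) (hga : ∀ z ∈ frame a b c d, adm z (g z))
    (he : EdgeFill adm (m, c) (m, d) (g (m, c)) (g (m, d))) :
    ∃ g', EqOn g' g (frame a b c d) ∧ ContinuousOn g' (frame a b c d ∪ {m} ×ˢ Icc c d) ∧
      ∀ z ∈ frame a b c d ∪ {m} ×ˢ Icc c d, adm z (g' z) := by
  obtain ⟨e, he, e0, e1, ea⟩ := he
  have hcd' : 0 < d - c := sub_pos.mpr hcd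
  have hmaps : ∀ z ∈ ({m} ×ˢ Icc c d : Set (ℝ × ℝ)), (z.2 - c) / (d - c) ∈ Icc (0 : ℝ) 1 :=
    fun z hz => ⟨div_nonneg (by linarith [hz.2.1]) hcd'.le,
      (div_le_one hcd').mpr (by linarith [hz.2.2])⟩
  obtain ⟨g', h1, h2, h3⟩ := exists_glue (isClosed_frame a b c d)
    (isClosed_singleton.prod isClosed_Icc) hg
    (g := fun z => e ((z.2 - c) / (d - c))) (he.comp (by fun_prop) hmaps) fun z hz hz' => by
      have hzm : z.1 = m := hz'.1
      rcases frame_of_fst_mem hz (hzm ▸ hm) with h | h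
      · rw [h, sub_self, zero_div, e0, ← h, ← hzm]
      · rw [h, div_self hcd'.ne', e1, ← h, ← hzm]
  refine ⟨g', h1, h3, ?_⟩
  rintro z (hz | hz)
  · rw [h1 hz]; exact hga z hz
  · rw [h2 hz]
    convert ea _ (hmaps z hz) using 1
    have hzm : z.1 = m := hz.1
    have := hcd'.ne'
    ext <;> simp [AffineMap.lineMap_apply_module]
    · linarith
    · field_simp; ring

theorem exists_extension_snd {a b c d m : ℝ} (hab : a < b) (hm : m ∈ Ioo c d) {g : ℝ × ℝ → Y}
    (hg : ContinuousOn g (frame a b c d)) (hga : ∀ z ∈ frame a b c d, adm z (g z))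
    (he : EdgeFill adm (a, m) (b, m) (g (a, m)) (g (b, m))) :
    ∃ g', EqOn g' g (frame a b c d) ∧ ContinuousOn g' (frame a b c d ∪ Icc a b ×ˢ {m}) ∧
      ∀ z ∈ frame a b c d ∪ Icc a b ×ˢ {m}, adm z (g' z) := by
  obtain ⟨e, he, e0, e1, ea⟩ := he
  have hab' : 0 < b - a := sub_pos.mpr hab
  have hmaps : ∀ z ∈ (Icc a b ×ˢ {m} : Set (ℝ × ℝ)), (z.1 - a) / (b - a) ∈ Icc (0 : ℝ) 1 :=
    fun z hz => ⟨div_nonneg (by linarith [hz.1.1]) hab'.le,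
      (div_le_one hab').mpr (by linarith [hz.1.2])⟩
  obtain ⟨g', h1, h2, h3⟩ := exists_glue (isClosed_frame a b c d)
    (isClosed_Icc.prod isClosed_singleton) hg
    (g := fun z => e ((z.1 - a) / (b - a))) (he.comp (by fun_prop) hmaps) fun z hz hz' => by
      have hzm : z.2 = m := hz'.2
      rcases frame_of_snd_mem hz (hzm ▸ hm) with h | h
      · rw [h, sub_self, zero_div, e0, ← h, ← hzm]
      · rw [h, div_self hab'.ne', e1, ← h, ← hzm]
  refine ⟨g', h1, h3, ?_⟩
  rintro z (hz | hz)
  · rw [h1 hz]; exact hga z hz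
  · rw [h2 hz]
    convert ea _ (hmaps z hz) using 1
    have hzm : z.2 = m := hz.2
    have := hab'.ne'
    ext <;> simp [AffineMap.lineMap_apply_module]
    · field_simp; ring
    · linarith

/-- A bisection principle: boundary values on a rectangle can be filled in as soon as this is
possible for small rectangles, provided that admissible boundary values extend across edges. -/
theorem rect_induction {Fill : ℝ → ℝ → ℝ → ℝ → (ℝ × ℝ → Y) → Prop} {a b c d η : ℝ} (hη : 0 < η)
    (hedge : ∀ z ∈ Icc a b ×ˢ Icc c d, ∀ w ∈ Icc a b ×ˢ Icc c d, ∀ p q, adm z p → adm w q →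
      EdgeFill adm z w p q)
    (hcongr : ∀ a b c d f g, EqOn f g (frame a b c d) → Fill a b c d f → Fill a b c d g)
    (hsmall : ∀ a' b' c' d' g, a' < b' → c' < d' →
      Icc a' b' ×ˢ Icc c' d' ⊆ Icc a b ×ˢ Icc c d → b' - a' < η → d' - c' < η →
      ContinuousOn g (frame a' b' c' d') → (∀ z ∈ frame a' b' c' d', adm z (g z)) →
      Fill a' b' c' d' g)
    (hunion : ∀ {a b c d a₁ b₁ c₁ d₁ a₂ b₂ c₂ d₂ : ℝ} {g},
      IsSplit a b c d a₁ b₁ c₁ d₁ a₂ b₂ c₂ d₂ → Fill a₁ b₁ c₁ d₁ g → Fill a₂ b₂ c₂ d₂ g →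
      Fill a b c d g)
    (hab : a < b) (hcd : c < d) {g : ℝ × ℝ → Y} (hg : ContinuousOn g (frame a b c d))
    (hga : ∀ z ∈ frame a b c d, adm z (g z)) : Fill a b c d g := by
  have hX : ∀ a' m b' c' d', a' < m → m < b' → c' < d' →
      Icc a' b' ×ˢ Icc c' d' ⊆ Icc a b ×ˢ Icc c d →
      (∀ g, ContinuousOn g (frame a' m c' d') → (∀ z ∈ frame a' m c' d', adm z (g z)) →
        Fill a' m c' d' g) →
      (∀ g, ContinuousOn g (frame m b' c' d') → (∀ z ∈ frame m b' c' d', adm z (g z)) →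
        Fill m b' c' d' g) →
      ∀ g, ContinuousOn g (frame a' b' c' d') → (∀ z ∈ frame a' b' c' d', adm z (g z)) →
        Fill a' b' c' d' g := by
    intro a' m b' c' d' ham hmb hcd hQ h1 h2 g hg hga
    have hb : ((m, c') : ℝ × ℝ) ∈ frame a' b' c' d' :=
      ⟨⟨⟨ham.le, hmb.le⟩, le_rfl, hcd.le⟩, fun h => lt_irrefl _ h.2.1⟩
    have ht : ((m, d') : ℝ × ℝ) ∈ frame a' b' c' d' :=
      ⟨⟨⟨ham.le, hmb.le⟩, hcd.le, le_rfl⟩, fun h => lt_irrefl _ h.2.2⟩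
    obtain ⟨g', hgg, hg', hga'⟩ := exists_extension_fst hcd ⟨ham, hmb⟩ hg hga
      (hedge _ (hQ hb.1) _ (hQ ht.1) _ _ (hga _ hb) (hga _ ht))
    have hl := frame_left_subset (c := c') (d := d') ⟨ham, hmb⟩
    have hr := frame_right_subset (c := c') (d := d') ⟨ham, hmb⟩
    exact hcongr _ _ _ _ _ _ hgg (hunion (isSplit_fst ham hmb _ _)
      (h1 g' (hg'.mono hl) fun z hz => hga' z (hl hz))
      (h2 g' (hg'.mono hr) fun z hz => hga' z (hr hz)))
  have hY : ∀ a' b' c' m d', a' < b' → c' < m → m < d' →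
      Icc a' b' ×ˢ Icc c' d' ⊆ Icc a b ×ˢ Icc c d →
      (∀ g, ContinuousOn g (frame a' b' c' m) → (∀ z ∈ frame a' b' c' m, adm z (g z)) →
        Fill a' b' c' m g) →
      (∀ g, ContinuousOn g (frame a' b' m d') → (∀ z ∈ frame a' b' m d', adm z (g z)) →
        Fill a' b' m d' g) →
      ∀ g, ContinuousOn g (frame a' b' c' d') → (∀ z ∈ frame a' b' c' d', adm z (g z)) →
        Fill a' b' c' d' g := by
    intro a' b' c' m d' hab hcm hmd hQ h1 h2 g hg hga
    have hb : ((a', m) : ℝ × ℝ) ∈ frame a' b' c' d' :=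
      ⟨⟨⟨le_rfl, hab.le⟩, hcm.le, hmd.le⟩, fun h => lt_irrefl _ h.1.1⟩
    have ht : ((b', m) : ℝ × ℝ) ∈ frame a' b' c' d' :=
      ⟨⟨⟨hab.le, le_rfl⟩, hcm.le, hmd.le⟩, fun h => lt_irrefl _ h.1.2⟩
    obtain ⟨g', hgg, hg', hga'⟩ := exists_extension_snd hab ⟨hcm, hmd⟩ hg hga
      (hedge _ (hQ hb.1) _ (hQ ht.1) _ _ (hga _ hb) (hga _ ht))
    have hl := frame_bot_subset (a := a') (b := b') ⟨hcm, hmd⟩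
    have hr := frame_top_subset (a := a') (b := b') ⟨hcm, hmd⟩
    exact hcongr _ _ _ _ _ _ hgg (hunion (isSplit_snd hcm hmd _ _)
      (h1 g' (hg'.mono hl) fun z hz => hga' z (hl hz))
      (h2 g' (hg'.mono hr) fun z hz => hga' z (hr hz)))
  have H : ∀ n : ℕ, ∀ a' b' c' d', a' < b' → c' < d' →
      Icc a' b' ×ˢ Icc c' d' ⊆ Icc a b ×ˢ Icc c d → b' - a' < 2 ^ n * η → d' - c' < 2 ^ n * η →
      ∀ g, ContinuousOn g (frame a' b' c' d') → (∀ z ∈ frame a' b' c' d', adm z (g z)) →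
        Fill a' b' c' d' g := by
    intro n
    induction n with
    | zero =>
      intro a' b' c' d' hab hcd hQ h1 h2 g hg hga
      exact hsmall a' b' c' d' g hab hcd hQ (by simpa using h1) (by simpa using h2) hg hga
    | succ n ih =>
      intro a' b' c' d' hab hcd hQ h1 h2
      rw [pow_succ] at h1 h2
      obtain ⟨m, hm⟩ : ∃ m, m = (a' + b') / 2 := ⟨_, rfl⟩
      obtain ⟨k, hk⟩ : ∃ k, k = (c' + d') / 2 := ⟨_, rfl⟩
      have ham : a' < m := by linarith
      have hmb : m < b' := by linarith
      have hck : c' < k := by linarith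
      have hkd : k < d' := by linarith
      have hQ₁ : Icc a' m ×ˢ Icc c' d' ⊆ Icc a b ×ˢ Icc c d :=
        (prod_mono (Icc_subset_Icc le_rfl hmb.le) le_rfl).trans hQ
      have hQ₂ : Icc m b' ×ˢ Icc c' d' ⊆ Icc a b ×ˢ Icc c d :=
        (prod_mono (Icc_subset_Icc ham.le le_rfl) le_rfl).trans hQ
      have hk₁ : Icc c' k ⊆ Icc c' d' := Icc_subset_Icc le_rfl hkd.le
      have hk₂ : Icc k d' ⊆ Icc c' d' := Icc_subset_Icc hck.le le_rfl
      refine hX a' m b' c' d' ham hmb hcd hQ (hY _ _ _ k _ ham hck hkd hQ₁ ?_ ?_)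
        (hY _ _ _ k _ hmb hck hkd hQ₂ ?_ ?_)
      · exact ih _ _ _ _ ham hck ((prod_mono le_rfl hk₁).trans hQ₁) (by linarith) (by linarith)
      · exact ih _ _ _ _ ham hkd ((prod_mono le_rfl hk₂).trans hQ₁) (by linarith) (by linarith)
      · exact ih _ _ _ _ hmb hck ((prod_mono le_rfl hk₁).trans hQ₂) (by linarith) (by linarith)
      · exact ih _ _ _ _ hmb hkd ((prod_mono le_rfl hk₂).trans hQ₂) (by linarith) (by linarith)
  obtain ⟨n, hn⟩ := pow_unbounded_of_one_lt (max (b - a) (d - c) / η) one_lt_two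
  rw [div_lt_iff₀ hη, max_lt_iff] at hn
  exact H n a b c d hab hcd le_rfl hn.1 hn.2 g hg hga

end

section

theorem exists_glue_inter {X Y : Type*} [TopologicalSpace X] [TopologicalSpace Y] {A B S : Set X}
    (hA : IsClosed A) (hB : IsClosed B) {f g : X → Y} (hf : ContinuousOn f (A ∩ S))
    (hg : ContinuousOn g (B ∩ S)) (hfg : ∀ x ∈ A, x ∈ B → f x = g x) :
    ∃ h : X → Y, EqOn h f A ∧ EqOn h g B ∧ ContinuousOn h ((A ∪ B) ∩ S) := by
  classical
  have h1 : EqOn (A.piecewise f g) f A := piecewise_eqOn A f g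
  have h2 : EqOn (A.piecewise f g) g B := fun x hx => by
    by_cases hxA : x ∈ A
    · rw [h1 hxA, hfg x hxA hx]
    · exact piecewise_eq_of_notMem A f g hxA
  refine ⟨A.piecewise f g, h1, h2, ?_⟩
  rw [union_inter_distrib_right]
  have hf' := hf.congr (h1.mono inter_subset_left)
  have hg' := hg.congr (h2.mono inter_subset_left)
  intro x hx
  have hxS : x ∈ S := hx.elim And.right And.right
  refine ContinuousWithinAt.union ?_ ?_
  · by_cases hxA : x ∈ A
    · exact hf' x ⟨hxA, hxS⟩
    · exact continuousWithinAt_of_notMem_closure fun hcl =>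
        hxA (closure_minimal inter_subset_left hA hcl)
  · by_cases hxB : x ∈ B
    · exact hg' x ⟨hxB, hxS⟩
    · exact continuousWithinAt_of_notMem_closure fun hcl =>
        hxB (closure_minimal inter_subset_left hB hcl)

theorem exists_clamp {a b c d : ℝ} (hab : a ≤ b) (hcd : c ≤ d) :
    ∃ κ : ℝ × ℝ → ℝ × ℝ, Continuous κ ∧ (∀ z, κ z ∈ Icc a b ×ˢ Icc c d) ∧
      (∀ z ∈ Icc a b ×ˢ Icc c d, κ z = z) ∧ ∀ z, κ z ∈ Ioo a b ×ˢ Ioo c d → κ z = z := by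
  have key : ∀ {a b x : ℝ}, max a (min b x) ∈ Ioo a b → max a (min b x) = x := by
    intro a b x h
    have h1 : a < min b x := by
      by_contra! hcon
      exact absurd h.1 (by rw [max_eq_left hcon]; exact lt_irrefl a)
    rw [max_eq_right h1.le] at h ⊢
    have h2 : x < b := by
      by_contra! hcon
      exact absurd h.2 (by rw [min_eq_left hcon]; exact lt_irrefl b)
    exact min_eq_right h2.le
  refine ⟨fun z => (max a (min b z.1), max c (min d z.2)), by fun_prop, fun z => ?_, fun z hz => ?_,
    fun z hz => Prod.ext (key hz.1) (key hz.2)⟩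
  · exact ⟨⟨le_max_left _ _, max_le hab (min_le_left _ _)⟩,
      ⟨le_max_left _ _, max_le hcd (min_le_left _ _)⟩⟩
  · ext
    · simp [hz.1.1, hz.1.2]
    · simp [hz.2.1, hz.2.2]

/-- The Tietze extension theorem with values in a rectangle. -/
theorem exists_extension_rect {X : Type*} [TopologicalSpace X] [NormalSpace X] {A : Set X}
    (hA : IsClosed A) {a b c d : ℝ} (hab : a ≤ b) (hcd : c ≤ d) {f : X → ℝ × ℝ}
    (hf : ContinuousOn f A) (hm : MapsTo f A (Icc a b ×ˢ Icc c d)) :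
    ∃ F : X → ℝ × ℝ, Continuous F ∧ EqOn F f A ∧ ∀ x, F x ∈ Icc a b ×ˢ Icc c d := by
  obtain ⟨κ, hκ, h1, h2, -⟩ := exists_clamp hab hcd
  obtain ⟨F, hF⟩ := ContinuousMap.exists_restrict_eq hA ⟨A.domRestrict f, hf.domRestrict⟩
  refine ⟨κ ∘ F, hκ.comp F.continuous, fun x hx => ?_, fun x => h1 _⟩
  have : F x = f x := congrArg (fun φ : C(A, ℝ × ℝ) => φ ⟨x, hx⟩) hF
  rw [Function.comp_apply, this, h2 _ (hm hx)]

/-- A punctured rectangle retracts onto its boundary. -/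
theorem exists_radial {a b c d : ℝ} (hab : a < b) (hcd : c < d) :
    ∃ z₀ ∈ Ioo a b ×ˢ Ioo c d, ∃ ρ : ℝ × ℝ → ℝ × ℝ,
      ContinuousOn ρ {z₀}ᶜ ∧ MapsTo ρ {z₀}ᶜ (frame a b c d) ∧
      ∀ z ∈ frame a b c d, ρ z = z := by
  obtain ⟨x, hx⟩ : ∃ x, x = (a + b) / 2 := ⟨_, rfl⟩
  obtain ⟨y, hy⟩ : ∃ y, y = (c + d) / 2 := ⟨_, rfl⟩
  obtain ⟨A, hA⟩ : ∃ A, A = (b - a) / 2 := ⟨_, rfl⟩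
  obtain ⟨B, hB⟩ : ∃ B, B = (d - c) / 2 := ⟨_, rfl⟩
  have hA0 : 0 < A := by linarith
  have hB0 : 0 < B := by linarith
  obtain ⟨lam, hlam⟩ : ∃ lam : ℝ × ℝ → ℝ,
    lam = fun z => max (|z.1 - x| / A) (|z.2 - y| / B) := ⟨_, rfl⟩
  have hcont : Continuous lam := by rw [hlam]; fun_prop
  have hframe : ∀ z : ℝ × ℝ, z ∈ frame a b c d ↔ lam z = 1 := by
    intro z
    have e1 : z ∈ Icc a b ×ˢ Icc c d ↔ lam z ≤ 1 := by
      simp only [hlam, max_le_iff, div_le_one hA0, div_le_one hB0, abs_le, mem_prod, mem_Icc]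
      constructor
      · rintro ⟨⟨_, _⟩, _, _⟩; refine ⟨⟨?_, ?_⟩, ?_, ?_⟩ <;> linarith
      · rintro ⟨⟨_, _⟩, _, _⟩; refine ⟨⟨?_, ?_⟩, ?_, ?_⟩ <;> linarith
    have e2 : z ∈ Ioo a b ×ˢ Ioo c d ↔ lam z < 1 := by
      simp only [hlam, max_lt_iff, div_lt_one hA0, div_lt_one hB0, abs_lt, mem_prod, mem_Ioo]
      constructor
      · rintro ⟨⟨_, _⟩, _, _⟩; refine ⟨⟨?_, ?_⟩, ?_, ?_⟩ <;> linarith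
      · rintro ⟨⟨_, _⟩, _, _⟩; refine ⟨⟨?_, ?_⟩, ?_, ?_⟩ <;> linarith
    rw [frame, Set.mem_sdiff, e1, e2, not_lt]
    exact ⟨fun h => le_antisymm h.1 h.2, fun h => ⟨h.le, h.ge⟩⟩
  have hpos : ∀ z : ℝ × ℝ, z ≠ (x, y) → 0 < lam z := by
    intro z hz
    by_contra! hcon
    rw [hlam] at hcon
    have h1 := (le_max_left _ _).trans hcon
    have h2 := (le_max_right _ _).trans hcon
    rw [div_le_iff₀ hA0, zero_mul, abs_nonpos_iff, sub_eq_zero] at h1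
    rw [div_le_iff₀ hB0, zero_mul, abs_nonpos_iff, sub_eq_zero] at h2
    exact hz (Prod.ext h1 h2)
  refine ⟨(x, y), ⟨⟨by simp only; linarith, by simp only; linarith⟩,
    ⟨by simp only; linarith, by simp only; linarith⟩⟩,
    fun z => (x + (z.1 - x) / lam z, y + (z.2 - y) / lam z), ?_, ?_, ?_⟩
  · have : ∀ z ∈ ({(x, y)}ᶜ : Set (ℝ × ℝ)), lam z ≠ 0 := fun z hz => (hpos z hz).ne'
    fun_prop (disch := assumption)
  · intro z hz
    have h0 := hpos z hz
    rw [hframe]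
    have : ∀ s C : ℝ, |x + s / lam z - x| / C = |s| / C / lam z := fun s C => by
      rw [add_sub_cancel_left, abs_div, abs_of_pos h0, div_right_comm]
    have h' : ∀ s C : ℝ, |y + s / lam z - y| / C = |s| / C / lam z := fun s C => by
      rw [add_sub_cancel_left, abs_div, abs_of_pos h0, div_right_comm]
    have e : ∀ w, lam w = max (|w.1 - x| / A) (|w.2 - y| / B) := fun w => by rw [hlam]
    rw [e]
    simp only [this, h']
    rw [max_div_div_right h0.le, div_eq_one_iff_eq h0.ne', ← e]
  · intro z hz
    rw [hframe] at hz
    simp [hz]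

theorem joinedIn_thickening {K : Set (ℝ × ℝ)} (hK : IsPathConnected K) {δ : ℝ} {p q : ℝ × ℝ}
    (hp : p ∈ thickening δ K) (hq : q ∈ thickening δ K) : JoinedIn (thickening δ K) p q := by
  have H : ∀ p ∈ thickening δ K, ∃ k ∈ K, JoinedIn (thickening δ K) p k := by
    intro p hp
    obtain ⟨k, hk, hpk⟩ := mem_thickening_iff.mp hp
    have hδ : 0 < δ := dist_nonneg.trans_lt hpk
    exact ⟨k, hk, (((convex_ball k δ).isPathConnected ⟨k, mem_ball_self hδ⟩).joinedIn p hpk k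
      (mem_ball_self hδ)).mono (ball_subset_thickening hk δ)⟩
  obtain ⟨k, hk, h1⟩ := H p hp
  obtain ⟨l, hl, h2⟩ := H q hq
  exact (h1.trans ((hK.joinedIn k hk l hl).mono
    (self_subset_thickening (h1.source_mem |> fun h => by
      obtain ⟨k, hk, hpk⟩ := mem_thickening_iff.mp h
      exact dist_nonneg.trans_lt hpk) K))).trans h2.symm

/-- The values of a map to a neighbourhood of `K` which is the identity near `K`. -/
def NearId (K : Set (ℝ × ℝ)) (δ : ℝ) (z w : ℝ × ℝ) : Prop :=
  w ∈ thickening δ K ∧ (infDist z K ≤ δ / 2 → w = z)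

theorem edgeFill_nearId_of_segment {K : Set (ℝ × ℝ)} (hK : IsPathConnected K) {δ : ℝ}
    {z w p : ℝ × ℝ}
    (hzw : ∀ s ∈ Icc (0 : ℝ) 1, AffineMap.lineMap z w s ∈ thickening δ K)
    (hp : NearId K δ z p) : EdgeFill (NearId K δ) z w p w := by
  have hline : ∀ z w : ℝ × ℝ, (∀ s ∈ Icc (0 : ℝ) 1, AffineMap.lineMap z w s ∈ thickening δ K) →
      EdgeFill (NearId K δ) z w z w := fun z w h =>
    ⟨AffineMap.lineMap z w, AffineMap.lineMap_continuous.continuousOn, by simp, by simp,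
      fun s hs => ⟨h s hs, fun _ => rfl⟩⟩
  by_cases hz : infDist z K ≤ δ / 2
  · rw [hp.2 hz]
    exact hline z w hzw
  · rw [not_le] at hz
    have hc : Continuous fun s : ℝ => infDist (AffineMap.lineMap z w s) K :=
      (continuous_infDist_pt K).comp AffineMap.lineMap_continuous
    have ho : IsOpen {s : ℝ | δ / 2 < infDist (AffineMap.lineMap z w s) K} :=
      isOpen_lt continuous_const hc
    obtain ⟨ε, hε, hεs⟩ := Metric.isOpen_iff.mp ho 0 (by simpa using hz)
    have hs₀ : min (ε / 2) (1 / 2) ∈ Ioo (0 : ℝ) 1 :=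
      ⟨by positivity, (min_le_right _ _).trans_lt (by norm_num)⟩
    have hle : min (ε / 2) (1 / 2) < ε := (min_le_left _ _).trans_lt (by linarith)
    generalize min (ε / 2) (1 / 2) = s₀ at hs₀ hle
    refine EdgeFill.trans hs₀ (EdgeFill.of_joinedIn
      (joinedIn_thickening hK hp.1 (hzw s₀ (Ioo_subset_Icc_self hs₀))) fun s hs y hy =>
        ⟨hy, fun hcon => absurd hcon (not_le.mpr ?_)⟩) (hline _ _ fun s hs => ?_)
    · have e : AffineMap.lineMap z (AffineMap.lineMap z w s₀) s =
          AffineMap.lineMap z w (s * s₀) := by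
        simp only [AffineMap.lineMap_apply_module]
        ext <;> simp <;> ring
      rw [e]
      refine hεs ?_
      rw [mem_ball, Real.dist_eq, sub_zero, abs_of_nonneg (mul_nonneg hs.1 hs₀.1.le)]
      nlinarith [hs.1, hs.2, hs₀.1]
    · have e : AffineMap.lineMap (AffineMap.lineMap z w s₀) w s =
          AffineMap.lineMap z w (1 - (1 - s) * (1 - s₀)) := by
        simp only [AffineMap.lineMap_apply_module]
        ext <;> simp <;> ring
      rw [e]
      have h1 : 0 ≤ (1 - s) * (1 - s₀) :=
        mul_nonneg (by linarith [hs.2]) (by linarith [hs₀.2])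
      have h2 : (1 - s) * (1 - s₀) ≤ 1 :=
        mul_le_one₀ (by linarith [hs.1]) (by linarith [hs₀.2]) (by linarith [hs₀.1])
      exact hzw _ ⟨by linarith, by linarith⟩

theorem mem_thickening_of_infDist_lt {K : Set (ℝ × ℝ)} (hK : K.Nonempty) {δ : ℝ} {z : ℝ × ℝ}
    (h : infDist z K < δ) : z ∈ thickening δ K :=
  mem_thickening_iff.mpr ((infDist_lt_iff hK).mp h)

theorem edgeFill_nearId {K : Set (ℝ × ℝ)} (hK : IsPathConnected K) {δ : ℝ} (hδ : 0 < δ)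
    {z w p q : ℝ × ℝ} (hp : NearId K δ z p) (hq : NearId K δ w q) :
    EdgeFill (NearId K δ) z w p q := by
  refine EdgeFill.of_small (Q := univ) convex_univ (fun z _ => ?_) (half_pos hδ) ?_ trivial trivial
    hp hq
  · by_cases hz : infDist z K ≤ δ / 2
    · exact ⟨z, mem_thickening_of_infDist_lt hK.nonempty (by linarith), fun _ => rfl⟩
    · exact ⟨p, hp.1, fun h => absurd h hz⟩
  · intro z _ w _ hzw p q hp hq
    by_cases h : ∃ s ∈ Icc (0 : ℝ) 1, infDist (AffineMap.lineMap z w s) K ≤ δ / 2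
    · obtain ⟨s, hs, hsK⟩ := h
      have hN : ∀ s' ∈ Icc (0 : ℝ) 1, AffineMap.lineMap z w s' ∈ thickening δ K := by
        intro s' hs'
        refine mem_thickening_of_infDist_lt hK.nonempty ?_
        have h1 := infDist_le_infDist_add_dist (s := K) (x := AffineMap.lineMap z w s')
          (y := AffineMap.lineMap z w s)
        have h2 : dist (AffineMap.lineMap z w s') (AffineMap.lineMap z w s) ≤ dist z w := by
          rw [dist_lineMap_lineMap]
          have : dist s' s ≤ 1 := by
            rw [Real.dist_eq, abs_le]
            constructor <;> linarith [hs.1, hs.2, hs'.1, hs'.2]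
          exact mul_le_of_le_one_left dist_nonneg this
        linarith
      refine EdgeFill.of_midpoint (edgeFill_nearId_of_segment hK (fun s hs => ?_) hp)
        (edgeFill_nearId_of_segment hK (fun s hs => ?_) hq)
      · have e : AffineMap.lineMap z (midpoint ℝ z w) s = AffineMap.lineMap z w (s / 2) := by
          simp only [midpoint, AffineMap.lineMap_apply_module]
          ext <;> simp <;> ring
        rw [e]
        exact hN _ ⟨by linarith [hs.1], by linarith [hs.2]⟩
      · have e : AffineMap.lineMap w (midpoint ℝ z w) s = AffineMap.lineMap z w (1 - s / 2) := by
          simp only [midpoint, AffineMap.lineMap_apply_module]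
          ext <;> simp <;> ring
        rw [e]
        exact hN _ ⟨by linarith [hs.2], by linarith [hs.1]⟩
    · push Not at h
      exact EdgeFill.of_joinedIn (joinedIn_thickening hK hp.1 hq.1) fun s hs y hy =>
        ⟨hy, fun hcon => absurd hcon (not_le.mpr (h s hs))⟩

/-- Boundary values extend over a rectangle, finitely many points removed, to a map into the
`δ`-neighbourhood of `K` which is the identity on `K`. -/
def PuncturedFill (K : Set (ℝ × ℝ)) (δ a b c d : ℝ) (g : ℝ × ℝ → ℝ × ℝ) : Prop :=
  ∃ P : Set (ℝ × ℝ), P.Finite ∧ Disjoint P K ∧ P ⊆ Ioo a b ×ˢ Ioo c d ∧ ∃ Φ : ℝ × ℝ → ℝ × ℝ,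
    ContinuousOn Φ ((Icc a b ×ˢ Icc c d) \ P) ∧ EqOn Φ g (frame a b c d) ∧
    (∀ z ∈ Icc a b ×ˢ Icc c d, z ∈ K → Φ z = z) ∧
    MapsTo Φ ((Icc a b ×ˢ Icc c d) \ P) (thickening δ K)

theorem PuncturedFill.union {K : Set (ℝ × ℝ)} {δ a b c d a₁ b₁ c₁ d₁ a₂ b₂ c₂ d₂ : ℝ}
    {g : ℝ × ℝ → ℝ × ℝ} (h₁ : PuncturedFill K δ a₁ b₁ c₁ d₁ g)
    (h₂ : PuncturedFill K δ a₂ b₂ c₂ d₂ g)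
    (h : IsSplit a b c d a₁ b₁ c₁ d₁ a₂ b₂ c₂ d₂) :
    PuncturedFill K δ a b c d g := by
  obtain ⟨P, hP, hPK, hPI, Φ, hΦ, hΦg, hΦK, hΦN⟩ := h₁
  obtain ⟨P', hP', hPK', hPI', Φ', hΦ', hΦg', hΦK', hΦN'⟩ := h₂
  obtain ⟨Ψ, h1, h2, h3⟩ := exists_glue_inter (S := (P ∪ P')ᶜ)
    ((isClosed_Icc (a := a₁) (b := b₁)).prod (isClosed_Icc (a := c₁) (b := d₁)))
    ((isClosed_Icc (a := a₂) (b := b₂)).prod (isClosed_Icc (a := c₂) (b := d₂)))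
    (hΦ.mono fun z hz => ⟨hz.1, fun h => hz.2 (Or.inl h)⟩)
    (hΦ'.mono fun z hz => ⟨hz.1, fun h => hz.2 (Or.inr h)⟩) fun z hz hz' => by
      rw [hΦg (h.mem_frame_left hz hz'), hΦg' (h.mem_frame_right hz hz')]
  rw [← h.rect_eq] at h3
  refine ⟨P ∪ P', hP.union hP', disjoint_union_left.mpr ⟨hPK, hPK'⟩,
    union_subset (hPI.trans h.interior_left) (hPI'.trans h.interior_right), Ψ, h3, ?_, ?_, ?_⟩
  · intro z hz
    rcases h.mem_frame hz with h | h
    · rw [h1 h.1, hΦg h]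
    · rw [h2 h.1, hΦg' h]
  · intro z hz hzK
    rw [h.rect_eq] at hz
    rcases hz with h | h
    · rw [h1 h, hΦK z h hzK]
    · rw [h2 h, hΦK' z h hzK]
  · intro z hz
    have hzR := hz.1
    rw [h.rect_eq] at hzR
    rcases hzR with h | h
    · rw [h1 h]; exact hΦN ⟨h, fun hI => hz.2 (Or.inl hI)⟩
    · rw [h2 h]; exact hΦN' ⟨h, fun hI => hz.2 (Or.inr hI)⟩

theorem PuncturedFill.of_small {K : Set (ℝ × ℝ)} {δ a b c d : ℝ}
    {g : ℝ × ℝ → ℝ × ℝ}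
    (hab : a < b) (hcd : c < d) (hb : b - a < δ / 2) (hd : d - c < δ / 2)
    (hg : ContinuousOn g (frame a b c d)) (hga : ∀ z ∈ frame a b c d, NearId K δ z (g z)) :
    PuncturedFill K δ a b c d g := by
  by_cases h : ∃ k ∈ K, k ∈ Icc a b ×ˢ Icc c d
  · obtain ⟨k, hkK, hk⟩ := h
    have hdist : ∀ z ∈ Icc a b ×ˢ Icc c d, dist z k < δ / 2 := by
      intro z hz
      rw [Prod.dist_eq, max_lt_iff, Real.dist_eq, Real.dist_eq, abs_lt, abs_lt]
      exact ⟨⟨by linarith [hz.1.1, hk.1.2], by linarith [hz.1.2, hk.1.1]⟩,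
        ⟨by linarith [hz.2.1, hk.2.2], by linarith [hz.2.2, hk.2.1]⟩⟩
    refine ⟨∅, finite_empty, empty_disjoint _, empty_subset _, id, continuousOn_id,
      fun z hz => ((hga z hz).2 ?_).symm, fun _ _ _ => rfl, fun z hz => ?_⟩
    · exact (infDist_le_dist_of_mem hkK).trans (hdist z hz.1).le
    · exact mem_thickening_iff.mpr ⟨k, hkK, (hdist z hz.1).trans (by linarith)⟩
  · push Not at h
    obtain ⟨z₀, hz₀, ρ, hρ, hρm, hρf⟩ := exists_radial hab hcd
    have hsub : (Icc a b ×ˢ Icc c d) \ {z₀} ⊆ {z₀}ᶜ := fun z hz => hz.2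
    refine ⟨{z₀}, finite_singleton _, ?_, singleton_subset_iff.mpr hz₀, g ∘ ρ,
      (hg.comp hρ hρm).mono hsub, fun z hz => ?_, fun z hz hzK => absurd hz (h z hzK),
      fun z hz => (hga _ (hρm (hsub hz))).1⟩
    · rw [disjoint_singleton_left]
      exact fun hK => h z₀ hK (prod_mono Ioo_subset_Icc_self Ioo_subset_Icc_self hz₀)
    · rw [Function.comp_apply, hρf z hz]

theorem puncturedFill_of_nearId {K : Set (ℝ × ℝ)} (hK : IsPathConnected K) {δ a b c d : ℝ}
    (hδ : 0 < δ) {g : ℝ × ℝ → ℝ × ℝ} (hab : a < b) (hcd : c < d)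
    (hg : ContinuousOn g (frame a b c d)) (hga : ∀ z ∈ frame a b c d, NearId K δ z (g z)) :
    PuncturedFill K δ a b c d g := by
  refine rect_induction (adm := NearId K δ) (half_pos hδ)
    (fun z _ w _ p q hp hq => edgeFill_nearId hK hδ hp hq) ?_ ?_ ?_ hab hcd hg hga
  · rintro a b c d f g hfg ⟨P, hP, hPK, hPI, Φ, hΦ, hΦg, h⟩
    exact ⟨P, hP, hPK, hPI, Φ, hΦ, hΦg.trans hfg, h⟩
  · intro a' b' c' d' g hab hcd _ hb hd hg hga
    exact PuncturedFill.of_small hab hcd hb hd hg hga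
  · exact fun h h₁ h₂ => h₁.union h₂ h

theorem exists_punctured_push {K : Set (ℝ × ℝ)} (hK : IsPathConnected K) {a b c d δ : ℝ}
    (hKQ : K ⊆ Icc a b ×ˢ Icc c d) (hδ : 0 < δ) :
    ∃ P : Set (ℝ × ℝ), P.Finite ∧ Disjoint P K ∧ P ⊆ Ioo (a - 1) (b + 1) ×ˢ Ioo (c - 1) (d + 1) ∧
      ∃ Φ : ℝ × ℝ → ℝ × ℝ,
        ContinuousOn Φ ((Icc (a - 1) (b + 1) ×ˢ Icc (c - 1) (d + 1)) \ P) ∧ (∀ z ∈ K, Φ z = z) ∧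
        MapsTo Φ ((Icc (a - 1) (b + 1) ×ˢ Icc (c - 1) (d + 1)) \ P) (thickening δ K) := by
  obtain ⟨k, hk⟩ := hK.nonempty
  have hkQ := hKQ hk
  have hab : a ≤ b := hkQ.1.1.trans hkQ.1.2
  have hcd : c ≤ d := hkQ.2.1.trans hkQ.2.2
  have hδ' : 0 < min δ 1 := lt_min hδ one_pos
  obtain ⟨P, h1, h2, h3, Φ, h4, -, h5, h6⟩ := puncturedFill_of_nearId hK hδ' (a := a - 1)
    (b := b + 1) (c := c - 1) (d := d + 1) (g := fun _ => k) (by linarith) (by linarith)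
    continuousOn_const fun z hz => ⟨self_subset_thickening hδ' K hk, fun hcon => by
      exfalso
      have h1 : infDist z K < 1 := by
        have := min_le_right δ 1
        linarith
      obtain ⟨l, hl, hzl⟩ := (infDist_lt_iff ⟨k, hk⟩).mp h1
      have hlQ := hKQ hl
      rw [Prod.dist_eq, max_lt_iff, Real.dist_eq, Real.dist_eq, abs_lt, abs_lt] at hzl
      exact hz.2 ⟨⟨by linarith [hzl.1.1, hlQ.1.1], by linarith [hzl.1.2, hlQ.1.2]⟩,
        ⟨by linarith [hzl.2.1, hlQ.2.1], by linarith [hzl.2.2, hlQ.2.2]⟩⟩⟩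
  refine ⟨P, h1, h2, h3, Φ, h4, fun z hz => h5 z ?_ hz, h6.mono_right
    (thickening_mono (min_le_left _ _) K)⟩
  have := hKQ hz
  exact ⟨⟨by linarith [this.1.1], by linarith [this.1.2]⟩,
    ⟨by linarith [this.2.1], by linarith [this.2.2]⟩⟩

/-- A map from a closed set to a component of the sublevel set extends to a map of the plane into
any neighbourhood of the component. -/
theorem IsAdmissible.exists_extension_thickening {u : ℝ × ℝ → ℝ} {t a b c d : ℝ}
    (hu : IsAdmissible u a b c d) (hab : a < b) (hcd : c < d) {x : ℝ × ℝ}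
    (hx : x ∈ sublevel u t a b c d) {A : Set (ℝ × ℝ)} (hA : IsClosed A) {γ : ℝ × ℝ → ℝ × ℝ}
    (hγ : ContinuousOn γ A) (hγK : MapsTo γ A (connectedComponentIn (sublevel u t a b c d) x))
    {δ : ℝ} (hδ : 0 < δ) :
    ∃ F : ℝ × ℝ → ℝ × ℝ, Continuous F ∧ EqOn F γ A ∧
      ∀ z, F z ∈ thickening δ (connectedComponentIn (sublevel u t a b c d) x) := by
  have hKS : connectedComponentIn (sublevel u t a b c d) x ⊆ sublevel u t a b c d :=
    connectedComponentIn_subset _ _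
  have hKQ : connectedComponentIn (sublevel u t a b c d) x ⊆ Icc a b ×ˢ Icc c d :=
    fun z hz => (hKS hz).1
  have hKp : IsPathConnected (connectedComponentIn (sublevel u t a b c d) x) :=
    ⟨x, mem_connectedComponentIn hx, fun _ hy => hu.joinedIn_component hab hcd hy⟩
  obtain ⟨P, hP, hPK, hPI, Φ, hΦ, hΦK, hΦN⟩ := exists_punctured_push hKp hKQ hδ
  obtain ⟨h, hhK, hhP⟩ := hu.exists_homeomorph hx hP hPK
  obtain ⟨F, hF, hFγ, hFQ⟩ := exists_extension_rect hA hab.le hcd.le hγ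
    (hγK.mono_right hKQ)
  obtain ⟨κ, hκ, hκ1, hκ2, hκ3⟩ := exists_clamp (a := a - 1) (b := b + 1) (c := c - 1) (d := d + 1)
    (by linarith) (by linarith)
  have hmaps : ∀ z, κ (h.symm (F z)) ∈ (Icc (a - 1) (b + 1) ×ˢ Icc (c - 1) (d + 1)) \ P := by
    refine fun z => ⟨hκ1 _, fun hcon => ?_⟩
    have e := hκ3 _ (hPI hcon)
    rw [e] at hcon
    refine hhP _ hcon ?_
    rw [h.apply_symm_apply]
    exact hFQ z
  refine ⟨fun z => Φ (κ (h.symm (F z))), ?_, fun z hz => ?_, fun z => hΦN (hmaps z)⟩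
  · exact hΦ.comp_continuous (hκ.comp (h.symm.continuous.comp hF)) hmaps
  · have hz' := hγK hz
    have e1 : h.symm (γ z) = γ z := by rw [h.symm_apply_eq, hhK _ hz']
    have := hKQ hz'
    simp only [hFγ hz, e1]
    rw [hκ2 _ ⟨⟨by linarith [this.1.1], by linarith [this.1.2]⟩,
      ⟨by linarith [this.2.1], by linarith [this.2.2]⟩⟩, hΦK _ hz']

end

section

theorem mem_frame_iff {a b c d : ℝ} {z : ℝ × ℝ} : z ∈ frame a b c d ↔
    z ∈ Icc a b ×ˢ Icc c d ∧ (z.1 = a ∨ z.1 = b ∨ z.2 = c ∨ z.2 = d) := by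
  refine and_congr_right fun hz => ⟨fun h => ?_, ?_⟩
  · by_contra! hcon
    exact h ⟨⟨lt_of_le_of_ne hz.1.1 (Ne.symm hcon.1), lt_of_le_of_ne hz.1.2 hcon.2.1⟩,
      lt_of_le_of_ne hz.2.1 (Ne.symm hcon.2.2.1), lt_of_le_of_ne hz.2.2 hcon.2.2.2⟩
  · rintro (h | h | h | h) hI
    · exact hI.1.1.ne' h
    · exact hI.1.2.ne h
    · exact hI.2.1.ne' h
    · exact hI.2.2.ne h

theorem corner_mem_frame {a b c d : ℝ} (hab : a ≤ b) (hcd : c ≤ d) : (a, c) ∈ frame a b c d :=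
  mem_frame_iff.mpr ⟨⟨⟨le_rfl, hab⟩, le_rfl, hcd⟩, Or.inl rfl⟩

theorem isPreconnected_frame {a b c d : ℝ} (hab : a ≤ b) (hcd : c ≤ d) :
    IsPreconnected (frame a b c d) := by
  have e : frame a b c d = (Icc a b ×ˢ {c} ∪ {b} ×ˢ Icc c d) ∪
      ({a} ×ˢ Icc c d ∪ Icc a b ×ˢ {d}) := by
    ext z
    rw [mem_frame_iff]
    simp only [mem_union, mem_prod, mem_singleton_iff, mem_Icc]
    constructor
    · tauto
    · rintro ((⟨h1, h2⟩ | ⟨h1, h2⟩) | (⟨h1, h2⟩ | ⟨h1, h2⟩)) <;> simp_all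
  rw [e]
  refine IsPreconnected.union (a, c) ?_ ?_
    (IsPreconnected.union (b, c) ?_ ?_ (isPreconnected_Icc.prod isPreconnected_singleton)
      (isPreconnected_singleton.prod isPreconnected_Icc))
    (IsPreconnected.union (a, d) ?_ ?_ (isPreconnected_singleton.prod isPreconnected_Icc)
      (isPreconnected_Icc.prod isPreconnected_singleton)) <;>
  simp [hab, hcd]

variable {u : ℝ × ℝ → ℝ} {t a b c d ε : ℝ}

/-- A continuous map from a rectangle to `[a, b] × [c, d]` such that the rectangle can be split into
rectangles each of which is mapped to a ball of radius `ε`, with its boundary mapped to one component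
of the intersection of this ball and the sublevel set. -/
inductive IsFineDisc (u : ℝ × ℝ → ℝ) (t a b c d ε : ℝ) :
    ℝ → ℝ → ℝ → ℝ → (ℝ × ℝ → ℝ × ℝ) → Prop
  | piece (a' b' c' d' : ℝ) (w y : ℝ × ℝ) (f : ℝ × ℝ → ℝ × ℝ) (hab : a' < b') (hcd : c' < d')
      (hw : w ∈ Icc a b ×ˢ Icc c d) (hf : ContinuousOn f (Icc a' b' ×ˢ Icc c' d'))
      (hfQ : MapsTo f (Icc a' b' ×ˢ Icc c' d') ((Icc a b ×ˢ Icc c d) ∩ closedBall w ε))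
      (h : MapsTo f (frame a' b' c' d')
        (connectedComponentIn (sublevel u t a b c d ∩ closedBall w ε) y)) :
      IsFineDisc u t a b c d ε a' b' c' d' f
  | union (a' b' c' d' a₁ b₁ c₁ d₁ a₂ b₂ c₂ d₂ : ℝ) (f : ℝ × ℝ → ℝ × ℝ)
      (hs : IsSplit a' b' c' d' a₁ b₁ c₁ d₁ a₂ b₂ c₂ d₂)
      (h₁ : IsFineDisc u t a b c d ε a₁ b₁ c₁ d₁ f)
      (h₂ : IsFineDisc u t a b c d ε a₂ b₂ c₂ d₂ f) :
      IsFineDisc u t a b c d ε a' b' c' d' f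

namespace IsFineDisc

variable {a' b' c' d' : ℝ} {f g : ℝ × ℝ → ℝ × ℝ}

theorem congr (h : IsFineDisc u t a b c d ε a' b' c' d' f)
    (hfg : EqOn g f (Icc a' b' ×ˢ Icc c' d')) : IsFineDisc u t a b c d ε a' b' c' d' g := by
  induction h with
  | piece a' b' c' d' w y f hab hcd hw hf hfQ h =>
    exact .piece a' b' c' d' w y g hab hcd hw (hf.congr hfg) (hfQ.congr hfg.symm)
      (h.congr (hfg.symm.mono (frame_subset _ _ _ _)))
  | union a' b' c' d' a₁ b₁ c₁ d₁ a₂ b₂ c₂ d₂ f hs h₁ h₂ ih₁ ih₂ =>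
    rw [hs.rect_eq] at hfg
    exact .union _ _ _ _ _ _ _ _ _ _ _ _ g hs (ih₁ (hfg.mono subset_union_left))
      (ih₂ (hfg.mono subset_union_right))

theorem mono {α β γ δ : ℝ} (h : IsFineDisc u t α β γ δ ε a' b' c' d' f)
    (hQ : Icc α β ×ˢ Icc γ δ ⊆ Icc a b ×ˢ Icc c d) :
    IsFineDisc u t a b c d ε a' b' c' d' f := by
  have hS : sublevel u t α β γ δ ⊆ sublevel u t a b c d := fun p hp => ⟨hQ hp.1, hp.2⟩
  induction h with
  | piece a' b' c' d' w y f hab hcd hw hf hfQ h =>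
    exact .piece a' b' c' d' w y f hab hcd (hQ hw) hf (fun x hx => ⟨hQ (hfQ hx).1, (hfQ hx).2⟩)
      (h.mono_right (connectedComponentIn_mono _ (inter_subset_inter_left _ hS)))
  | union a' b' c' d' a₁ b₁ c₁ d₁ a₂ b₂ c₂ d₂ f hs h₁ h₂ ih₁ ih₂ =>
    exact .union _ _ _ _ _ _ _ _ _ _ _ _ f hs ih₁ ih₂

theorem continuousOn (h : IsFineDisc u t a b c d ε a' b' c' d' f) :
    ContinuousOn f (Icc a' b' ×ˢ Icc c' d') := by
  induction h with
  | piece a' b' c' d' w y f hab hcd hw hf hfQ h => exact hf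
  | union a' b' c' d' a₁ b₁ c₁ d₁ a₂ b₂ c₂ d₂ f hs h₁ h₂ ih₁ ih₂ =>
    rw [hs.rect_eq]
    exact ih₁.union_of_isClosed ih₂ (isClosed_Icc.prod isClosed_Icc)
      (isClosed_Icc.prod isClosed_Icc)

theorem mapsTo (h : IsFineDisc u t a b c d ε a' b' c' d' f) :
    MapsTo f (Icc a' b' ×ˢ Icc c' d') (Icc a b ×ˢ Icc c d) := by
  induction h with
  | piece a' b' c' d' w y f hab hcd hw hf hfQ h => exact fun z hz => (hfQ hz).1
  | union a' b' c' d' a₁ b₁ c₁ d₁ a₂ b₂ c₂ d₂ f hs h₁ h₂ ih₁ ih₂ =>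
    rw [hs.rect_eq]
    exact ih₁.union ih₂

theorem exists_dist_le (h : IsFineDisc u t a b c d ε a' b' c' d' f) :
    ∀ z ∈ Icc a' b' ×ˢ Icc c' d', ∃ p ∈ sublevel u t a b c d, dist (f z) p ≤ 2 * ε := by
  induction h with
  | piece a' b' c' d' w y f hab hcd hw hf hfQ h =>
    intro z hz
    have hr := connectedComponentIn_subset _ _ (h (corner_mem_frame hab.le hcd.le))
    refine ⟨f (a', c'), hr.1, ?_⟩
    have h1 := mem_closedBall.mp hr.2
    have h2 := mem_closedBall.mp (hfQ hz).2
    linarith [dist_triangle_right (f z) (f (a', c')) w]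
  | union a' b' c' d' a₁ b₁ c₁ d₁ a₂ b₂ c₂ d₂ f hs h₁ h₂ ih₁ ih₂ =>
    rw [hs.rect_eq]
    exact fun z hz => hz.elim (ih₁ z) (ih₂ z)

theorem glue {a₁ b₁ c₁ d₁ a₂ b₂ c₂ d₂ : ℝ} (hs : IsSplit a' b' c' d' a₁ b₁ c₁ d₁ a₂ b₂ c₂ d₂)
    (h₁ : IsFineDisc u t a b c d ε a₁ b₁ c₁ d₁ f) (h₂ : IsFineDisc u t a b c d ε a₂ b₂ c₂ d₂ g)
    {φ : ℝ × ℝ → ℝ × ℝ} (hf : EqOn f φ (frame a₁ b₁ c₁ d₁)) (hg : EqOn g φ (frame a₂ b₂ c₂ d₂)) :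
    ∃ h, IsFineDisc u t a b c d ε a' b' c' d' h ∧ EqOn h φ (frame a' b' c' d') ∧
      EqOn h f (Icc a₁ b₁ ×ˢ Icc c₁ d₁) ∧ EqOn h g (Icc a₂ b₂ ×ˢ Icc c₂ d₂) := by
  obtain ⟨h, e1, e2, -⟩ := exists_glue ((isClosed_Icc (a := a₁) (b := b₁)).prod
    (isClosed_Icc (a := c₁) (b := d₁))) ((isClosed_Icc (a := a₂) (b := b₂)).prod
    (isClosed_Icc (a := c₂) (b := d₂))) h₁.continuousOn h₂.continuousOn fun z hz hz' => by
      rw [hf (hs.mem_frame_left hz hz'), hg (hs.mem_frame_right hz hz')]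
  refine ⟨h, .union _ _ _ _ _ _ _ _ _ _ _ _ h hs (h₁.congr e1) (h₂.congr e2), fun z hz => ?_,
    e1, e2⟩
  rcases hs.mem_frame hz with h' | h'
  · rw [e1 h'.1, hf h']
  · rw [e2 h'.1, hg h']

end IsFineDisc

/-- A point of `K` which lies in a small path-connected piece of `K` close to the value of `F`. -/
def NearVia (K : Set (ℝ × ℝ)) (F : ℝ × ℝ → ℝ × ℝ) (ρ ε : ℝ) (z w : ℝ × ℝ) : Prop :=
  ∃ k, dist k (F z) < ρ ∧ w ∈ pathComponentIn (K ∩ closedBall k ε) k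

theorem NearVia.mem {K : Set (ℝ × ℝ)} {F : ℝ × ℝ → ℝ × ℝ} {ρ ε : ℝ} {z w : ℝ × ℝ}
    (h : NearVia K F ρ ε z w) : w ∈ K := by
  obtain ⟨k, -, hw⟩ := h
  exact (JoinedIn.target_mem hw).1

theorem NearVia.dist_lt {K : Set (ℝ × ℝ)} {F : ℝ × ℝ → ℝ × ℝ} {ρ ε : ℝ} {z w : ℝ × ℝ}
    (h : NearVia K F ρ ε z w) : dist w (F z) < ε + ρ := by
  obtain ⟨k, hk, hw⟩ := h
  have := mem_closedBall.mp (JoinedIn.target_mem hw).2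
  linarith [dist_triangle w k (F z)]

theorem edgeFill_nearVia_of_convex {K C : Set (ℝ × ℝ)} {F : ℝ × ℝ → ℝ × ℝ} (hC : Convex ℝ C)
    (hF : Continuous F) {ρ ε : ℝ}
    (hjoin : ∀ x ∈ K, ∀ y ∈ K, dist x y < 2 * ρ → JoinedIn (K ∩ closedBall x ε) x y)
    {z m p k₀ : ℝ × ℝ} (hz : z ∈ C) (hm : m ∈ C) (hk₀ : k₀ ∈ K) (hk₀C : ∀ x ∈ C, dist k₀ (F x) < ρ)
    (hp : NearVia K F ρ ε z p) : EdgeFill (NearVia K F ρ ε) z m p k₀ := by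
  obtain ⟨k, hk, hpk⟩ := hp
  have hkK : k ∈ K := (JoinedIn.source_mem hpk).1
  have hc : Continuous fun s : ℝ => dist k (F (AffineMap.lineMap z m s)) :=
    continuous_const.dist (hF.comp AffineMap.lineMap_continuous)
  obtain ⟨r, hr, hrs⟩ := Metric.isOpen_iff.mp (isOpen_lt hc continuous_const) 0
    (show (0 : ℝ) ∈ {s : ℝ | dist k (F (AffineMap.lineMap z m s)) < ρ} by simpa using hk)
  have hs₀ : min (r / 2) (1 / 2) ∈ Ioo (0 : ℝ) 1 :=
    ⟨by positivity, (min_le_right _ _).trans_lt (by norm_num)⟩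
  have hle : min (r / 2) (1 / 2) < r := (min_le_left _ _).trans_lt (by linarith)
  generalize min (r / 2) (1 / 2) = s₀ at hs₀ hle
  have hline : ∀ s ∈ Icc 0 s₀, dist k (F (AffineMap.lineMap z m s)) < ρ := fun s hs => hrs (by
    rw [mem_ball, Real.dist_eq, sub_zero, abs_of_nonneg hs.1]
    exact hs.2.trans_lt hle)
  have hmC : AffineMap.lineMap z m s₀ ∈ C := hC.lineMap_mem hz hm (Ioo_subset_Icc_self hs₀)
  have hself : ∀ k ∈ K, 0 ≤ ε → k ∈ K ∩ closedBall k ε := fun k hk hε =>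
    ⟨hk, mem_closedBall_self hε⟩
  have hε : 0 ≤ ε := dist_nonneg.trans (mem_closedBall.mp (JoinedIn.source_mem hpk).2)
  have hkk : dist k₀ k < 2 * ρ := by
    have h1 := hline s₀ ⟨hs₀.1.le, le_rfl⟩
    have h2 := hk₀C _ hmC
    linarith [dist_triangle_right k₀ k (F (AffineMap.lineMap z m s₀))]
  refine EdgeFill.trans (r := k) hs₀
    (EdgeFill.of_joinedIn (A := pathComponentIn (K ∩ closedBall k ε) k) ?_ fun s hs y hy => ?_)
    (EdgeFill.of_joinedIn (A := pathComponentIn (K ∩ closedBall k₀ ε) k₀) ?_ fun s hs y hy => ?_)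
  · exact ((isPathConnected_pathComponentIn (hself k hkK hε)).joinedIn _
      (mem_pathComponentIn_self (hself k hkK hε)) _ hpk).symm
  · refine ⟨k, ?_, hy⟩
    have e : AffineMap.lineMap z (AffineMap.lineMap z m s₀) s =
        AffineMap.lineMap z m (s * s₀) := by
      simp only [AffineMap.lineMap_apply_module]
      ext <;> simp <;> ring
    rw [e]
    exact hline _ ⟨mul_nonneg hs.1 hs₀.1.le, mul_le_of_le_one_left hs₀.1.le hs.2⟩
  · exact ((isPathConnected_pathComponentIn (hself k₀ hk₀ hε)).joinedIn _
      (mem_pathComponentIn_self (hself k₀ hk₀ hε)) _ (hjoin k₀ hk₀ k hkK hkk)).symm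
  · exact ⟨k₀, hk₀C _ (hC.lineMap_mem hmC hm hs), hy⟩

theorem IsAdmissible.exists_isFineDisc (hu : IsAdmissible u a b c d) (hab : a < b) (hcd : c < d)
    {x : ℝ × ℝ} (hx : x ∈ sublevel u t a b c d) {a' b' c' d' : ℝ} (hab' : a' < b') (hcd' : c' < d')
    {φ : ℝ × ℝ → ℝ × ℝ} (hφ : ContinuousOn φ (frame a' b' c' d'))
    (hφK : MapsTo φ (frame a' b' c' d') (connectedComponentIn (sublevel u t a b c d) x))
    (hε : 0 < ε) :
    ∃ f, IsFineDisc u t a b c d ε a' b' c' d' f ∧ EqOn f φ (frame a' b' c' d') := by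
  set K := connectedComponentIn (sublevel u t a b c d) x with hKdef
  have hKS : K ⊆ sublevel u t a b c d := connectedComponentIn_subset _ _
  obtain ⟨δ, hδ, hjoin⟩ := hu.exists_joinedIn hab hcd t x (ε := ε / 8) (by positivity)
  obtain ⟨ρ, hρ, hρδ, hρε⟩ : ∃ ρ > 0, 2 * ρ ≤ δ ∧ ρ ≤ ε / 8 :=
    ⟨min (δ / 2) (ε / 8), by positivity, by linarith [min_le_left (δ / 2) (ε / 8)],
      min_le_right _ _⟩
  obtain ⟨F, hF, hFφ, hFN⟩ := hu.exists_extension_thickening hab hcd hx (isClosed_frame a' b' c' d')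
    hφ hφK (half_pos hρ)
  obtain ⟨η, hη, hFη⟩ := Metric.uniformContinuousOn_iff.mp
    ((isCompact_rect a' b' c' d').uniformContinuousOn_of_continuous hF.continuousOn) (ρ / 2)
    (half_pos hρ)
  have hself : ∀ k ∈ K, k ∈ pathComponentIn (K ∩ closedBall k (ε / 8)) k := fun k hk =>
    mem_pathComponentIn_self ⟨hk, mem_closedBall_self (by positivity)⟩
  have hnear : ∀ z, ∃ k ∈ K, dist k (F z) < ρ / 2 := fun z => by
    obtain ⟨k, hk, h⟩ := mem_thickening_iff.mp (hFN z)
    exact ⟨k, hk, by rwa [dist_comm]⟩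
  refine rect_induction (adm := NearVia K F ρ (ε / 8)) (Fill := fun a' b' c' d' g =>
    ∃ f, IsFineDisc u t a b c d ε a' b' c' d' f ∧ EqOn f g (frame a' b' c' d')) hη ?_ ?_ ?_ ?_
    hab' hcd' hφ fun z hz => ⟨φ z, by rw [hFφ hz, dist_self]; exact hρ, hself _ (hφK hz)⟩
  · intro z hz w hw p q hp hq
    have hconv := convex_rect a' b' c' d'
    refine EdgeFill.of_small hconv (fun z _ => ?_) hη ?_ hz hw hp hq
    · obtain ⟨k, hk, h⟩ := hnear z
      exact ⟨k, k, by linarith, hself k hk⟩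
    · intro z hz w hw hzw p q hp hq
      obtain ⟨k, hk, hkz⟩ := hnear z
      have hC : Convex ℝ ((Icc a' b' ×ˢ Icc c' d') ∩ ball z η) := hconv.inter (convex_ball z η)
      have hkC : ∀ y ∈ (Icc a' b' ×ˢ Icc c' d') ∩ ball z η, dist k (F y) < ρ := by
        intro y hy
        have h1 := hFη y hy.1 z hz hy.2
        linarith [dist_triangle_right k (F y) (F z), dist_comm (F y) (F z),
          dist_triangle k (F z) (F y)]
      have hzC : z ∈ (Icc a' b' ×ˢ Icc c' d') ∩ ball z η := ⟨hz, mem_ball_self hη⟩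
      have hwC : w ∈ (Icc a' b' ×ˢ Icc c' d') ∩ ball z η := ⟨hw, by rwa [mem_ball, dist_comm]⟩
      have hmC := hC.midpoint_mem hzC hwC
      have hjoin' : ∀ x ∈ K, ∀ y ∈ K, dist x y < 2 * ρ →
          JoinedIn (K ∩ closedBall x (ε / 8)) x y := fun x hx y hy h =>
        hjoin x hx y hy (h.trans_le hρδ)
      exact EdgeFill.of_midpoint
        (edgeFill_nearVia_of_convex hC hF hjoin' hzC hmC hk hkC hp)
        (edgeFill_nearVia_of_convex hC hF hjoin' hwC hmC hk hkC hq)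
  · rintro a b c d f g hfg ⟨h, hh, hhf⟩
    exact ⟨h, hh, hhf.trans hfg⟩
  · intro α β γ δ g hαβ hγδ hQ hβ hδ hg hga
    have hcor := corner_mem_frame hαβ.le hγδ.le
    have hgK : ∀ z ∈ frame α β γ δ, g z ∈ K := fun z hz => (hga z hz).mem
    have hgw : ∀ z ∈ frame α β γ δ, g z ∈ closedBall (g (α, γ)) ε := by
      intro z hz
      have h1 := (hga z hz).dist_lt
      have h2 := (hga _ hcor).dist_lt
      have h3 : dist (F z) (F (α, γ)) < ρ / 2 := by
        refine hFη z (hQ hz.1) _ (hQ hcor.1) ?_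
        rw [Prod.dist_eq, max_lt_iff, Real.dist_eq, Real.dist_eq, abs_lt, abs_lt]
        have h1 := hz.1.1
        have h2 := hz.1.2
        exact ⟨⟨by linarith [h1.1, h1.2], by linarith [h1.1, h1.2]⟩,
          ⟨by linarith [h2.1, h2.2], by linarith [h2.1, h2.2]⟩⟩
      rw [mem_closedBall]
      linarith [dist_triangle (g z) (F z) (g (α, γ)), dist_triangle_right (F z) (g (α, γ))
        (F (α, γ))]
    have hw := (hKS (hgK _ hcor)).1
    obtain ⟨a₁, b₁, c₁, d₁, hab₁, hcd₁, -, hR, -⟩ := exists_rect_inter hu hab hcd hw hε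
    obtain ⟨f, hf, hfg, hfR⟩ := exists_extension_rect (isClosed_frame α β γ δ) hab₁.le hcd₁.le hg
      fun z hz => by rw [hR]; exact ⟨(hKS (hgK z hz)).1, hgw z hz⟩
    refine ⟨f, .piece α β γ δ (g (α, γ)) (g (α, γ)) f hαβ hγδ hw hf.continuousOn
      (fun z _ => by rw [← hR]; exact hfR z) ?_, hfg⟩
    have hsub : g '' frame α β γ δ ⊆ connectedComponentIn
        (sublevel u t a b c d ∩ closedBall (g (α, γ)) ε) (g (α, γ)) := by
      refine ((isPreconnected_frame hαβ.le hγδ.le).image g hg).subset_connectedComponentIn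
        (mem_image_of_mem g hcor) ?_
      rintro _ ⟨z, hz, rfl⟩
      exact ⟨hKS (hgK z hz), hgw z hz⟩
    intro z hz
    rw [hfg hz]
    exact hsub (mem_image_of_mem g hz)
  · rintro a b c d a₁ b₁ c₁ d₁ a₂ b₂ c₂ d₂ g hs ⟨f₁, h₁, e₁⟩ ⟨f₂, h₂, e₂⟩
    obtain ⟨f, hf, hfg, -⟩ := IsFineDisc.glue hs h₁ h₂ e₁ e₂
    exact ⟨f, hf, hfg⟩

theorem IsFineDisc.exists_refinement {a' b' c' d' : ℝ} {f : ℝ × ℝ → ℝ × ℝ}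
    (hu : IsAdmissible u a b c d) (hab : a < b) (hcd : c < d) (hε : 0 < ε)
    (h : IsFineDisc u t a b c d ε a' b' c' d' f) {ε' : ℝ} (hε' : 0 < ε') :
    ∃ g, IsFineDisc u t a b c d ε' a' b' c' d' g ∧ EqOn g f (frame a' b' c' d') ∧
      ∀ z ∈ Icc a' b' ×ˢ Icc c' d', dist (f z) (g z) ≤ 2 * ε := by
  induction h with
  | piece a' b' c' d' w y f hab' hcd' hw hf hfQ h =>
    obtain ⟨α, β, γ, δ, hαβ, hγδ, hu', hQ, hS⟩ := exists_rect_inter hu hab hcd hw hε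
    rw [← hS] at h
    have hy := connectedComponentIn_nonempty_iff.mp ⟨_, h (corner_mem_frame hab'.le hcd'.le)⟩
    obtain ⟨g, hg, hgf⟩ := hu'.exists_isFineDisc hαβ hγδ hy hab' hcd'
      (hf.mono (frame_subset _ _ _ _)) h hε'
    have hsub : Icc α β ×ˢ Icc γ δ ⊆ Icc a b ×ˢ Icc c d := by
      rw [hQ]; exact inter_subset_left
    refine ⟨g, hg.mono hsub, hgf, fun z hz => ?_⟩
    have h1 := hg.mapsTo hz
    rw [hQ] at h1
    have h2 := mem_closedBall.mp h1.2
    have h3 := mem_closedBall.mp (hfQ hz).2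
    linarith [dist_triangle_right (f z) (g z) w]
  | union a' b' c' d' a₁ b₁ c₁ d₁ a₂ b₂ c₂ d₂ f hs h₁ h₂ ih₁ ih₂ =>
    obtain ⟨g₁, hg₁, e₁, k₁⟩ := ih₁
    obtain ⟨g₂, hg₂, e₂, k₂⟩ := ih₂
    obtain ⟨g, hg, hgf, l₁, l₂⟩ := IsFineDisc.glue hs hg₁ hg₂ e₁ e₂
    refine ⟨g, hg, hgf, ?_⟩
    rw [hs.rect_eq]
    rintro z (hz | hz)
    · rw [l₁ hz]; exact k₁ z hz
    · rw [l₂ hz]; exact k₂ z hz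

end

section

open scoped unitInterval

variable {u : ℝ × ℝ → ℝ} {t a b c d : ℝ}

/-- A map from the boundary of a rectangle to a component of the sublevel set extends to the
rectangle. -/
theorem IsAdmissible.exists_extension_component (hu : IsAdmissible u a b c d) (hab : a < b)
    (hcd : c < d) {x : ℝ × ℝ} {a' b' c' d' : ℝ} (hab' : a' < b') (hcd' : c' < d')
    {φ : ℝ × ℝ → ℝ × ℝ} (hφ : ContinuousOn φ (frame a' b' c' d'))
    (hφK : MapsTo φ (frame a' b' c' d') (connectedComponentIn (sublevel u t a b c d) x)) :
    ∃ g, ContinuousOn g (Icc a' b' ×ˢ Icc c' d') ∧ EqOn g φ (frame a' b' c' d') ∧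
      MapsTo g (Icc a' b' ×ˢ Icc c' d') (connectedComponentIn (sublevel u t a b c d) x) := by
  set e : ℕ → ℝ := fun n => 1 / 2 ^ n with he
  have hpos : ∀ n, 0 < e n := fun n => by positivity
  have hcor := corner_mem_frame hab'.le hcd'.le
  have hx := connectedComponentIn_nonempty_iff.mp ⟨_, hφK hcor⟩
  obtain ⟨f₀, hf₀, hf₀φ⟩ := hu.exists_isFineDisc hab hcd hx hab' hcd' hφ hφK (hpos 0)
  have step : ∀ (n : ℕ) (f : {f // IsFineDisc u t a b c d (e n) a' b' c' d' f}),
      ∃ g : {f // IsFineDisc u t a b c d (e (n + 1)) a' b' c' d' f},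
        EqOn g.1 f.1 (frame a' b' c' d') ∧
        ∀ z ∈ Icc a' b' ×ˢ Icc c' d', dist (f.1 z) (g.1 z) ≤ 2 * e n := by
    rintro n ⟨f, hf⟩
    obtain ⟨g, hg, h⟩ := hf.exists_refinement hu hab hcd (hpos n) (hpos (n + 1))
    exact ⟨⟨g, hg⟩, h⟩
  choose F hF hFd using step
  let G : ∀ n, {f // IsFineDisc u t a b c d (e n) a' b' c' d' f} :=
    fun n => Nat.rec ⟨f₀, hf₀⟩ F n
  have hG : ∀ n, EqOn (G n).1 φ (frame a' b' c' d') := fun n => by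
    induction n with
    | zero => exact hf₀φ
    | succ n ih => exact (hF n (G n)).trans ih
  obtain ⟨g, hg, hlim⟩ := exists_lim_of_dist_le (f := fun n => (G n).1)
    (D := Icc a' b' ×ˢ Icc c' d') (C := 4)
    (fun n => (G n).2.continuousOn) (fun n x hx => by
      have := hFd n (G n) x hx
      simp only [he] at this
      calc _ ≤ _ := this
        _ = _ := by ring)
  have hgφ : EqOn g φ (frame a' b' c' d') := fun z hz =>
    tendsto_nhds_unique (hlim z hz.1) (tendsto_const_nhds.congr fun n => (hG n hz).symm)
  have he0 : Tendsto (fun n => 2 * e n) atTop (𝓝 0) := by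
    simpa [he] using (tendsto_pow_atTop_nhds_zero_of_lt_one
      (r := (2 : ℝ)⁻¹) (by norm_num) (by norm_num)).const_mul 2
  have hgS : MapsTo g (Icc a' b' ×ˢ Icc c' d') (sublevel u t a b c d) := by
    intro x hx
    choose p hp hpd using fun n => (G n).2.exists_dist_le x hx
    have : Tendsto p atTop (𝓝 (g x)) := (tendsto_iff_of_dist
      (squeeze_zero (fun _ => dist_nonneg) hpd he0)).mp (hlim x hx)
    exact (hu.isClosed_sublevel t).mem_of_tendsto this (Eventually.of_forall hp)
  refine ⟨g, hg, hgφ, mapsTo_iff_image_subset.mpr ?_⟩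
  rw [connectedComponentIn_eq (hφK hcor), ← hgφ hcor]
  exact ((isPreconnected_Icc.prod isPreconnected_Icc).image g hg).subset_connectedComponentIn
    (mem_image_of_mem g hcor.1) (image_subset_iff.mpr hgS)

theorem IsAdmissible.simplyConnectedSpace (hu : IsAdmissible u a b c d) (hab : a < b)
    (hcd : c < d) {x : ℝ × ℝ} (hx : x ∈ sublevel u t a b c d) :
    SimplyConnectedSpace (connectedComponentIn (sublevel u t a b c d) x) := by
  rw [simply_connected_iff_paths_homotopic']
  refine ⟨isPathConnected_iff_pathConnectedSpace.mp
    ⟨x, mem_connectedComponentIn hx, fun _ hy => hu.joinedIn_component hab hcd hy⟩, ?_⟩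
  intro y z p q
  obtain ⟨φ, h1, h2, h3⟩ := exists_glue (X := ℝ × ℝ) (A := frame 0 1 0 1 ∩ {z | z.1 ≤ 1 / 2})
    (B := frame 0 1 0 1 ∩ {z | 1 / 2 ≤ z.1})
    ((isClosed_frame _ _ _ _).inter (isClosed_le continuous_fst continuous_const))
    ((isClosed_frame _ _ _ _).inter (isClosed_le continuous_const continuous_fst))
    (f := fun z => (p.extend z.2 : ℝ × ℝ)) (g := fun z => (q.extend z.2 : ℝ × ℝ))
    (Continuous.continuousOn (by fun_prop)) (Continuous.continuousOn (by fun_prop))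
    fun w hw hw' => by
      have e : w.1 = 1 / 2 := le_antisymm hw.2 hw'.2
      rcases frame_of_fst_mem hw.1 (by rw [e]; norm_num) with h | h <;> simp [h]
  have hmem : ∀ w ∈ frame (0 : ℝ) 1 0 1, w ∈ frame 0 1 0 1 ∩ {z : ℝ × ℝ | z.1 ≤ 1 / 2} ∪
      frame 0 1 0 1 ∩ {z : ℝ × ℝ | 1 / 2 ≤ z.1} := fun w hw =>
    (le_total w.1 (1 / 2)).imp (fun h => ⟨hw, h⟩) fun h => ⟨hw, h⟩
  obtain ⟨g, hg, hgφ, hgK⟩ := hu.exists_extension_component (t := t) (x := x) hab hcd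
    zero_lt_one zero_lt_one (h3.mono hmem) fun w hw => by
      rcases hmem w hw with h | h
      · rw [h1 h]; exact (p.extend w.2).2
      · rw [h2 h]; exact (q.extend w.2).2
  have hI : ∀ w : I × I, ((w.1 : ℝ), (w.2 : ℝ)) ∈ Icc (0 : ℝ) 1 ×ˢ Icc (0 : ℝ) 1 :=
    fun w => ⟨w.1.2, w.2.2⟩
  have hg0 : ∀ s : I, g (0, s) = p s := fun s => by
    have hf : ((0 : ℝ), (s : ℝ)) ∈ frame 0 1 0 1 :=
      mem_frame_iff.mpr ⟨hI (0, s), Or.inl rfl⟩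
    have hm : ((0 : ℝ), (s : ℝ)) ∈ frame 0 1 0 1 ∩ {z : ℝ × ℝ | z.1 ≤ 1 / 2} := ⟨hf, by simp⟩
    rw [hgφ hf, h1 hm]
    simp
  have hg1 : ∀ s : I, g (1, s) = q s := fun s => by
    have hf : ((1 : ℝ), (s : ℝ)) ∈ frame 0 1 0 1 :=
      mem_frame_iff.mpr ⟨hI (1, s), Or.inr (Or.inl rfl)⟩
    have hm : ((1 : ℝ), (s : ℝ)) ∈ frame 0 1 0 1 ∩ {z : ℝ × ℝ | 1 / 2 ≤ z.1} :=
      ⟨hf, by norm_num⟩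
    rw [hgφ hf, h2 hm]
    simp
  have hgy : ∀ s : I, g (s, 0) = y := fun s => by
    have hf : ((s : ℝ), (0 : ℝ)) ∈ frame 0 1 0 1 :=
      mem_frame_iff.mpr ⟨hI (s, 0), Or.inr (Or.inr (Or.inl rfl))⟩
    rw [hgφ hf]
    rcases hmem _ hf with h | h
    · rw [h1 h]; simp
    · rw [h2 h]; simp
  have hgz : ∀ s : I, g (s, 1) = z := fun s => by
    have hf : ((s : ℝ), (1 : ℝ)) ∈ frame 0 1 0 1 :=
      mem_frame_iff.mpr ⟨hI (s, 1), Or.inr (Or.inr (Or.inr rfl))⟩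
    rw [hgφ hf]
    rcases hmem _ hf with h | h
    · rw [h1 h]; simp
    · rw [h2 h]; simp
  refine ⟨⟨⟨⟨fun w => ⟨g (w.1, w.2), hgK (hI w)⟩, ?_⟩, fun s => Subtype.ext (hg0 s),
    fun s => Subtype.ext (hg1 s)⟩, ?_⟩⟩
  · exact Continuous.subtype_mk (hg.comp_continuous (by fun_prop) hI) _
  · rintro s τ (rfl | rfl)
    · exact Subtype.ext ((hgy s).trans (by simp))
    · exact Subtype.ext ((hgz s).trans (by simp))

end

section

theorem second_deriv_le_of_isLocalMax {f f' : ℝ → ℝ} {f'' s k m e : ℝ}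
    (h1 : ∀ᶠ x in 𝓝 s, HasDerivAt f (f' x) x) (h2 : HasDerivAt f' f'' s)
    (h : IsLocalMax (fun x => f x - k * (x - m) ^ 2 - e) s) : f'' ≤ 2 * k := by
  by_contra! hk
  set g : ℝ → ℝ := fun x => f x - k * (x - m) ^ 2 - e
  have hg : ∀ᶠ x in 𝓝 s, HasDerivAt g (f' x - 2 * k * (x - m)) x := by
    filter_upwards [h1] with x hx
    have := (hx.sub (((((hasDerivAt_id x).sub_const m).pow 2).const_mul k))).sub_const e
    exact this.congr_deriv (by simp; ring)
  have hd : deriv g =ᶠ[𝓝 s] fun x => f' x - 2 * k * (x - m) := hg.mono fun x hx => hx.deriv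
  have hdd : deriv (deriv g) s = f'' - 2 * k := by
    rw [hd.deriv_eq]
    have := h2.sub (((hasDerivAt_id s).sub_const m).const_mul (2 * k))
    rw [mul_one] at this
    exact this.deriv
  have hmin : IsLocalMin g s := isLocalMin_of_deriv_deriv_pos (by rw [hdd]; linarith)
    h.deriv_eq_zero hg.self_of_nhds.continuousAt
  have hc : g =ᶠ[𝓝 s] fun _ => g s := by
    filter_upwards [h, hmin] with x hx hx'
    exact le_antisymm hx hx'
  have h0 : deriv (deriv g) s = 0 := by
    rw [hc.deriv.deriv_eq]
    simp
  linarith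

section Directional

variable {E : Type*} [NormedAddCommGroup E] [NormedSpace ℝ E] {u : E → ℝ} {U : Set E}

theorem hasDerivAt_line {y v : E} {s : ℝ} (h : DifferentiableAt ℝ u (y + s • v)) :
    HasDerivAt (fun x : ℝ => u (y + x • v)) (fderiv ℝ u (y + s • v) v) s := by
  have h1 : HasDerivAt (fun x : ℝ => y + x • v) v s := by
    simpa using ((hasDerivAt_id s).smul_const v).const_add y
  exact h.hasFDerivAt.comp_hasDerivAt s h1

theorem contDiffOn_fderiv_apply (hU : IsOpen U) (hu : ContDiffOn ℝ 2 u U) (v : E) :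
    ContDiffOn ℝ 1 (fun y => fderiv ℝ u y v) U :=
  (hu.fderiv_of_isOpen hU (by norm_num)).clm_apply contDiffOn_const

theorem hasDerivAt_line_of_mem (hU : IsOpen U) (hu : ContDiffOn ℝ 2 u U) {y v : E} {s : ℝ}
    (hs : y + s • v ∈ U) :
    HasDerivAt (fun x : ℝ => u (y + x • v)) (fderiv ℝ u (y + s • v) v) s :=
  hasDerivAt_line ((hu.differentiableOn (by norm_num)).differentiableAt (hU.mem_nhds hs))

theorem hasDerivAt_fderiv_line_of_mem (hU : IsOpen U) (hu : ContDiffOn ℝ 2 u U) {y v : E} {s : ℝ}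
    (hs : y + s • v ∈ U) :
    HasDerivAt (fun x : ℝ => fderiv ℝ u (y + x • v) v)
      (fderiv ℝ (fun w => fderiv ℝ u w v) (y + s • v) v) s :=
  hasDerivAt_line (u := fun w => fderiv ℝ u w v)
    (((contDiffOn_fderiv_apply hU hu v).differentiableOn (by norm_num)).differentiableAt
      (hU.mem_nhds hs))

theorem eventually_line_mem (hU : IsOpen U) {y v : E} {s : ℝ} (hs : y + s • v ∈ U) :
    ∀ᶠ x : ℝ in 𝓝 s, y + x • v ∈ U :=
  (hU.preimage (f := fun x : ℝ => y + x • v) (by fun_prop)).mem_nhds hs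

theorem second_fderiv_le_of_isLocalMax (hU : IsOpen U) (hu : ContDiffOn ℝ 2 u U) {y v : E}
    {s k m e : ℝ} (hs : y + s • v ∈ U)
    (h : IsLocalMax (fun x : ℝ => u (y + x • v) - k * (x - m) ^ 2 - e) s) :
    fderiv ℝ (fun w => fderiv ℝ u w v) (y + s • v) v ≤ 2 * k :=
  second_deriv_le_of_isLocalMax ((eventually_line_mem hU hs).mono fun _ hx =>
    hasDerivAt_line_of_mem hU hu hx) (hasDerivAt_fderiv_line_of_mem hU hu hs) h

theorem strictConvexOn_line (hU : IsOpen U) (hu : ContDiffOn ℝ 2 u U) {y v : E} {D : Set ℝ}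
    (hD : Convex ℝ D) (hDU : ∀ x ∈ D, y + x • v ∈ U)
    (hpos : ∀ x ∈ D, 0 < fderiv ℝ (fun w => fderiv ℝ u w v) (y + x • v) v) :
    StrictConvexOn ℝ D fun x : ℝ => u (y + x • v) := by
  refine strictConvexOn_of_deriv2_pos' hD (fun x hx =>
    (hasDerivAt_line_of_mem hU hu (hDU x hx)).continuousAt.continuousWithinAt) fun x hx => ?_
  have h : deriv (fun x : ℝ => u (y + x • v)) =ᶠ[𝓝 x] fun x => fderiv ℝ u (y + x • v) v :=
    (eventually_line_mem hU (hDU x hx)).mono fun _ hx => (hasDerivAt_line_of_mem hU hu hx).deriv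
  rw [Function.iterate_succ_apply, Function.iterate_one, h.deriv_eq,
    (hasDerivAt_fderiv_line_of_mem hU hu (hDU x hx)).deriv]
  exact hpos x hx

theorem eventually_second_fderiv_pos (hU : IsOpen U) (hu : ContDiffOn ℝ 2 u U) {z v : E}
    (hz : z ∈ U) (hpos : 0 < fderiv ℝ (fun w => fderiv ℝ u w v) z v) :
    ∀ᶠ w in 𝓝 z, w ∈ U ∧ 0 < fderiv ℝ (fun w => fderiv ℝ u w v) w v := by
  have hc : ContinuousAt (fun w => fderiv ℝ (fun w => fderiv ℝ u w v) w v) z :=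
    (((contDiffOn_fderiv_apply hU hu v).continuousOn_fderiv_of_isOpen hU le_rfl).clm_apply
      continuousOn_const).continuousAt (hU.mem_nhds hz)
  exact (hU.eventually_mem hz).and (hc.eventually (lt_mem_nhds hpos))

end Directional

/-- The Euclidean plane is homeomorphic to the product of two lines. -/
def euclideanHomeomorphProd : EuclideanSpace ℝ (Fin 2) ≃ₜ ℝ × ℝ where
  toFun z := (z 0, z 1)
  invFun p := !₂[p.1, p.2]
  left_inv z := by ext i; fin_cases i <;> rfl
  right_inv p := rfl
  continuous_toFun := by fun_prop
  continuous_invFun := by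
    refine (PiLp.continuous_toLp 2 _).comp (continuous_pi fun i => ?_)
    fin_cases i
    · exact continuous_fst
    · exact continuous_snd

theorem euclidean_eq_fst (x y : ℝ) :
    (!₂[x, y] : EuclideanSpace ℝ (Fin 2)) = !₂[0, y] + x • EuclideanSpace.single 0 1 := by
  ext i; fin_cases i <;> simp

theorem euclidean_eq_snd (x y : ℝ) :
    (!₂[x, y] : EuclideanSpace ℝ (Fin 2)) = !₂[x, 0] + y • EuclideanSpace.single 1 1 := by
  ext i; fin_cases i <;> simp

theorem isOpen_openUnitSquare : IsOpen openUnitSquare := by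
  have : openUnitSquare = ⋂ i : Fin 2, (fun x : EuclideanSpace ℝ (Fin 2) => x i) ⁻¹' Ioo 0 1 := by
    ext x; simp [openUnitSquare]
  rw [this]
  exact isOpen_iInter_of_finite fun i => isOpen_Ioo.preimage (by fun_prop)

theorem isAdmissible_of_one_le_laplacian {u : EuclideanSpace ℝ (Fin 2) → ℝ}
    (hcont : ContinuousOn u unitSquare) (hC2 : ContDiffOn ℝ 2 u openUnitSquare)
    (hlap : ∀ x ∈ openUnitSquare, 1 ≤ laplacian u x) :
    IsAdmissible (fun p => u !₂[p.1, p.2]) 0 1 0 1 := by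
  have hU := isOpen_openUnitSquare
  have hmem : ∀ z ∈ Ioo (0 : ℝ) 1 ×ˢ Ioo (0 : ℝ) 1, !₂[z.1, z.2] ∈ openUnitSquare := by
    rintro z hz i
    fin_cases i
    · exact hz.1
    · exact hz.2
  have hsymm : Continuous fun p : ℝ × ℝ => (!₂[p.1, p.2] : EuclideanSpace ℝ (Fin 2)) :=
    euclideanHomeomorphProd.symm.continuous
  have key : ∀ z ∈ Ioo (0 : ℝ) 1 ×ˢ Ioo (0 : ℝ) 1, ∀ k l m n : ℝ, k + l < 1 / 2 →
      ¬ IsLocalMax (fun p : ℝ × ℝ =>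
        u !₂[p.1, p.2] - k * (p.1 - m) ^ 2 - l * (p.2 - n) ^ 2) z := by
    intro z hz k l m n hkl h
    have hz' := hmem z hz
    have hL := hlap _ hz'
    rw [laplacian, Fin.sum_univ_two] at hL
    have h0 : IsLocalMax (fun x : ℝ => u (!₂[0, z.2] + x • EuclideanSpace.single 0 1) -
        k * (x - m) ^ 2 - l * (z.2 - n) ^ 2) z.1 := by
      have := h.comp_continuous (g := fun x : ℝ => (x, z.2)) (b := z.1) (by fun_prop)
      simp only [Function.comp_def] at this
      convert this using 2 with x
      rw [← euclidean_eq_fst]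
    have h1 : IsLocalMax (fun x : ℝ => u (!₂[z.1, 0] + x • EuclideanSpace.single 1 1) -
        l * (x - n) ^ 2 - k * (z.1 - m) ^ 2) z.2 := by
      have := h.comp_continuous (g := fun x : ℝ => (z.1, x)) (b := z.2) (by fun_prop)
      simp only [Function.comp_def] at this
      convert this using 2 with x
      rw [← euclidean_eq_snd]; ring
    have e0 := second_fderiv_le_of_isLocalMax hU hC2 (by rwa [← euclidean_eq_fst]) h0
    have e1 := second_fderiv_le_of_isLocalMax hU hC2 (by rwa [← euclidean_eq_snd]) h1
    rw [← euclidean_eq_fst] at e0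
    rw [← euclidean_eq_snd] at e1
    linarith
  refine ⟨hcont.comp hsymm.continuousOn ?_, ?_, ?_, ?_⟩
  · rintro z hz i
    fin_cases i
    · exact hz.1
    · exact hz.2
  · intro z hz m h
    refine key z hz (1 / 4) 0 m 0 (by norm_num) ?_
    convert h using 2; ring
  · intro z hz m h
    refine key z hz 0 (1 / 4) 0 m (by norm_num) ?_
    convert h using 2; ring
  · intro z hz
    have hz' := hmem z hz
    have hL := hlap _ hz'
    rw [laplacian, Fin.sum_univ_two] at hL
    have near : ∀ i : Fin 2, 0 < fderiv ℝ (fun y => fderiv ℝ u y (EuclideanSpace.single i 1))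
        !₂[z.1, z.2] (EuclideanSpace.single i 1) → ∃ r > 0, ∀ x y : ℝ, |x - z.1| ≤ r →
        |y - z.2| ≤ r → !₂[x, y] ∈ openUnitSquare ∧
        0 < fderiv ℝ (fun y => fderiv ℝ u y (EuclideanSpace.single i 1))
          !₂[x, y] (EuclideanSpace.single i 1) := by
      intro i hi
      have := (hsymm.tendsto z).eventually (eventually_second_fderiv_pos hU hC2 hz' hi)
      obtain ⟨r, hr, h⟩ := (nhds_basis_closedBall.eventually_iff).mp this
      refine ⟨r, hr, fun x y hx hy => h (x := (x, y)) ?_⟩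
      rw [mem_closedBall, Prod.dist_eq]
      exact max_le hx hy
    have habs : ∀ {w r x : ℝ}, x ∈ Icc (w - r) (w + r) → |x - w| ≤ r := fun h =>
      abs_le.mpr ⟨by linarith [h.1], by linarith [h.2]⟩
    rcases lt_or_ge 0 (fderiv ℝ (fun y => fderiv ℝ u y (EuclideanSpace.single 0 1))
        !₂[z.1, z.2] (EuclideanSpace.single 0 1)) with h0 | h0
    · obtain ⟨r, hr, h⟩ := near 0 h0
      refine ⟨r, hr, Or.inl fun y hy => ?_⟩
      rw [funext fun x => congrArg u (euclidean_eq_fst x y)]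
      refine strictConvexOn_line hU hC2 (convex_Icc _ _) (fun x hx => ?_) fun x hx => ?_ <;>
        rw [← euclidean_eq_fst]
      exacts [(h x y (habs hx) hy).1, (h x y (habs hx) hy).2]
    · obtain ⟨r, hr, h⟩ := near 1 (by linarith)
      refine ⟨r, hr, Or.inr fun x hx => ?_⟩
      rw [funext fun y => congrArg u (euclidean_eq_snd x y)]
      refine strictConvexOn_line hU hC2 (convex_Icc _ _) (fun y hy => ?_) fun y hy => ?_ <;>
        rw [← euclidean_eq_snd]
      exacts [(h x y hx (habs hy)).1, (h x y hx (habs hy)).2]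

theorem image_sublevel (u : EuclideanSpace ℝ (Fin 2) → ℝ) (t : ℝ) :
    euclideanHomeomorphProd '' {y ∈ unitSquare | u y ≤ t} =
      sublevel (fun p => u !₂[p.1, p.2]) t 0 1 0 1 := by
  rw [euclideanHomeomorphProd.image_eq_preimage_symm]
  ext p
  refine and_congr ⟨fun h => ⟨h 0, h 1⟩, fun h i => ?_⟩ Iff.rfl
  fin_cases i
  · exact h.1
  · exact h.2

end

end SublevelTopology

/-- If `Δu ≥ 1` on `(0,1)²`, then every connected component of a sublevel set
`{x ∈ [0,1]² : u(x) ≤ t}` is simply connected. -/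
theorem sublevel_components_simply_connected (u : EuclideanSpace ℝ (Fin 2) → ℝ)
    (hcont : ContinuousOn u unitSquare) (hC2 : ContDiffOn ℝ 2 u openUnitSquare)
    (hlap : ∀ x ∈ openUnitSquare, 1 ≤ laplacian u x) (t : ℝ) :
    ∀ x ∈ {y ∈ unitSquare | u y ≤ t},
      SimplyConnectedSpace (connectedComponentIn {y ∈ unitSquare | u y ≤ t} x) := by
  intro x hx
  have h := (SublevelTopology.isAdmissible_of_one_le_laplacian hcont hC2
    hlap).simplyConnectedSpace zero_lt_one zero_lt_one (t := t)
    (SublevelTopology.image_sublevel u t ▸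
      Set.mem_image_of_mem SublevelTopology.euclideanHomeomorphProd hx)
  rw [← SublevelTopology.image_sublevel, ← Homeomorph.image_connectedComponentIn _ hx] at h
  exact ((Homeomorph.isSimplyConnected_image _).mp h).simplyConnectedSpace
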